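/- Let h(t) = t·ln(1+t) (the Prandtl–Eyring model). Suppose u ∈ C¹(ℝ², ℝ²) is divergence-free and a weak solution of the stationary generalized Navier–Stokes system with dissipative potential H(ε) = h(|ε|), i.e. ∫_{ℝ²} (h'(|ε(u)|)/|ε(u)|) ε(u) : ε(φ) dx + ∫_{ℝ²} u^k ∂_k u^i φ^i dx = 0 for every divergence-free φ ∈ C_c^∞(ℝ², ℝ²). If the energy ∫_{ℝ²} |∇u|·ln(1+|∇u|) dx is finite, then u is a constant vector. -/

import Mathlib

noncomputable section

open MeasureTheory Real Filter

/-- Partial derivative ∂ₖu(x) ∈ ℝⁿ of a vector field u : ℝⁿ → ℝⁿ. -/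
def pd {n : ℕ} (u : EuclideanSpace ℝ (Fin n) → EuclideanSpace ℝ (Fin n))
    (k : Fin n) (x : EuclideanSpace ℝ (Fin n)) : EuclideanSpace ℝ (Fin n) :=
  fderiv ℝ u x (EuclideanSpace.single k 1)

/-- Divergence of u at x. -/
def divg {n : ℕ} (u : EuclideanSpace ℝ (Fin n) → EuclideanSpace ℝ (Fin n))
    (x : EuclideanSpace ℝ (Fin n)) : ℝ :=
  ∑ k, pd u k x k

/-- Symmetric gradient ε(u)(x) = (1/2)(∇u + (∇u)ᵀ), entry (i,j) = (∂ⱼuⁱ + ∂ᵢuʲ)/2. -/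
def symGrad {n : ℕ} (u : EuclideanSpace ℝ (Fin n) → EuclideanSpace ℝ (Fin n))
    (x : EuclideanSpace ℝ (Fin n)) : Matrix (Fin n) (Fin n) ℝ :=
  fun i j => (pd u j x i + pd u i x j) / 2

/-- Full gradient ∇u(x), entry (i,j) = ∂ⱼuⁱ. -/
def gradM {n : ℕ} (u : EuclideanSpace ℝ (Fin n) → EuclideanSpace ℝ (Fin n))
    (x : EuclideanSpace ℝ (Fin n)) : Matrix (Fin n) (Fin n) ℝ :=
  fun i j => pd u j x i

/-- Frobenius inner product A : B. -/
def frob {n : ℕ} (A B : Matrix (Fin n) (Fin n) ℝ) : ℝ := ∑ i, ∑ j, A i j * B i j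

/-- Frobenius norm |A|. -/
def fnorm {n : ℕ} (A : Matrix (Fin n) (Fin n) ℝ) : ℝ := Real.sqrt (frob A A)

/-- DH(ε) = (h'(|ε|)/|ε|) ε, interpreted as 0 at ε = 0. -/
def DH {n : ℕ} (h : ℝ → ℝ) (A : Matrix (Fin n) (Fin n) ℝ) : Matrix (Fin n) (Fin n) ℝ :=
  if fnorm A = 0 then 0 else (deriv h (fnorm A) / fnorm A) • A

/-- u is a weak solution of -div DH(ε(u)) + (u·∇)u + ∇π = 0, div u = 0:
for all smooth compactly supported divergence-free φ,
∫ DH(ε(u)) : ε(φ) dx + ∫ uᵏ ∂ₖuⁱ φⁱ dx = 0. -/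
def IsWeakSolution {n : ℕ} (h : ℝ → ℝ)
    (u : EuclideanSpace ℝ (Fin n) → EuclideanSpace ℝ (Fin n)) : Prop :=
  ∀ φ : EuclideanSpace ℝ (Fin n) → EuclideanSpace ℝ (Fin n),
    ContDiff ℝ (⊤ : ℕ∞) φ → HasCompactSupport φ → (∀ x, divg φ x = 0) →
    (∫ x, frob (DH h (symGrad u x)) (symGrad φ x)) +
      (∫ x, ∑ k, ∑ i, u x k * pd u k x i * φ x i) = 0

/-- u is a weak solution of the Stokes-type system -div DH(ε(u)) + ∇π = 0, div u = 0:
for all smooth compactly supported divergence-free φ, ∫ DH(ε(u)) : ε(φ) dx = 0. -/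
def IsStokesWeakSolution {n : ℕ} (h : ℝ → ℝ)
    (u : EuclideanSpace ℝ (Fin n) → EuclideanSpace ℝ (Fin n)) : Prop :=
  ∀ φ : EuclideanSpace ℝ (Fin n) → EuclideanSpace ℝ (Fin n),
    ContDiff ℝ (⊤ : ℕ∞) φ → HasCompactSupport φ → (∀ x, divg φ x = 0) →
    (∫ x, frob (DH h (symGrad u x)) (symGrad φ x)) = 0

/-- The open square Q_R(x₀) ⊂ ℝ². -/
def sqr (R : ℝ) (x₀ : EuclideanSpace ℝ (Fin 2)) : Set (EuclideanSpace ℝ (Fin 2)) :=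
  {x | |x 0 - x₀ 0| < R ∧ |x 1 - x₀ 1| < R}

/-- h'(t)/t, extended by h''(0) at t = 0. -/
def slopeH (h : ℝ → ℝ) (t : ℝ) : ℝ :=
  if t = 0 then deriv (deriv h) 0 else deriv h t / t


def PD (f f1 f2 : ℝ × ℝ → ℝ) : Prop :=
  ∀ z, HasFDerivAt f (f1 z • ContinuousLinearMap.fst ℝ ℝ ℝ + f2 z • ContinuousLinearMap.snd ℝ ℝ ℝ) z

lemma PD.cont {f f1 f2 : ℝ × ℝ → ℝ} (h : PD f f1 f2) : Continuous f :=
  continuous_iff_continuousAt.2 fun z => (h z).continuousAt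

lemma PD.congr {f f1 f2 f' f1' f2' : ℝ × ℝ → ℝ} (h : PD f f1 f2) (e0 : ∀ z, f' z = f z)
    (e1 : ∀ z, f1' z = f1 z) (e2 : ∀ z, f2' z = f2 z) : PD f' f1' f2' := by
  obtain rfl : f' = f := funext e0
  obtain rfl : f1' = f1 := funext e1
  obtain rfl : f2' = f2 := funext e2
  exact h

lemma PD.add {f f1 f2 g g1 g2 : ℝ × ℝ → ℝ} (h : PD f f1 f2) (k : PD g g1 g2) :
    PD (fun z => f z + g z) (fun z => f1 z + g1 z) (fun z => f2 z + g2 z) := by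
  intro z
  have := (h z).add (k z)
  refine this.congr_fderiv ?_
  ext <;> simp

lemma PD.sub {f f1 f2 g g1 g2 : ℝ × ℝ → ℝ} (h : PD f f1 f2) (k : PD g g1 g2) :
    PD (fun z => f z - g z) (fun z => f1 z - g1 z) (fun z => f2 z - g2 z) := by
  intro z
  have := (h z).sub (k z)
  refine this.congr_fderiv ?_
  ext <;> simp

lemma PD.cmul {f f1 f2 : ℝ × ℝ → ℝ} (c : ℝ) (h : PD f f1 f2) :
    PD (fun z => c * f z) (fun z => c * f1 z) (fun z => c * f2 z) := by
  intro z
  have := (h z).const_mul c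
  refine this.congr_fderiv ?_
  ext <;> simp

lemma PD.mul {f f1 f2 g g1 g2 : ℝ × ℝ → ℝ} (h : PD f f1 f2) (k : PD g g1 g2) :
    PD (fun z => f z * g z) (fun z => f1 z * g z + f z * g1 z)
      (fun z => f2 z * g z + f z * g2 z) := by
  intro z
  have := (h z).mul (k z)
  refine this.congr_fderiv ?_
  ext <;> simp <;> ring

lemma PD.shift {f f1 f2 : ℝ × ℝ → ℝ} (w : ℝ × ℝ) (h : PD f f1 f2) :
    PD (fun z => f (z + w)) (fun z => f1 (z + w)) (fun z => f2 (z + w)) := by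
  intro z
  have := (h (z + w)).comp z ((hasFDerivAt_id z).add_const w)
  refine HasFDerivAt.congr_fderiv (f' := _) this ?_
  ext <;> simp

/-- scalar composition -/
lemma PD.comp1 {f f1 f2 : ℝ × ℝ → ℝ} {φ φ' : ℝ → ℝ} (hφ : ∀ x, HasDerivAt φ (φ' x) x)
    (h : PD f f1 f2) : PD (fun z => φ (f z)) (fun z => φ' (f z) * f1 z)
      (fun z => φ' (f z) * f2 z) := by
  intro z
  have := (hφ (f z)).comp_hasFDerivAt z (h z)
  refine this.congr_fderiv ?_
  ext <;> simp

lemma PD.line {f f1 f2 : ℝ × ℝ → ℝ} (h : PD f f1 f2) (z v : ℝ × ℝ) (s : ℝ) :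
    HasDerivAt (fun s : ℝ => f (z + s • v)) (v.1 * f1 (z + s • v) + v.2 * f2 (z + s • v)) s := by
  have h1 : HasDerivAt (fun s : ℝ => z + s • v) v s := by
    simpa using ((hasDerivAt_id s).smul_const v).const_add z
  have := (h (z + s • v)).comp_hasDerivAt s h1
  refine this.congr_deriv ?_
  simp; ring

lemma PD.dx {f f1 f2 : ℝ × ℝ → ℝ} (h : PD f f1 f2) (x y : ℝ) :
    HasDerivAt (fun s : ℝ => f (s, y)) (f1 (x, y)) x := by
  have := h.line (0, y) (1, 0) x
  simpa using this

lemma PD.dy {f f1 f2 : ℝ × ℝ → ℝ} (h : PD f f1 f2) (x y : ℝ) :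
    HasDerivAt (fun s : ℝ => f (x, s)) (f2 (x, y)) y := by
  have := h.line (x, 0) (0, 1) y
  simpa using this

lemma PD.contDiff_one {f f1 f2 : ℝ × ℝ → ℝ} (h : PD f f1 f2) (h1 : Continuous f1)
    (h2 : Continuous f2) : ContDiff ℝ 1 f := by
  rw [contDiff_one_iff_fderiv]
  refine ⟨fun z => (h z).differentiableAt, ?_⟩
  have : fderiv ℝ f = fun z => f1 z • ContinuousLinearMap.fst ℝ ℝ ℝ
      + f2 z • ContinuousLinearMap.snd ℝ ℝ ℝ := funext fun z => (h z).fderiv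
  rw [this]; fun_prop

lemma PD.of_diff {f : ℝ × ℝ → ℝ} (h : Differentiable ℝ f) :
    PD f (fun z => fderiv ℝ f z (1, 0)) (fun z => fderiv ℝ f z (0, 1)) := by
  intro z
  refine (h z).hasFDerivAt.congr_fderiv ?_
  ext <;> simp

/-- divergence theorem for compactly supported C1 fields -/
lemma PD.integral_zero {A A1 A2 B B1 B2 : ℝ × ℝ → ℝ} (hA : PD A A1 A2) (hB : PD B B1 B2)
    (cA : Continuous A1) (cB : Continuous B2)
    (sA : HasCompactSupport A) (sB : HasCompactSupport B)
    (sA1 : HasCompactSupport A1) (sB2 : HasCompactSupport B2) :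
    ∫ z, (A1 z + B2 z) = 0 := by
  have iA : Integrable A1 := cA.integrable_of_hasCompactSupport sA1
  have iB : Integrable B2 := cB.integrable_of_hasCompactSupport sB2
  rw [integral_add iA iB]
  have e1 : ∫ z, A1 z = 0 := by
    rw [show (volume : Measure (ℝ × ℝ)) = (volume : Measure ℝ).prod volume from rfl,
      integral_prod_symm _ iA]
    have : ∀ y, ∫ x, A1 (x, y) = 0 := by
      intro y
      have cl : Topology.IsClosedEmbedding (fun x : ℝ => (x, y)) := by
        refine Topology.IsClosedEmbedding.of_continuous_injective_isClosedMap (by fun_prop) ?_ ?_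
        · intro a b h; simpa using h
        · exact isClosedMap_prodMk_right y
      have s1 : HasCompactSupport (fun x => A1 (x, y)) := sA1.comp_isClosedEmbedding cl
      have s0 : HasCompactSupport (fun x => A (x, y)) := sA.comp_isClosedEmbedding cl
      have i1 : Integrable (fun x => A1 (x, y)) :=
        (by fun_prop : Continuous (fun x => A1 (x, y))).integrable_of_hasCompactSupport s1
      have i0 : Integrable (fun x => A (x, y)) :=
        (by have := hA.cont; fun_prop : Continuous (fun x => A (x, y))).integrable_of_hasCompactSupport s0
      exact integral_eq_zero_of_hasDerivAt_of_integrable (fun x => hA.dx x y) i1 i0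
    simp [this]
  have e2 : ∫ z, B2 z = 0 := by
    rw [show (volume : Measure (ℝ × ℝ)) = (volume : Measure ℝ).prod volume from rfl,
      integral_prod _ iB]
    have : ∀ x, ∫ y, B2 (x, y) = 0 := by
      intro y
      have cl : Topology.IsClosedEmbedding (fun x : ℝ => (y, x)) := by
        refine Topology.IsClosedEmbedding.of_continuous_injective_isClosedMap (by fun_prop) ?_ ?_
        · intro a b h; simpa using h
        · exact isClosedMap_prodMk_left y
      have s1 : HasCompactSupport (fun x => B2 (y, x)) := sB2.comp_isClosedEmbedding cl
      have s0 : HasCompactSupport (fun x => B (y, x)) := sB.comp_isClosedEmbedding cl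
      have i1 : Integrable (fun x => B2 (y, x)) :=
        (by fun_prop : Continuous (fun x => B2 (y, x))).integrable_of_hasCompactSupport s1
      have i0 : Integrable (fun x => B (y, x)) :=
        (by have := hB.cont; fun_prop : Continuous (fun x => B (y, x))).integrable_of_hasCompactSupport s0
      exact integral_eq_zero_of_hasDerivAt_of_integrable (fun x => hB.dy y x) i1 i0
    simp [this]
  rw [e1, e2, add_zero]

lemma PD.supp {f f1 f2 : ℝ × ℝ → ℝ} (h : PD f f1 f2) (s : HasCompactSupport f) :
    HasCompactSupport f1 ∧ HasCompactSupport f2 := by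
  have hs := s.fderiv ℝ
  have e : fderiv ℝ f = fun z => f1 z • ContinuousLinearMap.fst ℝ ℝ ℝ
      + f2 z • ContinuousLinearMap.snd ℝ ℝ ℝ := funext fun z => (h z).fderiv
  constructor
  · refine hs.mono ?_
    intro z hz
    rw [Function.mem_support, (h z).fderiv]
    intro h0
    apply hz
    have := congrArg (fun L => L ((1:ℝ), (0:ℝ))) h0
    simpa using this
  · refine hs.mono ?_
    intro z hz
    rw [Function.mem_support, (h z).fderiv]
    intro h0
    apply hz
    have := congrArg (fun L => L ((0:ℝ), (1:ℝ))) h0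
    simpa using this

/-- translation-difference integrates to zero -/
lemma integral_shift_sub {H : ℝ × ℝ → ℝ} (w : ℝ × ℝ) (hc : Continuous H)
    (hs : HasCompactSupport H) : ∫ z, (H (z + w) - H z) = 0 := by
  have i : Integrable H := hc.integrable_of_hasCompactSupport hs
  rw [integral_sub (i.comp_add_right w) i, integral_add_right_eq_self, sub_self]

structure J2 where
  f : ℝ × ℝ → ℝ
  f1 : ℝ × ℝ → ℝ
  f2 : ℝ × ℝ → ℝ
  f11 : ℝ × ℝ → ℝ
  f12 : ℝ × ℝ → ℝ
  f22 : ℝ × ℝ → ℝ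
  d0 : PD f f1 f2
  d1 : PD f1 f11 f12
  d2 : PD f2 f12 f22
  c11 : Continuous f11
  c12 : Continuous f12
  c22 : Continuous f22

namespace J2

lemma c0 (F : J2) : Continuous F.f := F.d0.cont
lemma c1 (F : J2) : Continuous F.f1 := F.d1.cont
lemma c2 (F : J2) : Continuous F.f2 := F.d2.cont

attribute [fun_prop] J2.c0 J2.c1 J2.c2 J2.c11 J2.c12 J2.c22

def add (F G : J2) : J2 where
  f z := F.f z + G.f z
  f1 z := F.f1 z + G.f1 z
  f2 z := F.f2 z + G.f2 z
  f11 z := F.f11 z + G.f11 z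
  f12 z := F.f12 z + G.f12 z
  f22 z := F.f22 z + G.f22 z
  d0 := F.d0.add G.d0
  d1 := F.d1.add G.d1
  d2 := F.d2.add G.d2
  c11 := by fun_prop
  c12 := by fun_prop
  c22 := by fun_prop

def cmul (c : ℝ) (F : J2) : J2 where
  f z := c * F.f z
  f1 z := c * F.f1 z
  f2 z := c * F.f2 z
  f11 z := c * F.f11 z
  f12 z := c * F.f12 z
  f22 z := c * F.f22 z
  d0 := F.d0.cmul c
  d1 := F.d1.cmul c
  d2 := F.d2.cmul c
  c11 := by fun_prop
  c12 := by fun_prop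
  c22 := by fun_prop

def shift (w : ℝ × ℝ) (F : J2) : J2 where
  f z := F.f (z + w)
  f1 z := F.f1 (z + w)
  f2 z := F.f2 (z + w)
  f11 z := F.f11 (z + w)
  f12 z := F.f12 (z + w)
  f22 z := F.f22 (z + w)
  d0 := F.d0.shift w
  d1 := F.d1.shift w
  d2 := F.d2.shift w
  c11 := by fun_prop
  c12 := by fun_prop
  c22 := by fun_prop

def mul (F G : J2) : J2 where
  f z := F.f z * G.f z
  f1 z := F.f1 z * G.f z + F.f z * G.f1 z
  f2 z := F.f2 z * G.f z + F.f z * G.f2 z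
  f11 z := F.f11 z * G.f z + 2 * (F.f1 z * G.f1 z) + F.f z * G.f11 z
  f12 z := F.f12 z * G.f z + F.f1 z * G.f2 z + F.f2 z * G.f1 z + F.f z * G.f12 z
  f22 z := F.f22 z * G.f z + 2 * (F.f2 z * G.f2 z) + F.f z * G.f22 z
  d0 := F.d0.mul G.d0
  d1 := ((F.d1.mul G.d0).add (F.d0.mul G.d1)).congr (fun _ => rfl) (fun z => by ring)
    (fun z => by ring)
  d2 := ((F.d2.mul G.d0).add (F.d0.mul G.d2)).congr (fun _ => rfl) (fun z => by ring)
    (fun z => by ring)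
  c11 := by fun_prop
  c12 := by fun_prop
  c22 := by fun_prop

/-- compact support of all derivatives -/
structure CS (F : J2) : Prop where
  s0 : HasCompactSupport F.f
  s1 : HasCompactSupport F.f1
  s2 : HasCompactSupport F.f2
  s11 : HasCompactSupport F.f11
  s12 : HasCompactSupport F.f12
  s22 : HasCompactSupport F.f22

lemma cs (F : J2) (h : HasCompactSupport F.f) : F.CS :=
  ⟨h, (F.d0.supp h).1, (F.d0.supp h).2, (F.d1.supp (F.d0.supp h).1).1,
    (F.d1.supp (F.d0.supp h).1).2, (F.d2.supp (F.d0.supp h).2).2⟩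

def dv (F : J2) (v : ℝ × ℝ) (z : ℝ × ℝ) : ℝ := v.1 * F.f1 z + v.2 * F.f2 z
def d1v (F : J2) (v : ℝ × ℝ) (z : ℝ × ℝ) : ℝ := v.1 * F.f11 z + v.2 * F.f12 z
def d2v (F : J2) (v : ℝ × ℝ) (z : ℝ × ℝ) : ℝ := v.1 * F.f12 z + v.2 * F.f22 z
def dvv (F : J2) (v : ℝ × ℝ) (z : ℝ × ℝ) : ℝ := v.1 * F.d1v v z + v.2 * F.d2v v z

@[fun_prop] lemma cdv (F : J2) (v : ℝ × ℝ) : Continuous (F.dv v) := by unfold dv; fun_prop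
@[fun_prop] lemma cd1v (F : J2) (v : ℝ × ℝ) : Continuous (F.d1v v) := by unfold d1v; fun_prop
@[fun_prop] lemma cd2v (F : J2) (v : ℝ × ℝ) : Continuous (F.d2v v) := by unfold d2v; fun_prop
@[fun_prop] lemma cdvv (F : J2) (v : ℝ × ℝ) : Continuous (F.dvv v) := by unfold dvv; fun_prop

end J2

/-- average along a segment -/
def av (v : ℝ × ℝ) (F : ℝ × ℝ → ℝ) (t : ℝ) (z : ℝ × ℝ) : ℝ :=
  ∫ s in (0:ℝ)..1, F (z + (s * t) • v)

/-- second-difference average -/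
def av2 (v : ℝ × ℝ) (F : ℝ × ℝ → ℝ) (t : ℝ) (z : ℝ × ℝ) : ℝ :=
  ∫ s in (0:ℝ)..1, av v F t (z + (s * t - t) • v)

lemma av_cont (v : ℝ × ℝ) {F : ℝ × ℝ → ℝ} (hF : Continuous F) :
    Continuous (fun w : ℝ × (ℝ × ℝ) => av v F w.1 w.2) := by
  unfold av
  apply intervalIntegral.continuous_parametric_intervalIntegral_of_continuous'
  fun_prop

lemma av2_cont (v : ℝ × ℝ) {F : ℝ × ℝ → ℝ} (hF : Continuous F) :
    Continuous (fun w : ℝ × (ℝ × ℝ) => av2 v F w.1 w.2) := by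
  unfold av2
  apply intervalIntegral.continuous_parametric_intervalIntegral_of_continuous'
  have := av_cont v hF
  exact this.comp (f := fun w : (ℝ × (ℝ × ℝ)) × ℝ => (w.1.1, w.1.2 + (w.2 * w.1.1 - w.1.1) • v)) (by fun_prop)

lemma av_zero (v : ℝ × ℝ) (F : ℝ × ℝ → ℝ) (z : ℝ × ℝ) : av v F 0 z = F z := by
  simp [av]
lemma av2_zero (v : ℝ × ℝ) (F : ℝ × ℝ → ℝ) (z : ℝ × ℝ) : av2 v F 0 z = F z := by
  simp [av2, av_zero]

lemma PD.av_eq {f f1 f2 : ℝ × ℝ → ℝ} (h : PD f f1 f2) (c1 : Continuous f1) (c2 : Continuous f2)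
    (v z : ℝ × ℝ) (t : ℝ) :
    f (z + t • v) = f z + t * av v (fun z => v.1 * f1 z + v.2 * f2 z) t z := by
  have key : ∀ s ∈ Set.uIcc (0:ℝ) 1, HasDerivAt (fun s : ℝ => f (z + (s * t) • v))
      (t * (v.1 * f1 (z + (s * t) • v) + v.2 * f2 (z + (s * t) • v))) s := by
    intro s _
    have h1 := h.line z v (s * t)
    have h2 : HasDerivAt (fun s : ℝ => s * t) t s := by
      simpa using (hasDerivAt_id s).mul_const t
    have := h1.comp s h2
    refine this.congr_deriv ?_
    ring
  have := intervalIntegral.integral_eq_sub_of_hasDerivAt key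
    (by apply Continuous.intervalIntegrable; fun_prop)
  rw [intervalIntegral.integral_const_mul] at this
  unfold av
  rw [this]; simp

namespace J2
lemma av0 (F : J2) (v z : ℝ × ℝ) (t : ℝ) :
    F.f (z + t • v) = F.f z + t * av v (F.dv v) t z := F.d0.av_eq F.c1 F.c2 v z t
lemma av1 (F : J2) (v z : ℝ × ℝ) (t : ℝ) :
    F.f1 (z + t • v) = F.f1 z + t * av v (F.d1v v) t z := F.d1.av_eq F.c11 F.c12 v z t
lemma av2' (F : J2) (v z : ℝ × ℝ) (t : ℝ) :
    F.f2 (z + t • v) = F.f2 z + t * av v (F.d2v v) t z := F.d2.av_eq F.c12 F.c22 v z t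

lemma avv (F : J2) (v z : ℝ × ℝ) (t : ℝ) :
    F.f (z + t • v) + F.f (z - t • v) - 2 * F.f z = t ^ 2 * av2 v (F.dvv v) t z := by
  -- δf(z) - δf(z - t v)
  have hdv : PD (F.dv v) (fun z => v.1 * F.f11 z + v.2 * F.f12 z)
      (fun z => v.1 * F.f12 z + v.2 * F.f22 z) := (F.d1.cmul v.1).add (F.d2.cmul v.2)
  have e1 := F.av0 v z t
  have e2 := F.av0 v (z - t • v) t
  rw [sub_add_cancel] at e2
  have key : av v (F.dv v) t z - av v (F.dv v) t (z - t • v) = t * av2 v (F.dvv v) t z := by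
    unfold av2
    have : ∀ s : ℝ, F.dv v (z + (s * t) • v) - F.dv v (z - t • v + (s * t) • v)
       = t * av v (F.dvv v) t (z + (s * t - t) • v) := by
      intro s
      have := hdv.av_eq (by fun_prop) (by fun_prop) v (z + (s * t - t) • v) t
      have e : z + (s * t - t) • v + t • v = z + (s * t) • v := by module
      have e' : z - t • v + (s * t) • v = z + (s * t - t) • v := by module
      rw [e] at this
      rw [this, e']
      simp only [add_sub_cancel_left]
      rfl
    rw [← intervalIntegral.integral_const_mul]
    simp_rw [← this]
    unfold av
    rw [intervalIntegral.integral_sub]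
    · apply Continuous.intervalIntegrable; fun_prop
    · apply Continuous.intervalIntegrable; fun_prop
  linear_combination e1 - e2 + t * key
end J2

/-- derivative of t log(1+t) -/
def hp (r : ℝ) : ℝ := Real.log (1 + r) + r / (1 + r)

def kap (r : ℝ) : ℝ := if r = 0 then 2 else hp r / r

lemma kap_mul (r : ℝ) : kap r * r = hp r := by
  unfold kap
  split_ifs with h
  · simp [h, hp]
  · field_simp

lemma hp_mono_lower {s r : ℝ} (hs : 0 ≤ s) (h : s ≤ r) : (r - s) / (1 + r) ≤ hp r - hp s := by
  have h1 : 0 < 1 + s := by linarith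
  have h2 : 0 < 1 + r := by linarith
  have hl : Real.log (1 + r) - Real.log (1 + s) ≥ (r - s) / (1 + r) := by
    have := Real.log_le_sub_one_of_pos (div_pos h1 h2)
    rw [Real.log_div h1.ne' h2.ne'] at this
    have e : (r - s) / (1 + r) = 1 - (1 + s) / (1 + r) := by field_simp; ring
    rw [e]; linarith
  have hd : s / (1 + s) ≤ r / (1 + r) := by
    rw [div_le_div_iff₀ h1 h2]; nlinarith
  unfold hp; linarith

lemma hp_upper {s r : ℝ} (hs : 0 ≤ s) (h : s ≤ r) : hp r - hp s ≤ 2 * (r - s) := by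
  have h1 : 0 < 1 + s := by linarith
  have h2 : 0 < 1 + r := by linarith
  have hl : Real.log (1 + r) - Real.log (1 + s) ≤ r - s := by
    have := Real.log_le_sub_one_of_pos (div_pos h2 h1)
    rw [Real.log_div h2.ne' h1.ne'] at this
    have e : (1 + r) / (1 + s) - 1 = (r - s) / (1 + s) := by field_simp; ring
    rw [e] at this
    have : (r - s) / (1 + s) ≤ r - s := div_le_self (by linarith) (by linarith)
    linarith
  have hd : r / (1 + r) - s / (1 + s) ≤ r - s := by
    have e : r / (1 + r) - s / (1 + s) = (r - s) / ((1 + r) * (1 + s)) := by field_simp; ring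
    rw [e]; exact div_le_self (by linarith) (by nlinarith)
  unfold hp; linarith

lemma hp_zero : hp 0 = 0 := by simp [hp]

lemma kap_lower {r : ℝ} (hr : 0 ≤ r) : 1 / (1 + r) ≤ kap r := by
  unfold kap
  split_ifs with h
  · simp [h]
  · have hr' : 0 < r := lt_of_le_of_ne hr (Ne.symm h)
    have := hp_mono_lower le_rfl hr
    rw [hp_zero] at this
    rw [le_div_iff₀ hr']
    calc 1 / (1 + r) * r = (r - 0) / (1 + r) := by ring
      _ ≤ _ := by linarith

lemma kap_upper {r : ℝ} (hr : 0 ≤ r) : kap r ≤ 2 := by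
  unfold kap
  split_ifs with h
  · rfl
  · have hr' : 0 < r := lt_of_le_of_ne hr (Ne.symm h)
    have := hp_upper le_rfl hr
    rw [hp_zero] at this
    rw [div_le_iff₀ hr']; linarith

def rr (p q : ℝ) : ℝ := Real.sqrt (2 * p ^ 2 + 2 * q ^ 2)

lemma rr_nonneg (p q : ℝ) : 0 ≤ rr p q := Real.sqrt_nonneg _
lemma rr_sq (p q : ℝ) : rr p q ^ 2 = 2 * p ^ 2 + 2 * q ^ 2 := Real.sq_sqrt (by positivity)

lemma G_ineq_aux (p q p' q' : ℝ) :
    2 * (p * p' + q * q') ≤ rr p q * rr p' q' := by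
  unfold rr
  rw [← Real.sqrt_mul (by positivity)]
  apply Real.le_sqrt_of_sq_le
  nlinarith [sq_nonneg (p * q' - q * p')]

lemma G_both (p q p' q' : ℝ) :
    let r := rr p q; let s := rr p' q'
    let A := kap r; let B := kap s
    let m := (A * q - B * q') * (q - q') + (A * p - B * p') * (p - p')
    ((p - p') ^ 2 + (q - q') ^ 2) / (1 + r + s) ≤ m ∧
    (A * q - B * q') ^ 2 + (A * p - B * p') ^ 2 ≤ 2 * m := by
  intro r s A B m
  have hr : 0 ≤ r := rr_nonneg _ _
  have hs : 0 ≤ s := rr_nonneg _ _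
  have hr2 : r ^ 2 = 2 * p ^ 2 + 2 * q ^ 2 := rr_sq _ _
  have hs2 : s ^ 2 = 2 * p' ^ 2 + 2 * q' ^ 2 := rr_sq _ _
  set c := 2 * (p * p' + q * q') with hc
  have hcs : 0 ≤ r * s - c := sub_nonneg.2 (G_ineq_aux p q p' q')
  have hA := kap_lower hr
  have hB := kap_lower hs
  have hA2 := kap_upper hr
  have hB2 := kap_upper hs
  have hAr : A * r = hp r := kap_mul r
  have hBs : B * s = hp s := kap_mul s
  have hA0 : 0 ≤ A := le_trans (by positivity) hA
  have hB0 : 0 ≤ B := le_trans (by positivity) hB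
  have em : 2 * m = (A * r - B * s) * (r - s) + (A + B) * (r * s - c) := by
    simp only [m, hc]
    linear_combination -A * hr2 - B * hs2
  have ed : 2 * ((p - p') ^ 2 + (q - q') ^ 2) = (r - s) ^ 2 + 2 * (r * s - c) := by
    rw [hc]; linear_combination -hr2 - hs2
  have eG : 2 * ((A * q - B * q') ^ 2 + (A * p - B * p') ^ 2)
      = (A * r - B * s) ^ 2 + 2 * A * B * (r * s - c) := by
    rw [hc]; linear_combination -A ^ 2 * hr2 - B ^ 2 * hs2
  have h1 : (r - s) ^ 2 / (1 + r + s) ≤ (A * r - B * s) * (r - s) := by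
    rw [hAr, hBs]
    rcases le_total s r with h | h
    · have := hp_mono_lower hs h
      have h3 : (r - s) / (1 + r + s) ≤ (r - s) / (1 + r) :=
        div_le_div_of_nonneg_left (by linarith) (by linarith) (by linarith)
      calc (r - s) ^ 2 / (1 + r + s) = ((r - s) / (1 + r + s)) * (r - s) := by ring
        _ ≤ _ := mul_le_mul_of_nonneg_right (h3.trans this) (by linarith)
    · have := hp_mono_lower hr h
      have h3 : (s - r) / (1 + r + s) ≤ (s - r) / (1 + s) :=
        div_le_div_of_nonneg_left (by linarith) (by linarith) (by linarith)
      calc (r - s) ^ 2 / (1 + r + s) = ((s - r) / (1 + r + s)) * (s - r) := by ring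
        _ ≤ (hp s - hp r) * (s - r) := mul_le_mul_of_nonneg_right (h3.trans this) (by linarith)
        _ = _ := by ring
  have h2 : (A * r - B * s) ^ 2 ≤ 2 * ((A * r - B * s) * (r - s)) := by
    rw [hAr, hBs]
    rcases le_total s r with h | h
    · have u := hp_upper hs h
      have l := hp_mono_lower hs h
      have : 0 ≤ (r - s) / (1 + r) := div_nonneg (by linarith) (by linarith)
      nlinarith
    · have u := hp_upper hr h
      have l := hp_mono_lower hr h
      have : 0 ≤ (s - r) / (1 + s) := div_nonneg (by linarith) (by linarith)
      nlinarith
  constructor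
  · have h3 : 2 / (1 + r + s) ≤ A + B := by
      have a1 : 1 / (1 + r + s) ≤ 1 / (1 + r) :=
        div_le_div_of_nonneg_left (by linarith) (by linarith) (by linarith)
      have a2 : 1 / (1 + r + s) ≤ 1 / (1 + s) :=
        div_le_div_of_nonneg_left (by linarith) (by linarith) (by linarith)
      have : 2 / (1 + r + s) = 1 / (1 + r + s) + 1 / (1 + r + s) := by ring
      rw [this]; exact add_le_add (a1.trans hA) (a2.trans hB)
    have h4 : 2 / (1 + r + s) * (r * s - c) ≤ (A + B) * (r * s - c) :=
      mul_le_mul_of_nonneg_right h3 hcs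
    have : 2 * (((p - p') ^ 2 + (q - q') ^ 2) / (1 + r + s)) =
      (r - s) ^ 2 / (1 + r + s) + 2 / (1 + r + s) * (r * s - c) := by
      rw [← mul_div_assoc, ed]; ring
    linarith
  · have h3 : A * B ≤ A + B := by nlinarith
    have h4 : A * B * (r * s - c) ≤ (A + B) * (r * s - c) :=
      mul_le_mul_of_nonneg_right h3 hcs
    linarith

lemma m_nonneg (p q p' q' : ℝ) :
    0 ≤ (kap (rr p q) * q - kap (rr p' q') * q') * (q - q')
      + (kap (rr p q) * p - kap (rr p' q') * p') * (p - p') := by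
  refine le_trans ?_ (G_both p q p' q').1
  have := rr_nonneg p q
  have := rr_nonneg p' q'
  positivity

lemma G_lip (p q p' q' : ℝ) :
    (kap (rr p q) * q - kap (rr p' q') * q') ^ 2 + (kap (rr p q) * p - kap (rr p' q') * p') ^ 2
     ≤ 4 * ((q - q') ^ 2 + (p - p') ^ 2) := by
  have h := (G_both p q p' q').2
  nlinarith [sq_nonneg (kap (rr p q) * q - kap (rr p' q') * q' - 2 * (q - q')),
    sq_nonneg (kap (rr p q) * p - kap (rr p' q') * p' - 2 * (p - p'))]

lemma G_cont : Continuous (fun w : ℝ × ℝ => kap (rr w.1 w.2) * w.2) ∧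
    Continuous (fun w : ℝ × ℝ => kap (rr w.1 w.2) * w.1) := by
  have key : ∀ a b : ℝ × ℝ, 4 * ((a.2 - b.2) ^ 2 + (a.1 - b.1) ^ 2) ≤ (4 * dist a b) ^ 2 := by
    intro a b
    have h1 : |a.1 - b.1| ≤ dist a b := by
      rw [← Real.dist_eq]; exact le_max_left _ _
    have h2 : |a.2 - b.2| ≤ dist a b := by
      rw [← Real.dist_eq]; exact le_max_right _ _
    have h0 : 0 ≤ dist a b := dist_nonneg
    have h1' := sq_le_sq' (by linarith [abs_nonneg (a.1 - b.1)]) h1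
    have h2' := sq_le_sq' (by linarith [abs_nonneg (a.2 - b.2)]) h2
    rw [sq_abs] at h1' h2'
    nlinarith
  constructor
  · refine (LipschitzWith.of_dist_le_mul (K := 4) ?_).continuous
    intro a b
    have := G_lip a.1 a.2 b.1 b.2
    rw [Real.dist_eq]
    refine abs_le_of_sq_le_sq ?_ (by positivity)
    simp only [NNReal.coe_ofNat]
    nlinarith [key a b, sq_nonneg (kap (rr a.1 a.2) * a.1 - kap (rr b.1 b.2) * b.1)]
  · refine (LipschitzWith.of_dist_le_mul (K := 4) ?_).continuous
    intro a b
    have := G_lip a.1 a.2 b.1 b.2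
    rw [Real.dist_eq]
    refine abs_le_of_sq_le_sq ?_ (by positivity)
    simp only [NNReal.coe_ofNat]
    nlinarith [key a b, sq_nonneg (kap (rr a.1 a.2) * a.2 - kap (rr b.1 b.2) * b.2)]

namespace J2
/-- p, q, r, P, Q, b1, b2 of a stream function -/
def p (ψ : J2) (z : ℝ × ℝ) : ℝ := - ψ.f12 z
def q (ψ : J2) (z : ℝ × ℝ) : ℝ := (ψ.f11 z - ψ.f22 z) / 2
def r (ψ : J2) (z : ℝ × ℝ) : ℝ := rr (ψ.p z) (ψ.q z)
def P (ψ : J2) (z : ℝ × ℝ) : ℝ := kap (ψ.r z) * ψ.p z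
def Q (ψ : J2) (z : ℝ × ℝ) : ℝ := kap (ψ.r z) * ψ.q z
def b1 (ψ : J2) (z : ℝ × ℝ) : ℝ := - ψ.f2 z * ψ.f11 z + ψ.f1 z * ψ.f12 z
def b2 (ψ : J2) (z : ℝ × ℝ) : ℝ := - ψ.f2 z * ψ.f12 z + ψ.f1 z * ψ.f22 z
def gg (ψ : J2) (z : ℝ × ℝ) : ℝ := ψ.f11 z ^ 2 + 2 * ψ.f12 z ^ 2 + ψ.f22 z ^ 2
/-- |u|² -/
def uu (ψ : J2) (z : ℝ × ℝ) : ℝ := ψ.f1 z ^ 2 + ψ.f2 z ^ 2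

@[fun_prop] lemma cp (ψ : J2) : Continuous ψ.p := by unfold p; fun_prop
@[fun_prop] lemma cq (ψ : J2) : Continuous ψ.q := by unfold q; fun_prop
@[fun_prop] lemma cr (ψ : J2) : Continuous ψ.r := by unfold r rr; fun_prop
@[fun_prop] lemma cP (ψ : J2) : Continuous ψ.P :=
  G_cont.2.comp (f := fun z => (ψ.p z, ψ.q z)) (by fun_prop)
@[fun_prop] lemma cQ (ψ : J2) : Continuous ψ.Q :=
  G_cont.1.comp (f := fun z => (ψ.p z, ψ.q z)) (by fun_prop)
@[fun_prop] lemma cb1 (ψ : J2) : Continuous ψ.b1 := by unfold b1; fun_prop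
@[fun_prop] lemma cb2 (ψ : J2) : Continuous ψ.b2 := by unfold b2; fun_prop
@[fun_prop] lemma cgg (ψ : J2) : Continuous ψ.gg := by unfold gg; fun_prop
@[fun_prop] lemma cuu (ψ : J2) : Continuous ψ.uu := by unfold uu; fun_prop

lemma r_nonneg (ψ : J2) (z : ℝ × ℝ) : 0 ≤ ψ.r z := rr_nonneg _ _
lemma r_sq_le (ψ : J2) (z : ℝ × ℝ) : ψ.r z ^ 2 ≤ ψ.gg z := by
  unfold r gg; rw [rr_sq]; unfold p q; nlinarith [sq_nonneg (ψ.f11 z + ψ.f22 z)]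

/-- weak form integrand -/
def wf (ψ : J2) (F : J2) (z : ℝ × ℝ) : ℝ :=
  ψ.Q z * (F.f11 z - F.f22 z) - 2 * ψ.P z * F.f12 z + ψ.b1 z * F.f1 z + ψ.b2 z * F.f2 z

/-- weak solution tested against C2 functions -/
def Weak (ψ : J2) : Prop := ∀ F : J2, HasCompactSupport F.f → ∫ z, ψ.wf F z = 0

/-- monotonicity quantity -/
def mm (ψ : J2) (w z : ℝ × ℝ) : ℝ :=
  (ψ.Q (z + w) - ψ.Q z) * (ψ.q (z + w) - ψ.q z) + (ψ.P (z + w) - ψ.P z) * (ψ.p (z + w) - ψ.p z)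

lemma mm_lower (ψ : J2) (w z : ℝ × ℝ) :
    ((ψ.p (z + w) - ψ.p z) ^ 2 + (ψ.q (z + w) - ψ.q z) ^ 2) / (1 + ψ.r (z + w) + ψ.r z)
      ≤ ψ.mm w z := (G_both (ψ.p (z + w)) (ψ.q (z + w)) (ψ.p z) (ψ.q z)).1
lemma mm_PQ (ψ : J2) (w z : ℝ × ℝ) :
    (ψ.Q (z + w) - ψ.Q z) ^ 2 + (ψ.P (z + w) - ψ.P z) ^ 2 ≤ 2 * ψ.mm w z :=
  (G_both (ψ.p (z + w)) (ψ.q (z + w)) (ψ.p z) (ψ.q z)).2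
lemma mm_nonneg (ψ : J2) (w z : ℝ × ℝ) : 0 ≤ ψ.mm w z :=
  m_nonneg (ψ.p (z + w)) (ψ.q (z + w)) (ψ.p z) (ψ.q z)
lemma cmm (ψ : J2) (w : ℝ × ℝ) : Continuous (ψ.mm w) := by unfold mm; fun_prop

end J2

namespace J2

/-- test function -/
def tst (ψ η : J2) (w : ℝ × ℝ) : J2 :=
  (η.mul η).mul (((ψ.shift w).add (ψ.shift (-w))).add (ψ.cmul (-2)))

def HH (ψ ζ : J2) (w z : ℝ × ℝ) : ℝ :=
  2 * ζ.f z * ψ.Q z * (ψ.q z - ψ.q (z + -w)) + 2 * ζ.f z * ψ.P z * (ψ.p z - ψ.p (z + -w))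
  + (2 * ψ.Q z * ζ.f1 z - 2 * ψ.P z * ζ.f2 z) * (ψ.f1 z - ψ.f1 (z + -w))
  - (2 * ψ.Q z * ζ.f2 z + 2 * ψ.P z * ζ.f1 z) * (ψ.f2 z - ψ.f2 (z + -w))
  - 2 * (ψ.Q z * ψ.q z + ψ.P z * ψ.p z) * (ζ.f z - ζ.f (z + -w))
  + ζ.f z * ψ.b1 z * (ψ.f1 z - ψ.f1 (z + -w))
  + ζ.f z * ψ.b2 z * (ψ.f2 z - ψ.f2 (z + -w))

/-- sum of squared differences of first derivatives -/
def ee (ψ : J2) (w z : ℝ × ℝ) : ℝ :=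
  (ψ.f1 (z + w) - ψ.f1 z) ^ 2 + (ψ.f2 (z + w) - ψ.f2 z) ^ 2

lemma ee_PD (ψ : J2) (w : ℝ × ℝ) : PD (ψ.ee w)
    (fun z => 2 * ((ψ.f1 (z + w) - ψ.f1 z) * (ψ.f11 (z + w) - ψ.f11 z)
      + (ψ.f2 (z + w) - ψ.f2 z) * (ψ.f12 (z + w) - ψ.f12 z)))
    (fun z => 2 * ((ψ.f1 (z + w) - ψ.f1 z) * (ψ.f12 (z + w) - ψ.f12 z)
      + (ψ.f2 (z + w) - ψ.f2 z) * (ψ.f22 (z + w) - ψ.f22 z))) := by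
  have h1 := (ψ.d1.shift w).sub ψ.d1
  have h2 := (ψ.d2.shift w).sub ψ.d2
  refine ((h1.mul h1).add (h2.mul h2)).congr ?_ ?_ ?_ <;> intro z <;> (try simp only [ee]) <;> ring

def dA (ψ ζ : J2) (w z : ℝ × ℝ) : ℝ :=
  (1 / 2) * ((ζ.f1 z * ψ.f2 z + ζ.f z * ψ.f12 z) * ψ.ee w z + ζ.f z * ψ.f2 z *
    (2 * ((ψ.f1 (z + w) - ψ.f1 z) * (ψ.f11 (z + w) - ψ.f11 z)
      + (ψ.f2 (z + w) - ψ.f2 z) * (ψ.f12 (z + w) - ψ.f12 z))))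
def dB (ψ ζ : J2) (w z : ℝ × ℝ) : ℝ :=
  (-1 / 2) * ((ζ.f2 z * ψ.f1 z + ζ.f z * ψ.f12 z) * ψ.ee w z + ζ.f z * ψ.f1 z *
    (2 * ((ψ.f1 (z + w) - ψ.f1 z) * (ψ.f12 (z + w) - ψ.f12 z)
      + (ψ.f2 (z + w) - ψ.f2 z) * (ψ.f22 (z + w) - ψ.f22 z))))

/-- differences -/
def df (F : ℝ × ℝ → ℝ) (w z : ℝ × ℝ) : ℝ := F (z + w) - F z

lemma wf_id (ψ ζ : J2) (w z : ℝ × ℝ) :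
    ψ.wf (ζ.mul (((ψ.shift w).add (ψ.shift (-w))).add (ψ.cmul (-2)))) z =
    -2 * ζ.f (z + w) * ψ.mm w z
    + (ψ.Q (z + w) - ψ.Q z) * (2 * df ζ.f w z * ψ.q (z + w) - 2 * ζ.f1 (z + w) * df ψ.f1 w z
        + 2 * ζ.f2 (z + w) * df ψ.f2 w z)
    + (ψ.P (z + w) - ψ.P z) * (2 * df ζ.f w z * ψ.p (z + w) + 2 * ζ.f2 (z + w) * df ψ.f1 w z
        + 2 * ζ.f1 (z + w) * df ψ.f2 w z)
    + (-2 * (ψ.Q z * df ζ.f1 w z - ψ.P z * df ζ.f2 w z) * df ψ.f1 w z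
       + 2 * (ψ.Q z * df ζ.f2 w z + ψ.P z * df ζ.f1 w z) * df ψ.f2 w z
       + 2 * (ψ.Q z * ψ.q z + ψ.P z * ψ.p z) * (ζ.f (z + w) + ζ.f (z + -w) - 2 * ζ.f z)
       + (ψ.Q z * (ζ.f11 z - ζ.f22 z) - 2 * ψ.P z * ζ.f12 z)
          * (ψ.f (z + w) + ψ.f (z + -w) - 2 * ψ.f z))
    + ((ζ.f (z + w) * ψ.f2 (z + w) - ζ.f z * ψ.f2 z) * (ψ.f11 (z + w) * df ψ.f1 w z + ψ.f12 (z + w) * df ψ.f2 w z)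
      - (ζ.f (z + w) * ψ.f1 (z + w) - ζ.f z * ψ.f1 z) * (ψ.f12 (z + w) * df ψ.f1 w z + ψ.f22 (z + w) * df ψ.f2 w z)
      + (1 / 2) * (-ζ.f1 z * ψ.f2 z + ζ.f2 z * ψ.f1 z) * (df ψ.f1 w z ^ 2 + df ψ.f2 w z ^ 2)
      + (ψ.b1 z * ζ.f1 z + ψ.b2 z * ζ.f2 z) * (ψ.f (z + w) + ψ.f (z + -w) - 2 * ψ.f z))
    + (ψ.HH ζ w (z + w) - ψ.HH ζ w z) + (ψ.dA ζ w z + ψ.dB ζ w z) := by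
  simp only [HH, dA, dB, wf, mm, ee, df, add_neg_cancel_right, J2.mul, J2.add, J2.shift, J2.cmul, q, p, b1, b2]
  ring

/-- remainder integrand -/
def Rint (ψ η : J2) (v : ℝ × ℝ) (t : ℝ) (z : ℝ × ℝ) : ℝ :=
  (1 / 2) * ((4 * (av v (η.dv v) t z * ψ.q (z + t • v) - η.f1 (z + t • v) * av v (ψ.d1v v) t z
      + η.f2 (z + t • v) * av v (ψ.d2v v) t z)) ^ 2
    + (4 * (av v (η.dv v) t z * ψ.p (z + t • v) + η.f2 (z + t • v) * av v (ψ.d1v v) t z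
      + η.f1 (z + t • v) * av v (ψ.d2v v) t z)) ^ 2)
  - 2 * ((ψ.Q (z + t • v) - ψ.Q z) * ψ.q (z + t • v) + (ψ.P (z + t • v) - ψ.P z) * ψ.p (z + t • v))
      * (av v (η.dv v) t z) ^ 2
  + (-2 * (ψ.Q z * av v ((η.mul η).d1v v) t z - ψ.P z * av v ((η.mul η).d2v v) t z) * av v (ψ.d1v v) t z
     + 2 * (ψ.Q z * av v ((η.mul η).d2v v) t z + ψ.P z * av v ((η.mul η).d1v v) t z) * av v (ψ.d2v v) t z
     + 2 * (ψ.Q z * ψ.q z + ψ.P z * ψ.p z) * av2 v ((η.mul η).dvv v) t z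
     + (ψ.Q z * ((η.mul η).f11 z - (η.mul η).f22 z) - 2 * ψ.P z * (η.mul η).f12 z) * av2 v (ψ.dvv v) t z)
  + (((η.f z + η.f (z + t • v)) * av v (η.dv v) t z * ψ.f2 (z + t • v) + η.f z * η.f z * av v (ψ.d2v v) t z)
        * (ψ.f11 (z + t • v) * av v (ψ.d1v v) t z + ψ.f12 (z + t • v) * av v (ψ.d2v v) t z)
     - ((η.f z + η.f (z + t • v)) * av v (η.dv v) t z * ψ.f1 (z + t • v) + η.f z * η.f z * av v (ψ.d1v v) t z)
        * (ψ.f12 (z + t • v) * av v (ψ.d1v v) t z + ψ.f22 (z + t • v) * av v (ψ.d2v v) t z)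
     + (1 / 2) * (-(η.mul η).f1 z * ψ.f2 z + (η.mul η).f2 z * ψ.f1 z)
        * (av v (ψ.d1v v) t z ^ 2 + av v (ψ.d2v v) t z ^ 2)
     + (ψ.b1 z * (η.mul η).f1 z + ψ.b2 z * (η.mul η).f2 z) * av2 v (ψ.dvv v) t z)

lemma wf_le (ψ η : J2) (v : ℝ × ℝ) (t : ℝ) (z : ℝ × ℝ) :
    ψ.wf (ψ.tst η (t • v)) z ≤ -(η.f (z + t • v) ^ 2 * ψ.mm (t • v) z) + t ^ 2 * ψ.Rint η v t z
      + (ψ.HH (η.mul η) (t • v) (z + t • v) - ψ.HH (η.mul η) (t • v) z)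
      + (ψ.dA (η.mul η) (t • v) z + ψ.dB (η.mul η) (t • v) z) := by
  unfold tst
  rw [wf_id]
  have hPQ := ψ.mm_PQ (t • v) z
  generalize ψ.HH (η.mul η) (t • v) (z + t • v) - ψ.HH (η.mul η) (t • v) z = X
  generalize ψ.dA (η.mul η) (t • v) z + ψ.dB (η.mul η) (t • v) z = Y
  generalize ψ.mm (t • v) z = M at *
  have hψ1 := ψ.av1 v z t
  have hψ2 := ψ.av2' v z t
  have hψ := ψ.avv v z t
  have hζ1 := (η.mul η).av1 v z t
  have hζ2 := (η.mul η).av2' v z t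
  have hζ := (η.mul η).avv v z t
  have hη := η.av0 v z t
  unfold Rint
  rw [sub_eq_add_neg z (t • v)] at hψ hζ
  simp only [df]
  rw [hψ, hζ]
  generalize av2 v (ψ.dvv v) t z = DD at *
  generalize av2 v ((η.mul η).dvv v) t z = ZZ at *
  generalize av v (ψ.d1v v) t z = D1 at *
  generalize av v (ψ.d2v v) t z = D2 at *
  generalize av v ((η.mul η).d1v v) t z = Z1 at *
  generalize av v ((η.mul η).d2v v) t z = Z2 at *
  generalize av v (η.dv v) t z = dη at *
  have z1p : (η.mul η).f1 (z + t • v) = 2 * η.f (z + t • v) * η.f1 (z + t • v) := by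
    simp only [J2.mul]; ring
  have z2p : (η.mul η).f2 (z + t • v) = 2 * η.f (z + t • v) * η.f2 (z + t • v) := by
    simp only [J2.mul]; ring
  have z0p : (η.mul η).f (z + t • v) = η.f (z + t • v) * η.f (z + t • v) := rfl
  have z0 : (η.mul η).f z = η.f z * η.f z := rfl
  have e1 : (η.mul η).f1 (z + t • v) - (η.mul η).f1 z = t * Z1 := by rw [hζ1]; ring
  have e2 : (η.mul η).f2 (z + t • v) - (η.mul η).f2 z = t * Z2 := by rw [hζ2]; ring
  rw [e1, e2, z1p, z2p, z0p, z0]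
  clear hζ1 hζ2 hζ hψ e1 e2 z1p z2p z0p z0
  generalize (η.mul η).f1 z = zz1
  generalize (η.mul η).f2 z = zz2
  generalize (η.mul η).f11 z = zz11
  generalize (η.mul η).f12 z = zz12
  generalize (η.mul η).f22 z = zz22
  generalize η.f1 (z + t • v) = η1
  generalize η.f2 (z + t • v) = η2
  generalize η.f (z + t • v) = ηp at *
  generalize ψ.f1 (z + t • v) = ψ1p at *
  generalize ψ.f2 (z + t • v) = ψ2p at *
  generalize η.f z = η0 at *
  generalize ψ.f1 z = ψ1 at *
  generalize ψ.f2 z = ψ2 at *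
  generalize ψ.f11 (z + t • v) = a11
  generalize ψ.f12 (z + t • v) = a12
  generalize ψ.f22 (z + t • v) = a22
  generalize ψ.q (z + t • v) = qp
  generalize ψ.p (z + t • v) = pp
  generalize ψ.q z = q0
  generalize ψ.p z = p0
  generalize ψ.Q (z + t • v) = Qp at *
  generalize ψ.P (z + t • v) = Pp at *
  generalize ψ.Q z = Q0 at *
  generalize ψ.P z = P0 at *
  generalize ψ.b1 z = b1 at *
  generalize ψ.b2 z = b2 at *
  subst hη hψ1 hψ2
  have s1 := sq_nonneg ((η0 + t * dη) * (Qp - Q0) - t * (4 * (dη * qp - η1 * D1 + η2 * D2)))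
  have s2 := sq_nonneg ((η0 + t * dη) * (Pp - P0) - t * (4 * (dη * pp + η2 * D1 + η1 * D2)))
  have s3 := mul_nonneg (sq_nonneg (η0 + t * dη)) (sub_nonneg.2 hPQ)
  linear_combination (1 / 2) * s1 + (1 / 2) * s2 + (1 / 2) * s3

end J2

lemma av_eq_zero {v z : ℝ × ℝ} {F : ℝ × ℝ → ℝ} {t : ℝ}
    (h : ∀ a : ℝ, |a| ≤ 1 → F (z + (a * t) • v) = 0) : av v F t z = 0 := by
  unfold av
  rw [intervalIntegral.integral_congr (g := fun _ => (0:ℝ))]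
  · simp
  · intro s hs
    rw [Set.uIcc_of_le zero_le_one] at hs
    exact h s (abs_le.2 ⟨by linarith [hs.1], hs.2⟩)

lemma av2_eq_zero {v z : ℝ × ℝ} {F : ℝ × ℝ → ℝ} {t : ℝ}
    (h : ∀ a : ℝ, |a| ≤ 1 → F (z + (a * t) • v) = 0) : av2 v F t z = 0 := by
  unfold av2
  rw [intervalIntegral.integral_congr (g := fun _ => (0:ℝ))]
  · simp
  · intro s hs
    rw [Set.uIcc_of_le zero_le_one] at hs
    simp only
    unfold av
    rw [intervalIntegral.integral_congr (g := fun _ => (0:ℝ))]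
    · simp
    · intro s' hs'
      rw [Set.uIcc_of_le zero_le_one] at hs'
      simp only
      have := h (s + s' - 1) (abs_le.2 ⟨by linarith [hs.1, hs'.1], by linarith [hs.2, hs'.2]⟩)
      rw [← this]
      congr 1
      module

namespace J2

structure Far (η : J2) (ρ : ℝ) : Prop where
  v0 : ∀ z, ρ < ‖z‖ → η.f z = 0
  v1 : ∀ z, ρ < ‖z‖ → η.f1 z = 0
  v2 : ∀ z, ρ < ‖z‖ → η.f2 z = 0
  v11 : ∀ z, ρ < ‖z‖ → η.f11 z = 0
  v12 : ∀ z, ρ < ‖z‖ → η.f12 z = 0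
  v22 : ∀ z, ρ < ‖z‖ → η.f22 z = 0

lemma cs_bd {f : ℝ × ℝ → ℝ} (h : HasCompactSupport f) : ∃ ρ : ℝ, ∀ z, ρ < ‖z‖ → f z = 0 := by
  obtain ⟨ρ, hρ⟩ := h.isBounded.subset_closedBall 0
  refine ⟨ρ, fun z hz => ?_⟩
  by_contra hne
  have := hρ (subset_tsupport f hne)
  rw [mem_closedBall_zero_iff] at this
  linarith

lemma far (η : J2) (h : HasCompactSupport η.f) : ∃ ρ : ℝ, 0 ≤ ρ ∧ η.Far ρ := by
  have c := η.cs h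
  obtain ⟨r0, h0⟩ := cs_bd c.s0
  obtain ⟨r1, h1⟩ := cs_bd c.s1
  obtain ⟨r2, h2⟩ := cs_bd c.s2
  obtain ⟨r3, h3⟩ := cs_bd c.s11
  obtain ⟨r4, h4⟩ := cs_bd c.s12
  obtain ⟨r5, h5⟩ := cs_bd c.s22
  refine ⟨|r0| + |r1| + |r2| + |r3| + |r4| + |r5|, by positivity, ⟨?_, ?_, ?_, ?_, ?_, ?_⟩⟩
  all_goals
    intro z hz
    have a0 := abs_nonneg r0
    have a1 := abs_nonneg r1
    have a2 := abs_nonneg r2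
    have a3 := abs_nonneg r3
    have a4 := abs_nonneg r4
    have a5 := abs_nonneg r5
    have b0 := le_abs_self r0
    have b1 := le_abs_self r1
    have b2 := le_abs_self r2
    have b3 := le_abs_self r3
    have b4 := le_abs_self r4
    have b5 := le_abs_self r5
  exacts [h0 z (by linarith), h1 z (by linarith), h2 z (by linarith), h3 z (by linarith),
    h4 z (by linarith), h5 z (by linarith)]

lemma Far.sq {η : J2} {ρ : ℝ} (h : η.Far ρ) : (η.mul η).Far ρ where
  v0 z hz := by simp [J2.mul, h.v0 z hz]
  v1 z hz := by simp [J2.mul, h.v0 z hz]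
  v2 z hz := by simp [J2.mul, h.v0 z hz]
  v11 z hz := by simp [J2.mul, h.v0 z hz, h.v1 z hz]
  v12 z hz := by simp [J2.mul, h.v0 z hz, h.v1 z hz]
  v22 z hz := by simp [J2.mul, h.v0 z hz, h.v2 z hz]

lemma cs_of_far {f : ℝ × ℝ → ℝ} (ρ : ℝ) (h : ∀ z, ρ < ‖z‖ → f z = 0) : HasCompactSupport f := by
  refine HasCompactSupport.intro (isCompact_closedBall (0 : ℝ × ℝ) ρ) fun z hz => h z ?_
  rw [mem_closedBall_zero_iff] at hz
  linarith

lemma norm_far {ρ c : ℝ} {z s : ℝ × ℝ} (hz : ρ + c < ‖z‖) (hs : ‖s‖ ≤ c) : ρ < ‖z + s‖ := by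
  have : ‖z‖ ≤ ‖z + s‖ + ‖s‖ := by
    calc ‖z‖ = ‖(z + s) - s‖ := by simp
      _ ≤ _ := norm_sub_le _ _
  linarith

lemma dv_far {η : J2} {ρ : ℝ} (h : η.Far ρ) {v z : ℝ × ℝ} (hz : ρ < ‖z‖) :
    η.dv v z = 0 ∧ η.d1v v z = 0 ∧ η.d2v v z = 0 ∧ η.dvv v z = 0 := by
  simp [dv, d1v, d2v, dvv, h.v1 z hz, h.v2 z hz, h.v11 z hz, h.v12 z hz, h.v22 z hz]

lemma Rint_far (ψ : J2) {η : J2} {ρ : ℝ} (h : η.Far ρ) {v : ℝ × ℝ} {t : ℝ} (hv : ‖v‖ ≤ 1)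
    (ht : |t| ≤ 1) {z : ℝ × ℝ} (hz : ρ + 1 < ‖z‖) : ψ.Rint η v t z = 0 := by
  have key : ∀ a : ℝ, |a| ≤ 1 → ρ < ‖z + (a * t) • v‖ := by
    intro a ha
    refine norm_far hz ?_
    rw [norm_smul, Real.norm_eq_abs, abs_mul]
    have h1 : |a| * |t| ≤ 1 := mul_le_one₀ ha (abs_nonneg _) ht
    exact mul_le_one₀ h1 (norm_nonneg _) hv
  have k1 : ρ < ‖z + t • v‖ := by simpa using key 1 (by simp)
  have k0 : ρ < ‖z‖ := by linarith
  have hq := h.sq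
  have e1 : av v (η.dv v) t z = 0 := av_eq_zero fun a ha => (dv_far h (key a ha)).1
  have e2 : av v ((η.mul η).d1v v) t z = 0 := av_eq_zero fun a ha => (dv_far hq (key a ha)).2.1
  have e3 : av v ((η.mul η).d2v v) t z = 0 := av_eq_zero fun a ha => (dv_far hq (key a ha)).2.2.1
  have e4 : av2 v ((η.mul η).dvv v) t z = 0 := av2_eq_zero fun a ha => (dv_far hq (key a ha)).2.2.2
  unfold Rint
  rw [e1, e2, e3, e4, h.v0 z k0, h.v1 _ k1, h.v2 _ k1, hq.v1 z k0, hq.v2 z k0, hq.v11 z k0,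
    hq.v12 z k0, hq.v22 z k0]
  ring

lemma Rint_cont (ψ η : J2) (v : ℝ × ℝ) :
    Continuous (fun x : ℝ × (ℝ × ℝ) => ψ.Rint η v x.1 x.2) := by
  have a1 := av_cont v (η.cdv v)
  have a2 := av_cont v ((η.mul η).cd1v v)
  have a3 := av_cont v ((η.mul η).cd2v v)
  have a4 := av2_cont v ((η.mul η).cdvv v)
  have a5 := av_cont v (ψ.cd1v v)
  have a6 := av_cont v (ψ.cd2v v)
  have a7 := av2_cont v (ψ.cdvv v)
  unfold Rint
  fun_prop

def Rf (ψ η : J2) (v : ℝ × ℝ) (t : ℝ) : ℝ := ∫ z, ψ.Rint η v t z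

lemma Rf_cont (ψ η : J2) (h : HasCompactSupport η.f) {v : ℝ × ℝ} (hv : ‖v‖ ≤ 1) :
    ContinuousOn (ψ.Rf η v) (Set.Icc (-1) 1) := by
  obtain ⟨ρ, hρ, hf⟩ := η.far h
  unfold Rf
  refine continuousOn_integral_of_compact_support (isCompact_closedBall (0 : ℝ × ℝ) (ρ + 1))
    (ψ.Rint_cont η v).continuousOn ?_
  intro t z ht hz
  rw [mem_closedBall_zero_iff, not_le] at hz
  exact ψ.Rint_far hf hv (abs_le.2 ht) hz

lemma HH_far (ψ : J2) {ζ : J2} {ρ : ℝ} (h : ζ.Far ρ) {w : ℝ × ℝ} {z : ℝ × ℝ}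
    (hz : ρ + ‖w‖ < ‖z‖) : ψ.HH ζ w z = 0 := by
  have k0 : ρ < ‖z‖ := by linarith [norm_nonneg w]
  have k1 : ρ < ‖z + -w‖ := norm_far hz (by simp)
  unfold HH
  rw [h.v0 z k0, h.v1 z k0, h.v2 z k0, h.v0 _ k1]
  ring

lemma HH_cont (ψ ζ : J2) (w : ℝ × ℝ) : Continuous (ψ.HH ζ w) := by
  unfold HH; fun_prop

lemma dAB_int (ψ ζ : J2) (h : HasCompactSupport ζ.f) (w : ℝ × ℝ) :
    ∫ z, (ψ.dA ζ w z + ψ.dB ζ w z) = 0 ∧ Integrable (fun z => ψ.dA ζ w z + ψ.dB ζ w z) := by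
  have hA : PD (fun z => (1 / 2) * ((ζ.f z * ψ.f2 z) * ψ.ee w z)) (ψ.dA ζ w) _ :=
    (((ζ.d0.mul ψ.d2).mul (ψ.ee_PD w)).cmul (1 / 2)).congr (fun _ => rfl)
      (fun z => by simp only [dA]) (fun _ => rfl)
  have hB : PD (fun z => (-1 / 2) * ((ζ.f z * ψ.f1 z) * ψ.ee w z)) _ (ψ.dB ζ w) :=
    (((ζ.d0.mul ψ.d1).mul (ψ.ee_PD w)).cmul (-1 / 2)).congr (fun _ => rfl)
      (fun _ => rfl) (fun z => by simp only [dB])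
  have sA : HasCompactSupport (fun z => (1 / 2) * ((ζ.f z * ψ.f2 z) * ψ.ee w z)) :=
    HasCompactSupport.mul_left (f := fun _ => (1/2 : ℝ)) (HasCompactSupport.mul_right (h.mul_right))
  have sB : HasCompactSupport (fun z => (-1 / 2) * ((ζ.f z * ψ.f1 z) * ψ.ee w z)) :=
    HasCompactSupport.mul_left (f := fun _ => (-1/2 : ℝ)) (HasCompactSupport.mul_right (h.mul_right))
  have cA : Continuous (ψ.dA ζ w) := by unfold dA ee; fun_prop
  have cB : Continuous (ψ.dB ζ w) := by unfold dB ee; fun_prop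
  have s1 := (hA.supp sA).1
  have s2 := (hB.supp sB).2
  exact ⟨hA.integral_zero hB cA cB sA sB s1 s2, (cA.integrable_of_hasCompactSupport s1).add
    (cB.integrable_of_hasCompactSupport s2)⟩

lemma wf_cont (ψ F : J2) : Continuous (ψ.wf F) := by unfold wf; fun_prop
lemma wf_supp (ψ F : J2) (h : HasCompactSupport F.f) : HasCompactSupport (ψ.wf F) := by
  obtain ⟨ρ, hρ, hf⟩ := F.far h
  refine cs_of_far ρ fun z hz => ?_
  simp [wf, hf.v1 z hz, hf.v2 z hz, hf.v11 z hz, hf.v12 z hz, hf.v22 z hz]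

lemma emm_int (ψ η : J2) (h : HasCompactSupport η.f) (w : ℝ × ℝ) :
    Integrable (fun z => η.f (z + w) ^ 2 * ψ.mm w z) := by
  obtain ⟨ρ, hρ, hf⟩ := η.far h
  have := ψ.cmm w
  refine Continuous.integrable_of_hasCompactSupport (by fun_prop) (cs_of_far (ρ + ‖w‖) ?_)
  intro z hz
  rw [hf.v0 _ (norm_far hz le_rfl)]; ring

lemma cacc1 (ψ η : J2) (hψ : ψ.Weak) (h : HasCompactSupport η.f) {v : ℝ × ℝ} (hv : ‖v‖ ≤ 1)
    {t : ℝ} (ht : |t| ≤ 1) :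
    ∫ z, η.f (z + t • v) ^ 2 * ψ.mm (t • v) z ≤ t ^ 2 * ψ.Rf η v t := by
  obtain ⟨ρ, hρ, hf⟩ := η.far h
  have hζ : HasCompactSupport (η.mul η).f := HasCompactSupport.mul_left h
  have hF : HasCompactSupport (ψ.tst η (t • v)).f := HasCompactSupport.mul_right hζ
  have h0 := hψ _ hF
  have i1 := ψ.emm_int η h (t • v)
  have i2 : Integrable (ψ.Rint η v t) := by
    have := ψ.Rint_cont η v
    refine Continuous.integrable_of_hasCompactSupport (by fun_prop) (cs_of_far (ρ + 1) ?_)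
    intro z hz
    exact ψ.Rint_far hf hv ht hz
  have sH : HasCompactSupport (ψ.HH (η.mul η) (t • v)) :=
    cs_of_far (ρ + ‖t • v‖) fun z hz => ψ.HH_far hf.sq hz
  have iH : Integrable (ψ.HH (η.mul η) (t • v)) :=
    (ψ.HH_cont _ _).integrable_of_hasCompactSupport sH
  have i3 : Integrable (fun z => ψ.HH (η.mul η) (t • v) (z + t • v) - ψ.HH (η.mul η) (t • v) z) :=
    (iH.comp_add_right _).sub iH
  obtain ⟨z4, i4⟩ := ψ.dAB_int (η.mul η) hζ (t • v)
  have z3 := integral_shift_sub (t • v) (ψ.HH_cont (η.mul η) (t • v)) sH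
  have i0 : Integrable (ψ.wf (ψ.tst η (t • v))) := (ψ.wf_cont _).integrable_of_hasCompactSupport (ψ.wf_supp _ hF)
  have iA : Integrable (fun z => -(η.f (z + t • v) ^ 2 * ψ.mm (t • v) z)) := i1.neg
  have iB : Integrable (fun z => t ^ 2 * ψ.Rint η v t z) := i2.const_mul _
  have key := integral_mono i0 (((iA.add iB).add i3).add i4) (ψ.wf_le η v t)
  rw [h0] at key
  simp only [Pi.add_apply] at key
  erw [integral_add ((iA.add iB).add i3) i4, integral_add (iA.add iB) i3, integral_add iA iB] at key
  rw [integral_neg, integral_const_mul, z3, z4] at key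
  unfold Rf
  linarith
end J2

namespace J2

def kd (ψ η : J2) (z : ℝ × ℝ) : ℝ :=
  ψ.gg z * (η.f1 z ^ 2 + η.f2 z ^ 2)
    + Real.sqrt (ψ.uu z) * ψ.gg z * |η.f z| * (|η.f1 z| + |η.f2 z|)

lemma kd_cont (ψ η : J2) : Continuous (ψ.kd η) := by unfold kd; fun_prop
lemma kd_supp (ψ η : J2) (h : HasCompactSupport η.f) : HasCompactSupport (ψ.kd η) := by
  obtain ⟨ρ, hρ, hf⟩ := η.far h
  refine cs_of_far ρ fun z hz => ?_
  simp [kd, hf.v0 z hz, hf.v1 z hz, hf.v2 z hz]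
lemma kd_int (ψ η : J2) (h : HasCompactSupport η.f) : Integrable (ψ.kd η) :=
  (ψ.kd_cont η).integrable_of_hasCompactSupport (ψ.kd_supp η h)
lemma gg_nonneg (ψ : J2) (z) : 0 ≤ ψ.gg z := by unfold gg; positivity

lemma Rint_zero_le (ψ η : J2) (z : ℝ × ℝ) :
    ψ.Rint η (1, 0) 0 z + ψ.Rint η (0, 1) 0 z ≤ 16 * ψ.kd η z := by
  have hu1 : |ψ.f1 z| ≤ Real.sqrt (ψ.uu z) :=
    Real.abs_le_sqrt (by unfold uu; nlinarith [sq_nonneg (ψ.f2 z)])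
  have hu2 : |ψ.f2 z| ≤ Real.sqrt (ψ.uu z) :=
    Real.abs_le_sqrt (by unfold uu; nlinarith [sq_nonneg (ψ.f1 z)])
  have hU := Real.sqrt_nonneg (ψ.uu z)
  have e : ψ.Rint η (1, 0) 0 z + ψ.Rint η (0, 1) 0 z =
     8 * ((-η.f1 z * ((ψ.f11 z + ψ.f22 z) / 2) + η.f2 z * ψ.f12 z) ^ 2
      + (-η.f1 z * ψ.f12 z + η.f2 z * ((ψ.f11 z + ψ.f22 z) / 2)) ^ 2
      + (η.f2 z * ψ.f11 z) ^ 2 + (η.f1 z * ψ.f22 z) ^ 2)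
      + (ψ.f11 z + ψ.f22 z) ^ 2 * (η.f z * (ψ.f1 z * η.f2 z - ψ.f2 z * η.f1 z)) := by
    simp only [Rint, av_zero, av2_zero, zero_smul, add_zero, dv, d1v, d2v, dvv, J2.mul, p, q, b1, b2]
    ring
  rw [e]
  have h1 : η.f z * (ψ.f1 z * η.f2 z - ψ.f2 z * η.f1 z) ≤
      Real.sqrt (ψ.uu z) * (|η.f z| * (|η.f1 z| + |η.f2 z|)) := by
    calc η.f z * (ψ.f1 z * η.f2 z - ψ.f2 z * η.f1 z)
        ≤ |η.f z * (ψ.f1 z * η.f2 z - ψ.f2 z * η.f1 z)| := le_abs_self _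
      _ = |η.f z| * |ψ.f1 z * η.f2 z - ψ.f2 z * η.f1 z| := abs_mul _ _
      _ ≤ |η.f z| * (Real.sqrt (ψ.uu z) * |η.f2 z| + Real.sqrt (ψ.uu z) * |η.f1 z|) := by
        gcongr
        refine (abs_sub _ _).trans ?_
        rw [abs_mul, abs_mul]
        gcongr
      _ = _ := by ring
  have hD : (ψ.f11 z + ψ.f22 z) ^ 2 ≤ 2 * ψ.gg z := by
    unfold gg; nlinarith [sq_nonneg (ψ.f11 z - ψ.f22 z), sq_nonneg (ψ.f12 z)]
  have h2 : (ψ.f11 z + ψ.f22 z) ^ 2 * (η.f z * (ψ.f1 z * η.f2 z - ψ.f2 z * η.f1 z)) ≤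
      2 * ψ.gg z * (Real.sqrt (ψ.uu z) * (|η.f z| * (|η.f1 z| + |η.f2 z|))) :=
    (mul_le_mul_of_nonneg_left h1 (sq_nonneg _)).trans
      (mul_le_mul_of_nonneg_right hD (by positivity))
  have h3 : (-η.f1 z * ((ψ.f11 z + ψ.f22 z) / 2) + η.f2 z * ψ.f12 z) ^ 2
      + (-η.f1 z * ψ.f12 z + η.f2 z * ((ψ.f11 z + ψ.f22 z) / 2)) ^ 2
      + (η.f2 z * ψ.f11 z) ^ 2 + (η.f1 z * ψ.f22 z) ^ 2 ≤ 2 * (ψ.gg z * (η.f1 z ^ 2 + η.f2 z ^ 2)) := by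
    have a1 : (-η.f1 z * ((ψ.f11 z + ψ.f22 z) / 2) + η.f2 z * ψ.f12 z) ^ 2
      + (-η.f1 z * ψ.f12 z + η.f2 z * ((ψ.f11 z + ψ.f22 z) / 2)) ^ 2
      ≤ 2 * ((η.f1 z ^ 2 + η.f2 z ^ 2) * (((ψ.f11 z + ψ.f22 z) / 2) ^ 2 + ψ.f12 z ^ 2)) := by
      nlinarith [sq_nonneg (η.f1 z * ((ψ.f11 z + ψ.f22 z) / 2) + η.f2 z * ψ.f12 z),
        sq_nonneg (η.f1 z * ψ.f12 z + η.f2 z * ((ψ.f11 z + ψ.f22 z) / 2))]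
    have a2 : 2 * (((ψ.f11 z + ψ.f22 z) / 2) ^ 2 + ψ.f12 z ^ 2) ≤ ψ.gg z := by
      unfold gg; nlinarith [sq_nonneg (ψ.f11 z - ψ.f22 z)]
    have a3 := mul_le_mul_of_nonneg_left a2 (by positivity : 0 ≤ η.f1 z ^ 2 + η.f2 z ^ 2)
    have a4 : (η.f2 z * ψ.f11 z) ^ 2 + (η.f1 z * ψ.f22 z) ^ 2 ≤ ψ.gg z * (η.f1 z ^ 2 + η.f2 z ^ 2) := by
      unfold gg
      nlinarith [sq_nonneg (η.f1 z * ψ.f11 z), sq_nonneg (η.f2 z * ψ.f22 z),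
        sq_nonneg (η.f1 z * ψ.f12 z), sq_nonneg (η.f2 z * ψ.f12 z)]
    linarith
  have h4 : 0 ≤ Real.sqrt (ψ.uu z) * ψ.gg z * |η.f z| * (|η.f1 z| + |η.f2 z|) := by
    have := ψ.gg_nonneg z
    positivity
  unfold kd
  linarith

/-- Caccioppoli inequality in the limit form. -/
lemma cacc (ψ η : J2) (hψ : ψ.Weak) (h : HasCompactSupport η.f) {e : ℝ} (he : 0 < e) :
    ∃ t0 : ℝ, 0 < t0 ∧ t0 ≤ 1 ∧ ∀ t, 0 < t → t < t0 →
      (∫ z, η.f (z + t • (1, 0)) ^ 2 * ψ.mm (t • (1, 0)) z) +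
      (∫ z, η.f (z + t • (0, 1)) ^ 2 * ψ.mm (t • (0, 1)) z)
        ≤ t ^ 2 * (16 * (∫ z, ψ.kd η z) + e) := by
  have n1 : ‖((1:ℝ), (0:ℝ))‖ ≤ 1 := by simp
  have n2 : ‖((0:ℝ), (1:ℝ))‖ ≤ 1 := by simp
  have c1 := ψ.Rf_cont η h n1
  have c2 := ψ.Rf_cont η h n2
  have c : ContinuousAt (fun t => ψ.Rf η (1, 0) t + ψ.Rf η (0, 1) t) 0 :=
    (c1.add c2).continuousAt (Icc_mem_nhds (by norm_num) (by norm_num))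
  have hR0 : ψ.Rf η (1, 0) 0 + ψ.Rf η (0, 1) 0 ≤ 16 * ∫ z, ψ.kd η z := by
    obtain ⟨ρ, hρ, hf⟩ := η.far h
    have ii : ∀ v : ℝ × ℝ, ‖v‖ ≤ 1 → Integrable (ψ.Rint η v 0) := by
      intro v hv
      have := ψ.Rint_cont η v
      refine Continuous.integrable_of_hasCompactSupport (by fun_prop) (cs_of_far (ρ + 1) ?_)
      intro z hz
      exact ψ.Rint_far hf hv (by simp) hz
    unfold Rf
    rw [← integral_add (ii _ n1) (ii _ n2), ← integral_const_mul]
    exact integral_mono ((ii _ n1).add (ii _ n2)) ((ψ.kd_int η h).const_mul _) (ψ.Rint_zero_le η)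
  have hev : ∀ᶠ t in nhds (0:ℝ), ψ.Rf η (1, 0) t + ψ.Rf η (0, 1) t < 16 * (∫ z, ψ.kd η z) + e :=
    c.eventually (gt_mem_nhds (by linarith))
  obtain ⟨d, hd, hball⟩ := Metric.eventually_nhds_iff.1 hev
  refine ⟨min d 1, lt_min hd one_pos, min_le_right _ _, fun t ht htd => ?_⟩
  have hb := hball (y := t) (by
    rw [Real.dist_eq, sub_zero, abs_of_pos ht]; exact htd.trans_le (min_le_left _ _))
  have ht1 : |t| ≤ 1 := by rw [abs_of_pos ht]; exact (htd.trans_le (min_le_right _ _)).le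
  have k1 := ψ.cacc1 η hψ h n1 ht1
  have k2 := ψ.cacc1 η hψ h n2 ht1
  nlinarith [sq_pos_of_pos ht]

end J2

/-- a C2 function gives a J2 -/
def J2.ofCD (f : ℝ × ℝ → ℝ) (hf : ContDiff ℝ 2 f) : J2 where
  f := f
  f1 z := fderiv ℝ f z (1, 0)
  f2 z := fderiv ℝ f z (0, 1)
  f11 z := fderiv ℝ (fderiv ℝ f) z (1, 0) (1, 0)
  f12 z := fderiv ℝ (fderiv ℝ f) z (1, 0) (0, 1)
  f22 z := fderiv ℝ (fderiv ℝ f) z (0, 1) (0, 1)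
  d0 := PD.of_diff (hf.differentiable (by norm_num))
  d1 := by
    have h1 : ContDiff ℝ 1 (fderiv ℝ f) := hf.fderiv_right (by norm_num)
    have hd : Differentiable ℝ (fderiv ℝ f) := h1.differentiable (by norm_num)
    intro z
    have := (hd z).hasFDerivAt.clm_apply (hasFDerivAt_const ((1:ℝ), (0:ℝ)) z)
    refine this.congr_fderiv ?_
    have hs := (hf.contDiffAt (x := z)).isSymmSndFDerivAt (by simp)
    ext
    · simp
    · simpa using hs (0, 1) (1, 0)
  d2 := by
    have h1 : ContDiff ℝ 1 (fderiv ℝ f) := hf.fderiv_right (by norm_num)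
    have hd : Differentiable ℝ (fderiv ℝ f) := h1.differentiable (by norm_num)
    intro z
    have := (hd z).hasFDerivAt.clm_apply (hasFDerivAt_const ((0:ℝ), (1:ℝ)) z)
    refine this.congr_fderiv ?_
    ext <;> simp
  c11 := by
    have h1 : ContDiff ℝ 1 (fderiv ℝ f) := hf.fderiv_right (by norm_num)
    have := h1.continuous_fderiv (by norm_num)
    fun_prop
  c12 := by
    have h1 : ContDiff ℝ 1 (fderiv ℝ f) := hf.fderiv_right (by norm_num)
    have := h1.continuous_fderiv (by norm_num)
    fun_prop
  c22 := by
    have h1 : ContDiff ℝ 1 (fderiv ℝ f) := hf.fderiv_right (by norm_num)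
    have := h1.continuous_fderiv (by norm_num)
    fun_prop

lemma exists_cut (ρ : ℝ) : ∃ η : J2, HasCompactSupport η.f ∧ ∀ z, ‖z‖ ≤ ρ → η.f z = 1 := by
  let b : ContDiffBump (0 : ℝ × ℝ) := ⟨max ρ 1, max ρ 1 + 1, by positivity, by linarith⟩
  refine ⟨J2.ofCD b b.contDiff, b.hasCompactSupport, fun z hz => ?_⟩
  refine b.one_of_mem_closedBall ?_
  rw [mem_closedBall_zero_iff]
  exact hz.trans (le_max_left _ _)

lemma av_jensen (v : ℝ × ℝ) {F : ℝ × ℝ → ℝ} (hF : Continuous F) (t : ℝ) (z : ℝ × ℝ) :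
    av v F t z ^ 2 ≤ av v (fun z => F z ^ 2) t z := by
  unfold av
  set m := ∫ s in (0:ℝ)..1, F (z + (s * t) • v) with hm
  have h : 0 ≤ ∫ s in (0:ℝ)..1, (F (z + (s * t) • v) - m) ^ 2 :=
    intervalIntegral.integral_nonneg zero_le_one (fun _ _ => sq_nonneg _)
  have e : ∀ s : ℝ, (F (z + (s * t) • v) - m) ^ 2 =
      F (z + (s * t) • v) ^ 2 - (2 * m) * F (z + (s * t) • v) + m ^ 2 := fun s => by ring
  simp_rw [e] at h
  rw [intervalIntegral.integral_add, intervalIntegral.integral_sub,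
    intervalIntegral.integral_const_mul, ← hm] at h
  · simp at h; linarith
  all_goals
    apply Continuous.intervalIntegrable; fun_prop

/-- Fubini plus bound -/
lemma av_weight_le (v : ℝ × ℝ) {F W : ℝ × ℝ → ℝ} (hF : Continuous F) (hW : Continuous W)
    (hF0 : ∀ z, 0 ≤ F z) (hW0 : ∀ z, 0 ≤ W z)
    (hs : HasCompactSupport W) (t M : ℝ)
    (hM : ∀ s ∈ Set.Ioc (0:ℝ) 1, ∫ z, W (z - (s * t) • v) * F z ≤ M) :
    ∫ z, W z * av v F t z ≤ M := by
  have e1 : ∀ z, W z * av v F t z = ∫ s in (0:ℝ)..1, W z * F (z + (s * t) • v) := by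
    intro z; unfold av; rw [intervalIntegral.integral_const_mul]
  simp_rw [e1]
  rw [← intervalIntegral_integral_swap (f := fun s z => W z * F (z + (s * t) • v))]
  · have hb : ‖∫ s in (0:ℝ)..1, ∫ z, W z * F (z + (s * t) • v)‖ ≤ M * |1 - 0| := by
      apply intervalIntegral.norm_integral_le_of_norm_le_const
      intro s hs'
      rw [Set.uIoc_of_le zero_le_one] at hs'
      have h1 := hM s hs'
      have h2 : ∫ z, W z * F (z + (s * t) • v) = ∫ z, W (z - (s * t) • v) * F z := by
        rw [← integral_add_right_eq_self (fun z => W (z - (s * t) • v) * F z) ((s * t) • v)]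
        simp
      rw [h2, Real.norm_eq_abs, abs_of_nonneg]
      · exact h1
      · exact integral_nonneg fun z => mul_nonneg (hW0 _) (hF0 _)
    have := (Real.le_norm_self _).trans hb
    simpa using this
  · rw [← Measure.restrict_univ (μ := (volume : Measure (ℝ × ℝ))), Measure.prod_restrict]
    have hK : IsCompact (Set.Icc (0:ℝ) 1 ×ˢ tsupport W) := isCompact_Icc.prod hs
    have hc : Continuous (Function.uncurry fun (s : ℝ) z => W z * F (z + (s * t) • v)) := by
      unfold Function.uncurry; fun_prop
    have i1 := hc.continuousOn.integrableOn_compact (μ := (volume : Measure ℝ).prod (volume : Measure (ℝ × ℝ))) hK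
    have i2 : IntegrableOn (Function.uncurry fun (s : ℝ) z => W z * F (z + (s * t) • v))
        (Set.Icc (0:ℝ) 1 ×ˢ Set.univ) ((volume : Measure ℝ).prod (volume : Measure (ℝ × ℝ))) := by
      refine i1.of_forall_diff_eq_zero (measurableSet_Icc.prod MeasurableSet.univ) ?_
      rintro ⟨s, z⟩ ⟨h1, h2⟩
      have : z ∉ tsupport W := fun h => h2 ⟨h1.1, h⟩
      simp [Function.uncurry, image_eq_zero_of_notMem_tsupport this]
    refine i2.mono_set ?_
    rw [Set.uIoc_of_le zero_le_one]
    exact Set.prod_mono Set.Ioc_subset_Icc_self subset_rfl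

namespace J2

/-- weight -/
def WW (ψ η : J2) (z : ℝ × ℝ) : ℝ := η.f z ^ 2 / (1 + 2 * ψ.r z)

lemma WW_cont (ψ η : J2) : Continuous (ψ.WW η) := by
  unfold WW
  refine Continuous.div (by fun_prop) (by fun_prop) fun z => ?_
  have := ψ.r_nonneg z
  positivity
lemma WW_nonneg (ψ η : J2) (z) : 0 ≤ ψ.WW η z := by
  have := ψ.r_nonneg z
  unfold WW; positivity
lemma WW_supp (ψ η : J2) (h : HasCompactSupport η.f) : HasCompactSupport (ψ.WW η) := by
  refine h.mono' ?_
  intro z hz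
  apply subset_tsupport
  intro h0
  apply hz
  simp [WW, h0]

/-- squared difference of the strain -/
def ed (ψ : J2) (w z : ℝ × ℝ) : ℝ := df ψ.p w z ^ 2 + df ψ.q w z ^ 2

lemma df_cont {F : ℝ × ℝ → ℝ} (hF : Continuous F) (w : ℝ × ℝ) : Continuous (df F w) := by
  unfold df; fun_prop

/-- weight comparison -/
lemma weight_cmp (ψ η B : J2) {ρ : ℝ} (hη : ∀ z, ρ < ‖z‖ → η.f z = 0)
    (hB : ∀ z, ‖z‖ ≤ ρ + 2 → B.f z = 1) {ε : ℝ} (hε : 0 < ε) :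
    ∃ t0 : ℝ, 0 < t0 ∧ ∀ a b : ℝ × ℝ, ‖a‖ < t0 → ‖b‖ < t0 → ∀ z,
      ψ.WW η (z - b) * (1 + ψ.r (z + a) + ψ.r z) ≤ η.f (z + a) ^ 2 + ε * B.f (z + a) ^ 2 := by
  have hc := ψ.WW_cont η
  have hcomp : IsCompact (Metric.closedBall (0 : ℝ × ℝ) (ρ + 1)) := isCompact_closedBall _ _
  have hev : ∀ᶠ x in nhds ((0 : ℝ × ℝ), (0 : ℝ × ℝ)), ∀ z ∈ Metric.closedBall (0 : ℝ × ℝ) (ρ + 1),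
      ψ.WW η (z - x.2) * (1 + ψ.r (z + x.1) + ψ.r z) - η.f (z + x.1) ^ 2 < ε := by
    apply hcomp.eventually_forall_of_forall_eventually
    intro z _
    have hcont : Continuous (fun y : ((ℝ × ℝ) × (ℝ × ℝ)) × (ℝ × ℝ) =>
      ψ.WW η (y.2 - y.1.2) * (1 + ψ.r (y.2 + y.1.1) + ψ.r y.2) - η.f (y.2 + y.1.1) ^ 2) := by
      fun_prop
    refine hcont.continuousAt.eventually (gt_mem_nhds ?_)
    have := ψ.r_nonneg z
    have e : ψ.WW η (z - 0) * (1 + ψ.r (z + 0) + ψ.r z) - η.f (z + 0) ^ 2 = 0 := by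
      simp only [sub_zero, add_zero, WW]
      field_simp
      ring
    simp only [e]
    exact hε
  obtain ⟨d, hd, hball⟩ := Metric.eventually_nhds_iff.1 hev
  refine ⟨min d 1, lt_min hd one_pos, fun a b ha hb z => ?_⟩
  by_cases hz : ‖z‖ ≤ ρ + 1
  · have h1 := hball (y := (a, b)) (by
      rw [dist_eq_norm]
      simp only [Prod.norm_def, Prod.fst_sub, Prod.snd_sub]
      have ha' := ha.trans_le (min_le_left _ _)
      have hb' := hb.trans_le (min_le_left _ _)
      simp only [Prod.norm_def] at ha' hb'
      simpa using ⟨max_lt_iff.1 ha', max_lt_iff.1 hb'⟩) z (by simpa using hz)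
    have h2 : B.f (z + a) = 1 := hB _ (by
      have := norm_add_le z a
      have := ha.trans_le (min_le_right _ _)
      linarith)
    rw [h2]
    simp only at h1
    linarith
  · have : ψ.WW η (z - b) = 0 := by
      have h3 : ρ < ‖z - b‖ := by
        have := norm_sub_norm_le z b
        have := hb.trans_le (min_le_right _ _)
        linarith
      simp [WW, hη _ h3]
    rw [this, zero_mul]
    positivity

/-- one direction -/
lemma dirD (ψ η B : J2) (sη : HasCompactSupport η.f) (sB : HasCompactSupport B.f) (v v' : ℝ × ℝ)
    {ε t : ℝ} (hcmp : ∀ s ∈ Set.Ioc (0:ℝ) 1, ∀ z,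
      ψ.WW η (z - (s * t) • v') * (1 + ψ.r (z + t • v) + ψ.r z)
        ≤ η.f (z + t • v) ^ 2 + ε * B.f (z + t • v) ^ 2) :
    ∫ z, ψ.WW η z * (av v' (df ψ.p (t • v)) t z ^ 2 + av v' (df ψ.q (t • v)) t z ^ 2) ≤
     (∫ z, η.f (z + t • v) ^ 2 * ψ.mm (t • v) z) + ε * ∫ z, B.f (z + t • v) ^ 2 * ψ.mm (t • v) z := by
  have cW := ψ.WW_cont η
  have sW := ψ.WW_supp η sη
  have cp := df_cont ψ.cp (t • v)
  have cq := df_cont ψ.cq (t • v)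
  have ce : Continuous (ψ.ed (t • v)) := by unfold ed; fun_prop
  have cap : ∀ {F : ℝ × ℝ → ℝ}, Continuous F → Continuous (av v' F t) := fun {F} hF => by
    have := av_cont v' hF
    fun_prop
  have c1 := cap cp
  have c2 := cap cq
  have c3 := cap ce
  have step : ∫ z, ψ.WW η z * (av v' (df ψ.p (t • v)) t z ^ 2 + av v' (df ψ.q (t • v)) t z ^ 2)
      ≤ ∫ z, ψ.WW η z * av v' (ψ.ed (t • v)) t z := by
    apply integral_mono
    · exact Continuous.integrable_of_hasCompactSupport (by fun_prop) sW.mul_right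
    · exact Continuous.integrable_of_hasCompactSupport (by fun_prop) sW.mul_right
    · intro z
      refine mul_le_mul_of_nonneg_left ?_ (ψ.WW_nonneg η z)
      have j1 := av_jensen v' cp t z
      have j2 := av_jensen v' cq t z
      have : av v' (ψ.ed (t • v)) t z = av v' (fun z => df ψ.p (t • v) z ^ 2) t z
          + av v' (fun z => df ψ.q (t • v) z ^ 2) t z := by
        unfold av ed
        rw [intervalIntegral.integral_add]
        all_goals
          apply Continuous.intervalIntegrable; fun_prop
      rw [this]; exact add_le_add j1 j2
  refine step.trans ?_
  have i1 := ψ.emm_int η sη (t • v)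
  have i2 := (ψ.emm_int B sB (t • v)).const_mul ε
  apply av_weight_le v' ce cW (fun z => by unfold ed; positivity) (ψ.WW_nonneg η) sW
  intro s hs
  rw [← integral_const_mul, ← integral_add i1 i2]
  refine integral_mono ?_ (i1.add i2) ?_
  · refine Continuous.integrable_of_hasCompactSupport (by fun_prop) ?_
    refine HasCompactSupport.mul_right ?_
    obtain ⟨ρ, hρ⟩ := cs_bd sW
    refine cs_of_far (ρ + ‖(s * t) • v'‖) fun z hz => hρ _ ?_
    rw [sub_eq_add_neg]
    exact norm_far hz (by simp)
  · intro z
    simp only [Pi.add_apply]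
    have hm := ψ.mm_lower (t • v) z
    have r1 := ψ.r_nonneg z
    have r2 := ψ.r_nonneg (z + t • v)
    rw [div_le_iff₀ (by positivity)] at hm
    have hm0 := ψ.mm_nonneg (t • v) z
    have hw := ψ.WW_nonneg η (z - (s * t) • v')
    have h1 : ψ.WW η (z - (s * t) • v') * ψ.ed (t • v) z ≤
      ψ.WW η (z - (s * t) • v') * (ψ.mm (t • v) z * (1 + ψ.r (z + t • v) + ψ.r z)) :=
      mul_le_mul_of_nonneg_left hm hw
    have h2 := mul_le_mul_of_nonneg_right (hcmp s hs z) hm0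
    nlinarith

/-- the third-derivative energy density of the averaged stream function -/
def tau (ψ : J2) (t : ℝ) (z : ℝ × ℝ) : ℝ :=
  ((av (0, 1) (df ψ.p (t • (1, 0))) t z ^ 2 + av (0, 1) (df ψ.q (t • (1, 0))) t z ^ 2) +
   (av (1, 0) (df ψ.p (t • (0, 1))) t z ^ 2 + av (1, 0) (df ψ.q (t • (0, 1))) t z ^ 2)) / t ^ 2

lemma tau_cont (ψ : J2) (t : ℝ) : Continuous (ψ.tau t) := by
  have a1 := av_cont (0, 1) (df_cont ψ.cp (t • (1, 0)))
  have a2 := av_cont (0, 1) (df_cont ψ.cq (t • (1, 0)))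
  have a3 := av_cont (1, 0) (df_cont ψ.cp (t • (0, 1)))
  have a4 := av_cont (1, 0) (df_cont ψ.cq (t • (0, 1)))
  unfold tau
  fun_prop

lemma lemD (ψ η : J2) (hψ : ψ.Weak) (h : HasCompactSupport η.f) {e : ℝ} (he : 0 < e) :
    ∃ t0 : ℝ, 0 < t0 ∧ t0 ≤ 1 ∧ ∀ t, 0 < t → t < t0 →
      ∫ z, ψ.WW η z * ψ.tau t z ≤ 16 * (∫ z, ψ.kd η z) + e := by
  obtain ⟨ρ, hρ0, hρ⟩ := η.far h
  obtain ⟨B, sB, hB⟩ := exists_cut (ρ + 2)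
  set KB := ∫ z, ψ.kd B z with hKB
  have hKB0 : 0 ≤ KB := integral_nonneg fun z => by
    have := ψ.gg_nonneg z
    unfold kd; positivity
  set ε := e / (2 * (16 * KB + 1)) with hε
  have hε0 : 0 < ε := by positivity
  obtain ⟨t1, ht1, ht1', c1⟩ := ψ.cacc η hψ h (half_pos he)
  obtain ⟨t2, ht2, ht2', c2⟩ := ψ.cacc B hψ sB one_pos
  obtain ⟨t3, ht3, c3⟩ := ψ.weight_cmp η B hρ.v0 hB hε0
  refine ⟨min t1 (min t2 t3), by positivity, (min_le_left _ _).trans ht1', fun t ht htt => ?_⟩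
  have l1 : t < t1 := htt.trans_le (min_le_left _ _)
  have l2 : t < t2 := htt.trans_le ((min_le_right _ _).trans (min_le_left _ _))
  have l3 : t < t3 := htt.trans_le ((min_le_right _ _).trans (min_le_right _ _))
  have n1 : ‖((1:ℝ), (0:ℝ))‖ = 1 := by simp
  have n2 : ‖((0:ℝ), (1:ℝ))‖ = 1 := by simp
  have cmp : ∀ v v' : ℝ × ℝ, ‖v‖ = 1 → ‖v'‖ = 1 → ∀ s ∈ Set.Ioc (0:ℝ) 1, ∀ z,
      ψ.WW η (z - (s * t) • v') * (1 + ψ.r (z + t • v) + ψ.r z)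
        ≤ η.f (z + t • v) ^ 2 + ε * B.f (z + t • v) ^ 2 := by
    intro v v' hv hv' s hs z
    apply c3
    · rw [norm_smul, hv, mul_one, Real.norm_eq_abs, abs_of_pos ht]; exact l3
    · rw [norm_smul, hv', mul_one, Real.norm_eq_abs, abs_of_pos (mul_pos hs.1 ht)]
      nlinarith [hs.2]
  have D1 := ψ.dirD η B h sB (1, 0) (0, 1) (cmp _ _ n1 n2)
  have D2 := ψ.dirD η B h sB (0, 1) (1, 0) (cmp _ _ n2 n1)
  have C1 := c1 t ht l1
  have C2 := c2 t ht l2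
  have a1 := av_cont (0, 1) (df_cont ψ.cp (t • (1, 0)))
  have a2 := av_cont (0, 1) (df_cont ψ.cq (t • (1, 0)))
  have a3 := av_cont (1, 0) (df_cont ψ.cp (t • (0, 1)))
  have a4 := av_cont (1, 0) (df_cont ψ.cq (t • (0, 1)))
  have cW := ψ.WW_cont η
  have sW := ψ.WW_supp η h
  have split : ∫ z, ψ.WW η z * ψ.tau t z = ((∫ z, ψ.WW η z * (av (0, 1) (df ψ.p (t • (1, 0))) t z ^ 2
      + av (0, 1) (df ψ.q (t • (1, 0))) t z ^ 2)) + ∫ z, ψ.WW η z * (av (1, 0) (df ψ.p (t • (0, 1))) t z ^ 2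
      + av (1, 0) (df ψ.q (t • (0, 1))) t z ^ 2)) / t ^ 2 := by
    rw [← integral_add, ← integral_div]
    · congr 1; ext z; unfold tau; ring
    · exact Continuous.integrable_of_hasCompactSupport (by fun_prop) sW.mul_right
    · exact Continuous.integrable_of_hasCompactSupport (by fun_prop) sW.mul_right
  rw [split, div_le_iff₀ (by positivity)]
  have hεK : ε * (16 * KB + 1) = e / 2 := by
    rw [hε]; field_simp
  have C2' := mul_le_mul_of_nonneg_left C2 hε0.le
  have : ε * (t ^ 2 * (16 * KB + 1)) = t ^ 2 * (e / 2) := by rw [← hεK]; ring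
  nlinarith

end J2

lemma av_deriv (v : ℝ × ℝ) {K : ℝ × ℝ → ℝ} (hK : Continuous K) {t : ℝ} (ht : t ≠ 0)
    (z : ℝ × ℝ) (s : ℝ) :
    HasDerivAt (fun s : ℝ => av v K t (z + s • v))
      (1 / t * (K (z + s • v + t • v) - K (z + s • v))) s := by
  have hk : Continuous (fun τ : ℝ => K (z + τ • v)) := by fun_prop
  have e : ∀ s : ℝ, av v K t (z + s • v) = 1 / t * ((∫ τ in (0:ℝ)..(s + t), K (z + τ • v))
      - ∫ τ in (0:ℝ)..s, K (z + τ • v)) := by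
    intro s
    rw [intervalIntegral.integral_interval_sub_left (hk.intervalIntegrable _ _) (hk.intervalIntegrable _ _)]
    have := intervalIntegral.integral_comp_mul_add (a := 0) (b := 1)
      (fun τ : ℝ => K (z + τ • v)) ht s
    unfold av
    simp only [mul_zero, zero_add, mul_one, smul_eq_mul] at this
    rw [add_comm s t, one_div, ← this]
    congr 1; ext σ
    congr 1
    rw [add_assoc, ← add_smul]; congr 2; ring
  have e' : (fun s : ℝ => av v K t (z + s • v)) = _ := funext e
  rw [e']
  have d1 := (hk.integral_hasStrictDerivAt 0 (s + t)).hasDerivAt.comp_add_const s t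
  have d2 := (hk.integral_hasStrictDerivAt 0 s).hasDerivAt
  have := (d1.sub d2).const_mul (1 / t)
  refine this.congr_deriv ?_
  rw [add_smul, add_assoc]

lemma av_df (v w : ℝ × ℝ) {F : ℝ × ℝ → ℝ} (hF : Continuous F) (t : ℝ) (z : ℝ × ℝ) :
    av v (J2.df F w) t z = av v F t (z + w) - av v F t z := by
  unfold av J2.df
  rw [← intervalIntegral.integral_sub]
  · congr 1; ext s; congr 2; abel
  all_goals
    apply Continuous.intervalIntegrable; fun_prop

lemma av_cont1 (v : ℝ × ℝ) {F : ℝ × ℝ → ℝ} (hF : Continuous F) (t : ℝ) : Continuous (av v F t) := by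
  have := av_cont v hF
  fun_prop

/-- Steklov average -/
def Sk (F : ℝ × ℝ → ℝ) (t : ℝ) (z : ℝ × ℝ) : ℝ := av (1, 0) (av (0, 1) F t) t z

lemma Sk_comm {F : ℝ × ℝ → ℝ} (hF : Continuous F) (t : ℝ) (z : ℝ × ℝ) :
    Sk F t z = av (0, 1) (av (1, 0) F t) t z := by
  unfold Sk av
  rw [intervalIntegral_intervalIntegral_swap]
  · congr 1; ext s; congr 1; ext σ; congr 1; abel
  · rw [Set.uIoc_of_le zero_le_one]
    have hc : Continuous (Function.uncurry fun (s σ : ℝ) => F (z + (s * t) • (1, 0) + (σ * t) • (0, 1))) := by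
      unfold Function.uncurry; fun_prop
    have := hc.continuousOn.integrableOn_compact
      (μ := (volume : Measure ℝ).prod (volume : Measure ℝ)) (isCompact_Icc (a := (0:ℝ)) (b := 1) |>.prod (isCompact_Icc (a := (0:ℝ)) (b := 1)))
    exact this.mono_set (Set.prod_mono Set.Ioc_subset_Icc_self Set.Ioc_subset_Icc_self)

lemma Sk_cont {F : ℝ × ℝ → ℝ} (hF : Continuous F) (t : ℝ) : Continuous (Sk F t) :=
  av_cont1 _ (av_cont1 _ hF t) t

lemma Sk_dx {F : ℝ × ℝ → ℝ} (hF : Continuous F) {t : ℝ} (ht : t ≠ 0) (x y : ℝ) :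
    HasDerivAt (fun s : ℝ => Sk F t (s, y)) (1 / t * av (0, 1) (J2.df F (t • (1, 0))) t (x, y)) x := by
  have := av_deriv (1, 0) (av_cont1 (0, 1) hF t) ht (0, y) x
  rw [av_df _ _ hF]
  simpa [Sk] using this

lemma Sk_dy {F : ℝ × ℝ → ℝ} (hF : Continuous F) {t : ℝ} (ht : t ≠ 0) (x y : ℝ) :
    HasDerivAt (fun s : ℝ => Sk F t (x, s)) (1 / t * av (1, 0) (J2.df F (t • (0, 1))) t (x, y)) y := by
  have := av_deriv (0, 1) (av_cont1 (1, 0) hF t) ht (x, 0) y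
  rw [av_df _ _ hF]
  simp_rw [Sk_comm hF]
  simpa using this

lemma av_lin (v : ℝ × ℝ) {F G : ℝ × ℝ → ℝ} (hF : Continuous F) (hG : Continuous G) (a b t : ℝ) (z : ℝ × ℝ) :
    av v (fun z => a * F z + b * G z) t z = a * av v F t z + b * av v G t z := by
  unfold av
  rw [← intervalIntegral.integral_const_mul, ← intervalIntegral.integral_const_mul, ← intervalIntegral.integral_add]
  all_goals
    apply Continuous.intervalIntegrable; fun_prop

/-- uniform convergence on compacts -/
lemma Sk_unif {F : ℝ × ℝ → ℝ} (hF : Continuous F) {Q : Set (ℝ × ℝ)} (hQ : IsCompact Q) {ε : ℝ} (hε : 0 < ε) :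
    ∃ t0 : ℝ, 0 < t0 ∧ ∀ t, 0 < t → t < t0 → ∀ z ∈ Q, |Sk F t z - F z| ≤ ε := by
  -- local uniform continuity
  have hev : ∀ᶠ w in nhds (0 : ℝ × ℝ), ∀ z ∈ Q, |F (z + w) - F z| < ε := by
    apply hQ.eventually_forall_of_forall_eventually
    intro z _
    have hcont : Continuous (fun y : (ℝ × ℝ) × (ℝ × ℝ) => |F (y.2 + y.1) - F y.2|) := by fun_prop
    exact hcont.continuousAt.eventually (gt_mem_nhds (by simpa using hε))
  obtain ⟨d, hd, hball⟩ := Metric.eventually_nhds_iff.1 hev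
  refine ⟨d, hd, fun t ht htd z hz => ?_⟩
  have key : ∀ s ∈ Set.Icc (0:ℝ) 1, ∀ σ ∈ Set.Icc (0:ℝ) 1,
      |F (z + (s * t) • (1, 0) + (σ * t) • (0, 1)) - F z| ≤ ε := by
    intro s hs σ hσ
    have := hball (y := (s * t, σ * t)) (by
      rw [dist_zero_right, Prod.norm_def]
      simp only [Real.norm_eq_abs]
      rw [abs_of_nonneg (mul_nonneg hs.1 ht.le), abs_of_nonneg (mul_nonneg hσ.1 ht.le)]
      refine max_lt ?_ ?_ <;> nlinarith [hs.2, hσ.2]) z hz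
    rw [add_assoc]
    refine le_trans (le_of_eq ?_) this.le
    simp
  have in1 : ∀ s ∈ Set.Icc (0:ℝ) 1, |av (0, 1) F t (z + (s * t) • (1, 0)) - F z| ≤ ε := by
    intro s hs
    have e : av (0, 1) F t (z + (s * t) • (1, 0)) - F z
        = ∫ σ in (0:ℝ)..1, (F (z + (s * t) • (1, 0) + (σ * t) • (0, 1)) - F z) := by
      unfold av
      rw [intervalIntegral.integral_sub]
      · simp
      all_goals
        apply Continuous.intervalIntegrable; fun_prop
    rw [e]
    have := intervalIntegral.norm_integral_le_of_norm_le_const (a := (0:ℝ)) (b := 1) (C := ε)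
      (f := fun σ => (F (z + (s * t) • (1, 0) + (σ * t) • (0, 1)) - F z)) (fun σ hσ => by
        rw [Set.uIoc_of_le zero_le_one] at hσ
        exact key s hs σ (Set.Ioc_subset_Icc_self hσ))
    simpa using this
  have cA := av_cont1 (0, 1) hF t
  have e : Sk F t z - F z = ∫ s in (0:ℝ)..1, (av (0, 1) F t (z + (s * t) • (1, 0)) - F z) := by
    unfold Sk
    rw [intervalIntegral.integral_sub]
    · simp [av]
    all_goals
      apply Continuous.intervalIntegrable; fun_prop
  rw [e]
  have := intervalIntegral.norm_integral_le_of_norm_le_const (a := (0:ℝ)) (b := 1) (C := ε)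
    (f := fun s => (av (0, 1) F t (z + (s * t) • (1, 0)) - F z)) (fun σ hσ => by
      rw [Set.uIoc_of_le zero_le_one] at hσ
      exact in1 σ (Set.Ioc_subset_Icc_self hσ))
  simpa using this

namespace J2

/-- x-derivative of the Steklov average -/
def Dx (F : ℝ × ℝ → ℝ) (t : ℝ) (z : ℝ × ℝ) : ℝ := 1 / t * av (0, 1) (df F (t • (1, 0))) t z
/-- y-derivative of the Steklov average -/
def Dy (F : ℝ × ℝ → ℝ) (t : ℝ) (z : ℝ × ℝ) : ℝ := 1 / t * av (1, 0) (df F (t • (0, 1))) t z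

lemma Dx_cont {F : ℝ × ℝ → ℝ} (hF : Continuous F) (t : ℝ) : Continuous (Dx F t) :=
  (av_cont1 _ (df_cont hF _) t).const_mul _
lemma Dy_cont {F : ℝ × ℝ → ℝ} (hF : Continuous F) (t : ℝ) : Continuous (Dy F t) :=
  (av_cont1 _ (df_cont hF _) t).const_mul _

lemma Dx_lin {F G : ℝ × ℝ → ℝ} (hF : Continuous F) (hG : Continuous G) (a b t : ℝ) (z : ℝ × ℝ) :
    Dx (fun z => a * F z + b * G z) t z = a * Dx F t z + b * Dx G t z := by
  unfold Dx
  rw [av_df _ _ (by fun_prop), av_df _ _ hF, av_df _ _ hG, av_lin _ hF hG, av_lin _ hF hG]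
  ring
lemma Dy_lin {F G : ℝ × ℝ → ℝ} (hF : Continuous F) (hG : Continuous G) (a b t : ℝ) (z : ℝ × ℝ) :
    Dy (fun z => a * F z + b * G z) t z = a * Dy F t z + b * Dy G t z := by
  unfold Dy
  rw [av_df _ _ (by fun_prop), av_df _ _ hF, av_df _ _ hG, av_lin _ hF hG, av_lin _ hF hG]
  ring

lemma Dxy {f f1 f2 : ℝ × ℝ → ℝ} (h : PD f f1 f2) (c1 : Continuous f1) (c2 : Continuous f2)
    {t : ℝ} (ht : t ≠ 0) (z : ℝ × ℝ) : Dy f1 t z = Dx f2 t z := by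
  unfold Dx Dy
  have e1 := fun z => h.av_eq c1 c2 (1, 0) z t
  have e2 := fun z => h.av_eq c1 c2 (0, 1) z t
  simp only [one_mul, zero_mul, add_zero, zero_add] at e1 e2
  rw [av_df _ _ c1, av_df _ _ c2]
  have a1 := e1 z
  have a2 := e1 (z + t • (0, 1))
  have a3 := e2 z
  have a4 := e2 (z + t • (1, 0))
  have e : z + t • (0, 1) + t • (1, 0) = z + t • (1, 0) + t • ((0:ℝ), (1:ℝ)) := by abel
  rw [e] at a2
  congr 1
  apply mul_left_cancel₀ ht
  linarith

lemma grad_le (ψ : J2) {t : ℝ} (ht : t ≠ 0) (z : ℝ × ℝ) :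
    (Dx ψ.f11 t z ^ 2 + 2 * Dx ψ.f12 t z ^ 2 + Dx ψ.f22 t z ^ 2) +
    (Dy ψ.f11 t z ^ 2 + 2 * Dy ψ.f12 t z ^ 2 + Dy ψ.f22 t z ^ 2) ≤ 8 * ψ.tau t z := by
  have s1 := Dxy ψ.d1 ψ.c11 ψ.c12 ht z
  have s2 := Dxy ψ.d2 ψ.c12 ψ.c22 ht z
  have hp : ψ.p = fun z => (-1) * ψ.f12 z + 0 * ψ.f12 z := by ext z; simp [p]
  have hq : ψ.q = fun z => (1/2) * ψ.f11 z + (-1/2) * ψ.f22 z := by ext z; simp [q]; ring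
  have p1 := Dx_lin ψ.c12 ψ.c12 (-1) 0 t z
  have p2 := Dy_lin ψ.c12 ψ.c12 (-1) 0 t z
  have q1 := Dx_lin ψ.c11 ψ.c22 (1/2) (-1/2) t z
  have q2 := Dy_lin ψ.c11 ψ.c22 (1/2) (-1/2) t z
  rw [← hp] at p1 p2
  rw [← hq] at q1 q2
  have ht' : ψ.tau t z = Dx ψ.p t z ^ 2 + Dx ψ.q t z ^ 2 + (Dy ψ.p t z ^ 2 + Dy ψ.q t z ^ 2) := by
    unfold tau Dx Dy; field_simp
  rw [ht', p1, p2, q1, q2, s1, s2]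
  rw [s1] at q2
  rw [← s2]
  nlinarith [sq_nonneg (Dx ψ.f11 t z - Dy ψ.f12 t z), sq_nonneg (Dx ψ.f12 t z - Dy ψ.f22 t z),
    sq_nonneg (Dx ψ.f11 t z), sq_nonneg (Dy ψ.f12 t z), sq_nonneg (Dx ψ.f12 t z), sq_nonneg (Dy ψ.f22 t z),
    sq_nonneg (Dx ψ.f11 t z - 2 * Dy ψ.f12 t z), sq_nonneg (Dx ψ.f12 t z * 2 - Dy ψ.f22 t z)]

end J2

/-- iterated integral over the square -/
def II (S : ℝ) (F : ℝ × ℝ → ℝ) : ℝ := ∫ x in (-S)..S, ∫ y in (-S)..S, F (x, y)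

lemma slice_cont {F : ℝ × ℝ → ℝ} (hF : Continuous F) (a b : ℝ) :
    Continuous (fun x : ℝ => ∫ y in a..b, F (x, y)) := by
  apply intervalIntegral.continuous_parametric_intervalIntegral_of_continuous'
  exact hF

lemma slice_ii {F : ℝ × ℝ → ℝ} (hF : Continuous F) (x a b : ℝ) :
    IntervalIntegrable (fun y : ℝ => F (x, y)) volume a b := by
  apply Continuous.intervalIntegrable; fun_prop

lemma II_mono {S : ℝ} (hS : 0 ≤ S) {F G : ℝ × ℝ → ℝ} (hF : Continuous F) (hG : Continuous G)
    (h : ∀ x ∈ Set.Icc (-S) S, ∀ y ∈ Set.Icc (-S) S, F (x, y) ≤ G (x, y)) : II S F ≤ II S G := by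
  unfold II
  apply intervalIntegral.integral_mono_on (by linarith)
  · exact (slice_cont hF _ _).intervalIntegrable _ _
  · exact (slice_cont hG _ _).intervalIntegrable _ _
  · intro x hx
    exact intervalIntegral.integral_mono_on (by linarith) (slice_ii hF _ _ _) (slice_ii hG _ _ _)
      (fun y hy => h x hx y hy)

lemma II_add {S : ℝ} {F G : ℝ × ℝ → ℝ} (hF : Continuous F) (hG : Continuous G) :
    II S (fun z => F z + G z) = II S F + II S G := by
  unfold II
  rw [← intervalIntegral.integral_add ((slice_cont hF _ _).intervalIntegrable _ _)
    ((slice_cont hG _ _).intervalIntegrable _ _)]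
  congr 1; ext x
  rw [intervalIntegral.integral_add (slice_ii hF _ _ _) (slice_ii hG _ _ _)]

lemma II_cmul {S : ℝ} (c : ℝ) (F : ℝ × ℝ → ℝ) :
    II S (fun z => c * F z) = c * II S F := by
  unfold II
  simp_rw [intervalIntegral.integral_const_mul]

lemma II_const {S : ℝ} (c : ℝ) : II S (fun _ => c) = 4 * S ^ 2 * c := by
  unfold II
  simp; ring

lemma II_iOn {S : ℝ} {F : ℝ × ℝ → ℝ} (hF : Continuous F) :
    IntegrableOn F (Set.Ioc (-S) S ×ˢ Set.Ioc (-S) S) ((volume : Measure ℝ).prod volume) := by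
  have := hF.continuousOn.integrableOn_compact
      (μ := (volume : Measure ℝ).prod (volume : Measure ℝ)) (isCompact_Icc (a := (-S)) (b := S) |>.prod (isCompact_Icc (a := (-S)) (b := S)))
  exact this.mono_set (Set.prod_mono Set.Ioc_subset_Icc_self Set.Ioc_subset_Icc_self)

lemma II_swap {S : ℝ} (hS : 0 ≤ S) {F : ℝ × ℝ → ℝ} (hF : Continuous F) :
    II S F = II S (fun z => F (z.2, z.1)) := by
  unfold II
  rw [intervalIntegral_intervalIntegral_swap]
  rw [Set.uIoc_of_le (by linarith)]
  exact II_iOn hF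

lemma II_eq_set {S : ℝ} (hS : 0 ≤ S) {F : ℝ × ℝ → ℝ} (hF : Continuous F) :
    II S F = ∫ z in Set.Ioc (-S) S ×ˢ Set.Ioc (-S) S, F z := by
  unfold II
  rw [show (volume : Measure (ℝ × ℝ)) = (volume : Measure ℝ).prod volume from rfl,
    setIntegral_prod _ (II_iOn hF), intervalIntegral.integral_of_le (by linarith)]
  congr 1; ext x
  rw [intervalIntegral.integral_of_le (by linarith)]

lemma II_le_integral {S : ℝ} (hS : 0 ≤ S) {F : ℝ × ℝ → ℝ} (hF : Continuous F) (h0 : ∀ z, 0 ≤ F z)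
    (hi : Integrable F) : II S F ≤ ∫ z, F z := by
  rw [II_eq_set hS hF]
  exact setIntegral_le_integral hi (Eventually.of_forall h0)

lemma II_eq_integral {S : ℝ} (hS : 0 ≤ S) {F : ℝ × ℝ → ℝ} (hF : Continuous F)
    (h0 : ∀ z : ℝ × ℝ, (S ≤ |z.1| ∨ S ≤ |z.2|) → F z = 0) : II S F = ∫ z, F z := by
  rw [II_eq_set hS hF]
  apply setIntegral_eq_integral_of_forall_compl_eq_zero
  intro z hz
  apply h0
  by_contra hc
  push Not at hc
  apply hz
  rw [abs_lt, abs_lt] at hc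
  exact ⟨⟨hc.1.1, hc.1.2.le⟩, ⟨hc.2.1, hc.2.2.le⟩⟩

/-- one-dimensional inequality -/
lemma slice1 {S c : ℝ} (hS : 0 ≤ S) {k k' β β' : ℝ → ℝ} (hk : ∀ y, HasDerivAt k (k' y) y)
    (hβ : ∀ y, HasDerivAt β (β' y) y) (ck' : Continuous k') (cβ' : Continuous β')
    (k0 : ∀ y, 0 ≤ k y) (b0 : ∀ y, 0 ≤ β y) (hc : ∀ y, |β' y| ≤ c) (hS0 : β (-S) = 0) :
    ∫ y in (-S)..S, k y ^ 2 * β y ≤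
      (∫ y in (-S)..S, k y) * ∫ y in (-S)..S, (|k' y| * β y + c * k y) := by
  have ck : Continuous k := continuous_iff_continuousAt.2 fun y => (hk y).continuousAt
  have cβ : Continuous β := continuous_iff_continuousAt.2 fun y => (hβ y).continuousAt
  have hcc : 0 ≤ c := (abs_nonneg _).trans (hc 0)
  set M := ∫ y in (-S)..S, (|k' y| * β y + c * k y) with hM
  have sup : ∀ y ∈ Set.Icc (-S) S, k y * β y ≤ M := by
    intro y hy
    have h1 : ∫ s in (-S)..y, (k' s * β s + k s * β' s) = k y * β y - k (-S) * β (-S) :=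
      intervalIntegral.integral_eq_sub_of_hasDerivAt (fun s _ => (hk s).mul (hβ s))
        (by apply Continuous.intervalIntegrable; fun_prop)
    rw [hS0, mul_zero, sub_zero] at h1
    rw [← h1]
    have h2 : ∫ s in (-S)..y, (k' s * β s + k s * β' s) ≤ ∫ s in (-S)..y, (|k' s| * β s + c * k s) := by
      apply intervalIntegral.integral_mono_on hy.1
      · apply Continuous.intervalIntegrable; fun_prop
      · apply Continuous.intervalIntegrable; fun_prop
      · intro s _
        have := mul_le_mul_of_nonneg_right (le_abs_self (k' s)) (b0 s)
        have := mul_le_mul_of_nonneg_left ((le_abs_self _).trans (hc s)) (k0 s)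
        linarith
    refine h2.trans ?_
    apply intervalIntegral.integral_mono_interval le_rfl hy.1 hy.2
    · refine Eventually.of_forall fun s => ?_
      have := k0 s
      have := b0 s
      simp only [Pi.zero_apply]
      positivity
    · apply Continuous.intervalIntegrable; fun_prop
  calc ∫ y in (-S)..S, k y ^ 2 * β y ≤ ∫ y in (-S)..S, k y * M := by
        apply intervalIntegral.integral_mono_on (by linarith)
        · apply Continuous.intervalIntegrable; fun_prop
        · apply Continuous.intervalIntegrable; fun_prop
        · intro y hy
          have := mul_le_mul_of_nonneg_left (sup y hy) (k0 y)
          nlinarith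
    _ = _ := by rw [intervalIntegral.integral_mul_const]

/-- planar slice inequality -/
lemma slice2 {S c : ℝ} (hS : 0 ≤ S) {k k2 : ℝ × ℝ → ℝ} {β β' α a : ℝ → ℝ}
    (ck : Continuous k) (ck2 : Continuous k2)
    (hk : ∀ x y, HasDerivAt (fun s => k (x, s)) (k2 (x, y)) y)
    (hβ : ∀ y, HasDerivAt β (β' y) y) (cβ' : Continuous β') (cα : Continuous α) (ca : Continuous a)
    (k0 : ∀ z, 0 ≤ k z) (b0 : ∀ y, 0 ≤ β y) (hc : ∀ y, |β' y| ≤ c) (hS0 : β (-S) = 0)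
    (α0 : ∀ x, 0 ≤ α x) (α1 : ∀ x, α x ≤ 1) (a0 : ∀ x, 0 ≤ a x) (a1 : ∀ x, a x ≤ 1)
    (ak : ∀ x ∈ Set.Icc (-S) S, a x * ∫ y in (-S)..S, k (x, y) ≤ 1) :
    II S (fun z => k z ^ 2 * (α z.1 * β z.2 * a z.1 ^ 2)) ≤
      II S (fun z => |k2 z| * (α z.1 * β z.2)) + c * II S k := by
  have cβ : Continuous β := continuous_iff_continuousAt.2 fun y => (hβ y).continuousAt
  have hcc : 0 ≤ c := (abs_nonneg _).trans (hc 0)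
  rw [← II_cmul, ← II_add (by fun_prop) (by fun_prop)]
  unfold II
  apply intervalIntegral.integral_mono_on (by linarith)
  · exact (slice_cont (F := fun z => k z ^ 2 * (α z.1 * β z.2 * a z.1 ^ 2)) (by fun_prop) _ _).intervalIntegrable _ _
  · exact (slice_cont (F := fun z => |k2 z| * (α z.1 * β z.2) + c * k z) (by fun_prop) _ _).intervalIntegrable _ _
  intro x hx
  have h1 := slice1 (S := S) (c := c) hS (k := fun y => k (x, y)) (k' := fun y => k2 (x, y)) (hk x) hβ
    (by fun_prop) cβ' (fun y => k0 _) b0 hc hS0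
  have h2 := ak x hx
  set T := ∫ y in (-S)..S, k (x, y) with hT
  set U := ∫ y in (-S)..S, (|k2 (x, y)| * β y + c * k (x, y)) with hU
  have e1 : ∫ y in (-S)..S, k (x, y) ^ 2 * (α x * β y * a x ^ 2) =
      α x * a x ^ 2 * ∫ y in (-S)..S, k (x, y) ^ 2 * β y := by
    rw [← intervalIntegral.integral_const_mul]; congr 1; ext y; ring
  have hU0 : 0 ≤ U := by
    apply intervalIntegral.integral_nonneg (by linarith)
    intro y _
    have := k0 (x, y)
    have := b0 y
    positivity
  have hle : α x * U ≤ ∫ y in (-S)..S, (|k2 (x, y)| * (α x * β y) + c * k (x, y)) := by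
    rw [hU, ← intervalIntegral.integral_const_mul]
    apply intervalIntegral.integral_mono_on (by linarith)
    · apply Continuous.intervalIntegrable; fun_prop
    · apply Continuous.intervalIntegrable; fun_prop
    · intro y _
      have h3 := k0 (x, y)
      have := mul_le_mul_of_nonneg_right (α1 x) (mul_nonneg hcc h3)
      nlinarith
  show ∫ y in (-S)..S, k (x, y) ^ 2 * (α x * β y * a x ^ 2) ≤ ∫ y in (-S)..S, (|k2 (x, y)| * (α x * β y) + c * k (x, y))
  rw [e1]
  refine le_trans ?_ hle
  have a2 := mul_le_mul_of_nonneg_left h1 (mul_nonneg (α0 x) (sq_nonneg (a x)))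
  refine a2.trans ?_
  have : α x * a x ^ 2 * (T * U) = (α x * U) * (a x * (a x * T)) := by ring
  rw [this]
  have h5 : a x * (a x * T) ≤ 1 := by
    have := mul_le_mul_of_nonneg_left h2 (a0 x)
    linarith [a1 x]
  have := mul_le_mul_of_nonneg_left h5 (mul_nonneg (α0 x) hU0)
  linarith

/-- velocity bound -/
lemma ubound {S E M : ℝ} (hS : 1 ≤ S) {f f1 f2 g : ℝ × ℝ → ℝ}
    (hdx : ∀ x y, HasDerivAt (fun s => f (s, y)) (f1 (x, y)) x)
    (hdy : ∀ x y, HasDerivAt (fun s => f (x, s)) (f2 (x, y)) y)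
    (c1 : Continuous f1) (c2 : Continuous f2) (cg : Continuous g) (g0 : ∀ z, 0 ≤ g z)
    (g1 : ∀ z, |f1 z| ≤ g z) (g2 : ∀ z, |f2 z| ≤ g z)
    (hE : II S (fun z => g z ^ 2 / (1 + g z)) ≤ E) (E0 : 0 ≤ E) (M0 : 0 ≤ M)
    (hM : ∀ b ∈ Set.Icc (0:ℝ) 1, |f (0, b)| ≤ M)
    {x y : ℝ} (hx : x ∈ Set.Icc (-S) S) (hy : y ∈ Set.Icc (-S) S) :
    |f (x, y)| ≤ √S * (M + 6 + 2 * E) * (1 + ∫ y in (-S)..S, g (x, y) ^ 2 / (1 + g (x, y))) := by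
  set e : ℝ × ℝ → ℝ := fun z => g z ^ 2 / (1 + g z) with he
  have ce : Continuous e := by
    rw [he]
    refine Continuous.div (by fun_prop) (by fun_prop) fun z => ?_
    have := g0 z
    positivity
  have e0 : ∀ z, 0 ≤ e z := fun z => by have := g0 z; simp only [he]; positivity
  set σ := √S with hσ
  have σ1 : 1 ≤ σ := by rw [hσ]; exact Real.one_le_sqrt.2 hS
  have σσ : σ * σ = S := Real.mul_self_sqrt (by linarith)
  have hg : ∀ z, g z ≤ 1 / σ + 2 * σ * e z := by
    intro z
    have hz := g0 z
    simp only [he]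
    rw [← sub_nonneg]
    have : 1 / σ + 2 * σ * (g z ^ 2 / (1 + g z)) - g z
      = ((1 + g z) * (1 - σ * g z) + 2 * σ ^ 2 * g z ^ 2) / (σ * (1 + g z)) := by
      field_simp; ring
    rw [this]
    apply div_nonneg _ (by positivity)
    nlinarith [sq_nonneg (σ * g z - 1), mul_nonneg hz (by linarith : 0 ≤ σ), mul_nonneg (mul_nonneg hz hz) (by nlinarith : 0 ≤ σ ^ 2 - σ)]
  -- one-dimensional bound
  have len : ∀ (F F' G : ℝ → ℝ), (∀ s, HasDerivAt F (F' s) s) → Continuous F' → Continuous G →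
      (∀ s, |F' s| ≤ G s) → ∀ p ∈ Set.Icc (-S) S, ∀ q ∈ Set.Icc (-S) S,
      |F q - F p| ≤ ∫ s in (-S)..S, G s := by
    intro F F' G hF cF cG hG
    have main : ∀ p ∈ Set.Icc (-S) S, ∀ q ∈ Set.Icc (-S) S, p ≤ q →
        |F q - F p| ≤ ∫ s in (-S)..S, G s := by
      intro p hp q hq hpq
      rw [← intervalIntegral.integral_eq_sub_of_hasDerivAt (fun s _ => hF s) (cF.intervalIntegrable _ _)]
      refine (intervalIntegral.abs_integral_le_integral_abs hpq).trans ?_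
      refine (intervalIntegral.integral_mono_on hpq (cF.abs.intervalIntegrable _ _)
        (cG.intervalIntegrable _ _) (fun s _ => hG s)).trans ?_
      exact intervalIntegral.integral_mono_interval hp.1 hpq hq.2
        (Eventually.of_forall fun s => (abs_nonneg _).trans (hG s)) (cG.intervalIntegrable _ _)
    intro p hp q hq
    rcases le_total p q with h | h
    · exact main p hp q hq h
    · rw [abs_sub_comm]; exact main q hq p hp h
  have cut : ∀ G : ℝ → ℝ, Continuous G → ∀ e : ℝ → ℝ, Continuous e → (∀ s, G s ≤ 1 / σ + 2 * σ * e s) →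
      ∫ s in (-S)..S, G s ≤ 2 * σ + 2 * σ * ∫ s in (-S)..S, e s := by
    intro G cG e ce h
    refine (intervalIntegral.integral_mono_on (by linarith) (cG.intervalIntegrable _ _) ?_ (fun s _ => h s)).trans ?_
    · apply Continuous.intervalIntegrable; fun_prop
    · rw [intervalIntegral.integral_add, intervalIntegral.integral_const_mul]
      · simp
        apply le_of_eq
        field_simp
        nlinarith
      all_goals
        apply Continuous.intervalIntegrable; fun_prop
  -- choose b
  have hb : ∃ b ∈ Set.Icc (0:ℝ) 1, ∫ s in (-S)..S, e (s, b) ≤ E + 1 := by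
    by_contra hcon
    push Not at hcon
    have ct : Continuous (fun b : ℝ => ∫ s in (-S)..S, e (s, b)) :=
      slice_cont (F := fun z => e (z.2, z.1)) (by fun_prop) _ _
    have h1 : ∫ b in (0:ℝ)..1, (E + 1) ≤ ∫ b in (0:ℝ)..1, ∫ s in (-S)..S, e (s, b) := by
      apply intervalIntegral.integral_mono_on zero_le_one
      · simp
      · exact ct.intervalIntegrable _ _
      · intro b hb; exact (hcon b hb).le
    have h2 : ∫ b in (0:ℝ)..1, ∫ s in (-S)..S, e (s, b) ≤ ∫ b in (-S)..S, ∫ s in (-S)..S, e (s, b) := by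
      apply intervalIntegral.integral_mono_interval (by linarith) zero_le_one hS
      · refine Eventually.of_forall fun b => ?_
        exact intervalIntegral.integral_nonneg (by linarith) fun s _ => e0 _
      · exact ct.intervalIntegrable _ _
    have h3 := II_swap (S := S) (by linarith) ce
    have h4 : II S e ≤ E := hE
    rw [h3] at h4
    unfold II at h4
    simp at h1
    linarith
  obtain ⟨b, hb, hbE⟩ := hb
  have b1 : b ∈ Set.Icc (-S) S := ⟨by linarith [hb.1], by linarith [hb.2]⟩
  have z1 : (0:ℝ) ∈ Set.Icc (-S) S := ⟨by linarith, by linarith⟩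
  have q1 := len (fun s => f (s, b)) (fun s => f1 (s, b)) (fun s => g (s, b)) (fun s => hdx s b)
    (by fun_prop) (by fun_prop) (fun s => g1 _) 0 z1 x hx
  have q2 := len (fun s => f (x, s)) (fun s => f2 (x, s)) (fun s => g (x, s)) (fun s => hdy x s)
    (by fun_prop) (by fun_prop) (fun s => g2 _) b b1 y hy
  have r1 := cut (fun s => g (s, b)) (by fun_prop) (fun s => e (s, b)) (by fun_prop) (fun s => hg _)
  have r2 := cut (fun s => g (x, s)) (by fun_prop) (fun s => e (x, s)) (by fun_prop) (fun s => hg _)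
  have m1 := hM b hb
  set T := ∫ s in (-S)..S, e (x, s) with hT
  have T0 : 0 ≤ T := intervalIntegral.integral_nonneg (by linarith) fun s _ => e0 _
  have tri : |f (x, y)| ≤ |f (0, b)| + |f (x, b) - f (0, b)| + |f (x, y) - f (x, b)| := by
    have : f (x, y) = f (0, b) + (f (x, b) - f (0, b)) + (f (x, y) - f (x, b)) := by ring
    calc |f (x, y)| = |f (0, b) + (f (x, b) - f (0, b)) + (f (x, y) - f (x, b))| := by rw [← this]
      _ ≤ _ := abs_add_three _ _ _
  have s1 : 2 * σ * ∫ s in (-S)..S, e (s, b) ≤ 2 * σ * (E + 1) :=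
    mul_le_mul_of_nonneg_left hbE (by linarith)
  have hMσ : M ≤ σ * M := le_mul_of_one_le_left M0 σ1
  have : σ * (M + 6 + 2 * E) * (1 + T) = σ * (M + 6 + 2 * E) + 2 * σ * T + σ * (M + 4 + 2 * E) * T := by ring
  show |f (x, y)| ≤ σ * (M + 6 + 2 * E) * (1 + T)
  rw [this]
  have : 0 ≤ σ * (M + 4 + 2 * E) * T := by positivity
  nlinarith

lemma Sk_nonneg {F : ℝ × ℝ → ℝ} (h : ∀ z, 0 ≤ F z) (t : ℝ) (z : ℝ × ℝ) : 0 ≤ Sk F t z := by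
  unfold Sk av
  exact intervalIntegral.integral_nonneg zero_le_one fun _ _ =>
    intervalIntegral.integral_nonneg zero_le_one fun _ _ => h _

/-- basic smooth profile -/
lemma profile : ∃ (φ φ' φ'' : ℝ → ℝ) (C : ℝ), (∀ x, HasDerivAt φ (φ' x) x) ∧
    (∀ x, HasDerivAt φ' (φ'' x) x) ∧ Continuous φ'' ∧ 0 < C ∧ (∀ x, 0 ≤ φ x) ∧ (∀ x, φ x ≤ 1) ∧
    (∀ x, |x| ≤ 1 → φ x = 1) ∧ (∀ x, 2 ≤ |x| → φ x = 0) ∧ (∀ x, |φ' x| ≤ C) ∧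
    (∀ x, φ' x ^ 2 ≤ C * φ x) := by
  let b : ContDiffBump (0 : ℝ) := ⟨1, 2, by norm_num, by norm_num⟩
  have hb : ContDiff ℝ 2 (b : ℝ → ℝ) := b.contDiff
  have h1 : ContDiff ℝ 1 (deriv b) := by
    have : ContDiff ℝ (1 + 1) (b : ℝ → ℝ) := hb
    exact (contDiff_succ_iff_deriv.1 this).2.2
  have d0 : ∀ x, HasDerivAt b (deriv b x) x := fun x => (hb.differentiable (by norm_num) x).hasDerivAt
  have d1 : ∀ x, HasDerivAt (deriv b) (deriv (deriv b) x) x :=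
    fun x => (h1.differentiable (by norm_num) x).hasDerivAt
  have c2 : Continuous (deriv (deriv b)) := h1.continuous_deriv (by norm_num)
  have c1 : Continuous (deriv b) := h1.continuous
  have c0 : Continuous b := hb.continuous
  obtain ⟨B, hB⟩ := c1.bounded_above_of_compact_support b.hasCompactSupport.deriv
  have B0 : 0 ≤ B := (norm_nonneg _).trans (hB 0)
  refine ⟨fun x => b x ^ 2, fun x => 2 * b x * deriv b x,
    fun x => 2 * deriv b x * deriv b x + 2 * b x * deriv (deriv b) x, 2 * B + 4 * B ^ 2 + 1,
    fun x => ?_, fun x => ?_, by fun_prop, by positivity, fun x => sq_nonneg _, fun x => ?_,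
    fun x hx => ?_, fun x hx => ?_, fun x => ?_, fun x => ?_⟩
  · simpa using (d0 x).fun_pow 2
  · exact ((d0 x).const_mul 2).mul (d1 x)
  · have := b.nonneg (x := x); have := b.le_one (x := x); nlinarith
  · have : b x = 1 := b.one_of_mem_closedBall (by simpa using hx)
    simp [this]
  · have : b x = 0 := b.zero_of_le_dist (by simpa using hx)
    simp [this]
  · have := b.nonneg (x := x); have h2 := b.le_one (x := x)
    have h3 := hB x
    rw [Real.norm_eq_abs] at h3
    rw [abs_mul, abs_of_nonneg (by positivity)]
    nlinarith [abs_nonneg (deriv b x)]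
  · have h3 := hB x
    rw [Real.norm_eq_abs] at h3
    have h4 : deriv b x ^ 2 ≤ B ^ 2 := sq_le_sq' (abs_le.1 h3).1 (abs_le.1 h3).2
    have := mul_le_mul_of_nonneg_left h4 (sq_nonneg (b x))
    nlinarith [sq_nonneg (b x)]

structure Cutoff (C R S : ℝ) (s α α' α'' a : ℝ → ℝ) : Prop where
  d1 : ∀ x, HasDerivAt α (α' x) x
  d2 : ∀ x, HasDerivAt α' (α'' x) x
  c2 : Continuous α''
  p0 : ∀ x, 0 ≤ α x
  p1 : ∀ x, α x ≤ 1
  one : ∀ x, |x| ≤ R → α x = 1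
  zero : ∀ x, S ≤ |x| → α x = 0
  ca : Continuous a
  a0 : ∀ x, 0 ≤ a x
  a1 : ∀ x, a x ≤ 1
  as : ∀ x ∈ Set.Icc (-S) S, a x * (1 + s x) ≤ 1
  b1 : ∀ x, |α' x| ≤ C / R * a x ^ 3
  b2 : ∀ x, α' x ^ 2 ≤ C / R * (α x * a x ^ 2)

lemma exists_cutoff : ∃ C : ℝ, 0 < C ∧ ∀ (R E : ℝ) (s : ℝ → ℝ), 1 ≤ R → E ≤ R → Continuous s →
    (∀ x, 0 ≤ s x) → ∫ x in (-(256 * R))..(256 * R), s x ≤ E →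
    ∃ α α' α'' a, Cutoff C R (256 * R) s α α' α'' a := by
  obtain ⟨φ, φ', φ'', C, hφ, hφ', cφ, C0, φ0, φ1, φone, φzero, φb, φc⟩ := profile
  refine ⟨C, C0, fun R E s hR hER cs s0 hE => ?_⟩
  set S := 256 * R with hS
  have cφ0 : Continuous φ := continuous_iff_continuousAt.2 fun y => (hφ y).continuousAt
  have cφ1 : Continuous φ' := continuous_iff_continuousAt.2 fun y => (hφ' y).continuousAt
  have cF : Continuous (fun z : ℝ × ℝ => s z.1) := by fun_prop
  obtain ⟨t0, ht0, hu⟩ := Sk_unif cF (Q := Set.Icc (-S) S ×ˢ {0}) (isCompact_Icc.prod isCompact_singleton) one_pos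
  set t := t0 / 2 with ht
  have tp : 0 < t := by positivity
  set m : ℝ → ℝ := fun x => Sk (fun z => s z.1) t (x, 0) with hm
  set m' : ℝ → ℝ := fun x => J2.Dx (fun z => s z.1) t (x, 0) with hm'
  have dm : ∀ x, HasDerivAt m (m' x) x := fun x => Sk_dx cF tp.ne' x 0
  have cm' : Continuous m' := (J2.Dx_cont cF t).comp (by fun_prop)
  have cm : Continuous m := continuous_iff_continuousAt.2 fun y => (dm y).continuousAt
  have m0 : ∀ x, 0 ≤ m x := fun x => Sk_nonneg (fun z => s0 _) _ _
  have mc : ∀ x ∈ Set.Icc (-S) S, |m x - s x| ≤ 1 := fun x hx =>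
    hu t tp (by rw [ht]; linarith) (x, 0) ⟨hx, rfl⟩
  set a : ℝ → ℝ := fun x => (3 + m x)⁻¹ with ha
  have v0 : ∀ x, 0 < 3 + m x := fun x => by linarith [m0 x]
  have a0 : ∀ x, 0 < a x := fun x => inv_pos.2 (v0 x)
  have a1 : ∀ x, a x ≤ 1 := fun x => inv_le_one_of_one_le₀ (by linarith [m0 x])
  have da : ∀ x, HasDerivAt a (-m' x / (3 + m x) ^ 2) x := fun x => ((dm x).const_add 3).inv (v0 x).ne'
  have ca : Continuous a := continuous_iff_continuousAt.2 fun y => (da y).continuousAt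
  set A : ℝ → ℝ := fun x => ∫ y in (0:ℝ)..x, a y ^ 3 with hA
  have ca3 : Continuous (fun y => a y ^ 3) := by fun_prop
  have dA : ∀ x, HasDerivAt A (a x ^ 3) x := fun x => (ca3.integral_hasStrictDerivAt 0 x).hasDerivAt
  have Amono : Monotone A := monotone_of_deriv_nonneg (fun x => (dA x).differentiableAt)
    (fun x => by rw [(dA x).deriv]; exact (pow_pos (a0 x) 3).le)
  have A0 : A 0 = 0 := by simp [hA]
  have Ale : ∀ x, |A x| ≤ |x| := by
    intro x
    have := intervalIntegral.norm_integral_le_of_norm_le_const (a := (0:ℝ)) (b := x) (C := 1)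
      (f := fun y => a y ^ 3) (fun y _ => by
        rw [Real.norm_eq_abs, abs_of_nonneg (pow_pos (a0 y) 3).le]
        exact pow_le_one₀ (a0 y).le (a1 y))
    simpa using this
  have low : ∀ x ∈ Set.Icc (-S) S, 1 / 64 - 3 / 256 * s x ≤ a x ^ 3 := by
    intro x hx
    have h1 := (abs_le.1 (mc x hx)).2
    have h2 := s0 x
    have hv : 3 + m x ≤ 4 + s x := by linarith
    have h3 : (4 + s x)⁻¹ ≤ a x := inv_anti₀ (v0 x) hv
    have h4 : (4 + s x)⁻¹ ^ 3 ≤ a x ^ 3 := pow_le_pow_left₀ (by positivity) h3 3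
    refine le_trans ?_ h4
    rw [inv_pow, ← one_div, le_div_iff₀ (by positivity)]
    nlinarith [mul_nonneg h2 h2, mul_nonneg (mul_nonneg h2 h2) h2, mul_nonneg (mul_nonneg h2 h2) (mul_nonneg h2 h2)]
  have ints : ∀ p q, -S ≤ p → p ≤ q → q ≤ S → ∫ x in p..q, s x ≤ E := by
    intro p q h1 h2 h3
    refine le_trans ?_ hE
    exact intervalIntegral.integral_mono_interval h1 h2 h3 (Eventually.of_forall s0) (cs.intervalIntegrable _ _)
  have intA : ∀ p q, -S ≤ p → p ≤ q → q ≤ S → (q - p) / 64 - 3 / 256 * E ≤ ∫ x in p..q, a x ^ 3 := by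
    intro p q h1 h2 h3
    have h4 : ∫ x in p..q, (1 / 64 - 3 / 256 * s x) ≤ ∫ x in p..q, a x ^ 3 := by
      apply intervalIntegral.integral_mono_on h2
      · apply Continuous.intervalIntegrable; fun_prop
      · apply Continuous.intervalIntegrable; fun_prop
      · intro x hx; exact low x ⟨h1.trans hx.1, hx.2.trans h3⟩
    rw [intervalIntegral.integral_sub, intervalIntegral.integral_const_mul] at h4
    · have h5 := ints p q h1 h2 h3
      simp at h4
      linarith
    all_goals
      apply Continuous.intervalIntegrable; fun_prop
  have AS : 2 * R ≤ A S := by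
    have := intA 0 S (by linarith) (by linarith) le_rfl
    simp only [hA]; rw [hS] at this ⊢; linarith
  have AS' : A (-S) ≤ - (2 * R) := by
    have := intA (-S) 0 le_rfl (by linarith) (by linarith)
    simp only [hA]
    rw [intervalIntegral.integral_symm]
    rw [hS] at this ⊢; linarith
  have R0 : 0 < R := by linarith
  have dAR : ∀ x, HasDerivAt (fun x => A x / R) (a x ^ 3 / R) x := fun x => (dA x).div_const R
  have cA : Continuous A := continuous_iff_continuousAt.2 fun y => (dA y).continuousAt
  refine ⟨fun x => φ (A x / R), fun x => φ' (A x / R) * (a x ^ 3 / R),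
    fun x => (φ'' (A x / R) * (a x ^ 3 / R)) * (a x ^ 3 / R) + φ' (A x / R) *
      ((3 * a x ^ 2 * (-m' x / (3 + m x) ^ 2)) / R), ?_⟩
  refine ⟨a, fun x => ?_, fun x => ?_, ?_, fun x => φ0 _, fun x => φ1 _, fun x hx => ?_, fun x hx => ?_,
    ca, fun x => (a0 x).le, a1, fun x hx => ?_, fun x => ?_, fun x => ?_⟩
  · exact (hφ _).comp x (dAR x)
  · refine ((hφ' _).comp x (dAR x)).mul ?_
    have := ((da x).fun_pow 3).div_const R
    simpa using this
  · have hcd : Continuous (fun x => -m' x / (3 + m x) ^ 2) :=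
      Continuous.div (by fun_prop) (by fun_prop) fun x => (pow_pos (v0 x) 2).ne'
    fun_prop
  · apply φone
    rw [abs_div, abs_of_pos R0, div_le_one R0]
    exact (Ale x).trans hx
  · apply φzero
    rw [abs_div, abs_of_pos R0, le_div_iff₀ R0]
    rcases le_abs'.1 hx with h | h
    · have := Amono h
      rw [le_abs']; left; linarith
    · have := Amono h
      rw [le_abs']; right; linarith
  · have h1 := (abs_le.1 (mc x hx)).1
    simp only [ha]
    rw [inv_mul_le_iff₀ (v0 x)]
    linarith
  · have ap := pow_pos (a0 x) 3
    rw [abs_mul, abs_of_pos (by positivity : 0 < a x ^ 3 / R)]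
    have := mul_le_mul_of_nonneg_right (φb (A x / R)) (by positivity : 0 ≤ a x ^ 3 / R)
    refine this.trans (le_of_eq ?_)
    ring
  · have h1 := φc (A x / R)
    have h2 : (a x ^ 3 / R) ^ 2 ≤ a x ^ 2 / R := by
      rw [div_pow, div_le_div_iff₀ (by positivity) R0]
      have h3 : a x ^ 4 ≤ 1 := pow_le_one₀ (a0 x).le (a1 x)
      have h4 : a x ^ 2 * R * (a x ^ 4) ≤ a x ^ 2 * R * 1 := mul_le_mul_of_nonneg_left h3 (by positivity)
      have h5 : a x ^ 2 * R * 1 ≤ a x ^ 2 * R * R := mul_le_mul_of_nonneg_left hR (by positivity)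
      nlinarith
    rw [mul_pow]
    have h0 := φ0 (A x / R)
    calc φ' (A x / R) ^ 2 * (a x ^ 3 / R) ^ 2 ≤ (C * φ (A x / R)) * (a x ^ 2 / R) :=
          mul_le_mul h1 h2 (by positivity) (by positivity)
      _ = _ := by ring

/-- weighted norm of a symmetric matrix -/
def nn (a b c : ℝ) : ℝ := √(a ^ 2 + 2 * b ^ 2 + c ^ 2)

lemma nn_nonneg (a b c : ℝ) : 0 ≤ nn a b c := Real.sqrt_nonneg _
lemma nn_sq (a b c : ℝ) : nn a b c ^ 2 = a ^ 2 + 2 * b ^ 2 + c ^ 2 := Real.sq_sqrt (by positivity)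

lemma nn_cs (a b c x y z : ℝ) : |a * x + 2 * (b * y) + c * z| ≤ nn a b c * nn x y z := by
  apply abs_le_of_sq_le_sq _ (mul_nonneg (nn_nonneg _ _ _) (nn_nonneg _ _ _))
  rw [mul_pow, nn_sq, nn_sq]
  nlinarith [sq_nonneg (a * y - b * x), sq_nonneg (a * z - c * x), sq_nonneg (b * z - c * y)]

lemma nn_tri (a b c x y z : ℝ) : nn (a + x) (b + y) (c + z) ≤ nn a b c + nn x y z := by
  apply Real.sqrt_le_iff.2 ⟨add_nonneg (nn_nonneg _ _ _) (nn_nonneg _ _ _), ?_⟩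
  have h1 := nn_sq a b c
  have h2 := nn_sq x y z
  have h3 := (le_abs_self _).trans (nn_cs a b c x y z)
  nlinarith

lemma nn_close {a b c x y z d : ℝ} (d0 : 0 ≤ d) (h1 : |a - x| ≤ d / 2) (h2 : |b - y| ≤ d / 2) (h3 : |c - z| ≤ d / 2) :
    nn a b c ≤ nn x y z + d := by
  have := nn_tri x y z (a - x) (b - y) (c - z)
  simp only [add_sub_cancel] at this
  refine this.trans (add_le_add_right ?_ _)
  apply Real.sqrt_le_iff.2 ⟨d0, ?_⟩
  have e1 := sq_le_sq' (abs_le.1 h1).1 (abs_le.1 h1).2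
  have e2 := sq_le_sq' (abs_le.1 h2).1 (abs_le.1 h2).2
  have e3 := sq_le_sq' (abs_le.1 h3).1 (abs_le.1 h3).2
  nlinarith

def eee (x : ℝ) : ℝ := x ^ 2 / (1 + x)

lemma eee_nonneg {x : ℝ} (h : 0 ≤ x) : 0 ≤ eee x := by unfold eee; positivity

lemma eee_lip {x y d : ℝ} (hx : 0 ≤ x) (hy : 0 ≤ y) (d0 : 0 ≤ d) (h : x ≤ y + d) : eee x ≤ eee y + d := by
  unfold eee
  rw [← sub_nonneg]
  have : y ^ 2 / (1 + y) + d - x ^ 2 / (1 + x) = (d * ((1 + x) * (1 + y)) - (x - y) * (x + y + x * y)) / ((1 + x) * (1 + y)) := by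
    field_simp; ring
  rw [this]
  apply div_nonneg _ (by positivity)
  have h1 : (x - y) * (x + y + x * y) ≤ d * (x + y + x * y) :=
    mul_le_mul_of_nonneg_right (by linarith) (by positivity)
  nlinarith

/-- the regularized norm -/
def kk (G : ℝ) : ℝ := √(1 + G) - 1

lemma kk_nonneg {G : ℝ} (h : 0 ≤ G) : 0 ≤ kk G := by
  unfold kk
  have := Real.one_le_sqrt.2 (by linarith : 1 ≤ 1 + G)
  linarith
lemma kk_sq {G : ℝ} (h : 0 ≤ G) : kk G ^ 2 + 2 * kk G = G := by
  unfold kk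
  have := Real.sq_sqrt (by linarith : 0 ≤ 1 + G)
  nlinarith
lemma kk_le {n : ℝ} (h : 0 ≤ n) : kk (n ^ 2) ≤ eee n := by
  unfold kk eee
  have : √(1 + n ^ 2) ≤ n ^ 2 / (1 + n) + 1 := by
    apply Real.sqrt_le_iff.2 ⟨by positivity, ?_⟩
    have : n ^ 2 / (1 + n) + 1 = (1 + n + n ^ 2) / (1 + n) := by field_simp; ring
    rw [this, div_pow, le_div_iff₀ (by positivity)]
    nlinarith [sq_nonneg n]
  linarith

lemma amgm_pt {η n w r g d T : ℝ} (n0 : 0 ≤ n) (r0 : 0 ≤ r) (hrg : r ≤ g)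
    (hg : g ≤ n + d) (hd : d ≤ 1 / 4) (hw : w ^ 2 ≤ 16 * T) :
    (n / √(1 + n ^ 2)) * w * η ≤ η ^ 2 / (1 + 2 * r) * T + 16 * eee n := by
  set m := n / √(1 + n ^ 2) with hm
  have sq1 : √(1 + n ^ 2) ^ 2 = 1 + n ^ 2 := Real.sq_sqrt (by positivity)
  have m2 : m ^ 2 = n ^ 2 / (1 + n ^ 2) := by rw [hm, div_pow, sq1]
  have hv : 0 < 1 + 2 * r := by linarith
  have h1 : m * w * η ≤ η ^ 2 * w ^ 2 / (16 * (1 + 2 * r)) + 4 * (m ^ 2 * (1 + 2 * r)) := by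
    rw [← sub_nonneg]
    have : η ^ 2 * w ^ 2 / (16 * (1 + 2 * r)) + 4 * (m ^ 2 * (1 + 2 * r)) - m * w * η
      = (η * w - 8 * (m * (1 + 2 * r))) ^ 2 / (16 * (1 + 2 * r)) := by
      field_simp; ring
    rw [this]; positivity
  have h2 : η ^ 2 * w ^ 2 / (16 * (1 + 2 * r)) ≤ η ^ 2 / (1 + 2 * r) * T := by
    rw [div_mul_eq_mul_div, div_le_div_iff₀ (by positivity) hv]
    have := mul_le_mul_of_nonneg_left hw (mul_nonneg (sq_nonneg η) hv.le)
    nlinarith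
  have h3 : m ^ 2 * (1 + 2 * r) ≤ 4 * eee n := by
    rw [m2]
    unfold eee
    rw [div_mul_eq_mul_div, ← mul_div_assoc, div_le_div_iff₀ (by positivity) (by positivity)]
    have h4 : 1 + 2 * r ≤ 2 + 2 * n := by linarith
    have h5 : (1 + 2 * r) * (1 + n) ≤ 4 * (1 + n ^ 2) := by
      have := mul_le_mul_of_nonneg_right h4 (by linarith : 0 ≤ 1 + n)
      nlinarith [sq_nonneg (n - 1)]
    nlinarith [mul_le_mul_of_nonneg_left h5 (sq_nonneg n)]
  linarith

namespace J2

/-- gradient modulus -/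
def g (ψ : J2) (z : ℝ × ℝ) : ℝ := nn (ψ.f11 z) (ψ.f12 z) (ψ.f22 z)
def en (ψ : J2) (z : ℝ × ℝ) : ℝ := ψ.g z ^ 2 / (1 + ψ.g z)

lemma g_nonneg (ψ : J2) (z) : 0 ≤ ψ.g z := nn_nonneg _ _ _
lemma g_sq (ψ : J2) (z) : ψ.g z ^ 2 = ψ.gg z := nn_sq _ _ _
@[fun_prop] lemma g_cont (ψ : J2) : Continuous ψ.g := by unfold g nn; fun_prop
@[fun_prop] lemma en_cont (ψ : J2) : Continuous ψ.en := by
  unfold en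
  refine Continuous.div (by fun_prop) (by fun_prop) fun z => ?_
  have := ψ.g_nonneg z
  positivity
lemma en_nonneg (ψ : J2) (z) : 0 ≤ ψ.en z := by
  have := ψ.g_nonneg z
  unfold en; positivity
lemma r_le_g (ψ : J2) (z) : ψ.r z ≤ ψ.g z := by
  have := ψ.r_sq_le z
  rw [← g_sq] at this
  exact (pow_le_pow_iff_left₀ (ψ.r_nonneg z) (ψ.g_nonneg z) two_ne_zero).1 this

/-- one-variable functions -/
def ofX (α α' α'' : ℝ → ℝ) (d1 : ∀ x, HasDerivAt α (α' x) x) (d2 : ∀ x, HasDerivAt α' (α'' x) x)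
    (c2 : Continuous α'') : J2 where
  f z := α z.1
  f1 z := α' z.1
  f2 z := 0
  f11 z := α'' z.1
  f12 z := 0
  f22 z := 0
  d0 z := ((d1 z.1).comp_hasFDerivAt z hasFDerivAt_fst).congr_fderiv (by ext <;> simp)
  d1 z := ((d2 z.1).comp_hasFDerivAt z hasFDerivAt_fst).congr_fderiv (by ext <;> simp)
  d2 z := (hasFDerivAt_const _ _).congr_fderiv (by simp)
  c11 := by fun_prop
  c12 := by fun_prop
  c22 := by fun_prop
def ofY (α α' α'' : ℝ → ℝ) (d1 : ∀ x, HasDerivAt α (α' x) x) (d2 : ∀ x, HasDerivAt α' (α'' x) x)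
    (c2 : Continuous α'') : J2 where
  f z := α z.2
  f1 z := 0
  f2 z := α' z.2
  f11 z := 0
  f12 z := 0
  f22 z := α'' z.2
  d0 z := ((d1 z.2).comp_hasFDerivAt z hasFDerivAt_snd).congr_fderiv (by ext <;> simp)
  d1 z := (hasFDerivAt_const _ _).congr_fderiv (by simp)
  d2 z := ((d2 z.2).comp_hasFDerivAt z hasFDerivAt_snd).congr_fderiv (by ext <;> simp)
  c11 := by fun_prop
  c12 := by fun_prop
  c22 := by fun_prop

end J2

namespace Cutoff
variable {C R S : ℝ} {s α α' α'' a : ℝ → ℝ}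
lemma cα (h : Cutoff C R S s α α' α'' a) : Continuous α :=
  continuous_iff_continuousAt.2 fun y => (h.d1 y).continuousAt
lemma cα' (h : Cutoff C R S s α α' α'' a) : Continuous α' :=
  continuous_iff_continuousAt.2 fun y => (h.d2 y).continuousAt
lemma bC (h : Cutoff C R S s α α' α'' a) (C0 : 0 < C) (hR : 1 ≤ R) (x : ℝ) : |α' x| ≤ C := by
  refine (h.b1 x).trans ?_
  have h1 : a x ^ 3 ≤ 1 := pow_le_one₀ (h.a0 x) (h.a1 x)
  have h2 : C / R ≤ C := div_le_self C0.le hR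
  have h3 : 0 ≤ C / R := by positivity
  nlinarith
end Cutoff

namespace J2

set_option maxHeartbeats 1000000 in
lemma khat (ψ η : J2) (hψ : ψ.Weak) {C R S E : ℝ} (C0 : 0 < C) (hR : 1 ≤ R) (hS : S = 256 * R) (E0 : 0 ≤ E)
    {α α' α'' a β β' β'' b : ℝ → ℝ}
    (hα : Cutoff C R S (fun x => ∫ y in (-S)..S, ψ.en (x, y)) α α' α'' a)
    (hβ : Cutoff C R S (fun y => ∫ x in (-S)..S, ψ.en (x, y)) β β' β'' b)
    (hη : ∀ z, η.f z = α z.1 * β z.2) (sη : HasCompactSupport η.f) (hE : II S ψ.en ≤ E) :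
    II S (fun z => ψ.gg z * (α z.1 * β z.2 * (a z.1 ^ 2 + b z.2 ^ 2))) ≤
      32 * (∫ z, ψ.kd η z) + (3 + (40 + 4 * C) * (E + 1)) := by
  have S1 : 1 ≤ S := by linarith
  have S0 : 0 ≤ S := by linarith
  set d : ℝ := 1 / (16 * S ^ 2) with hd
  have d0 : 0 < d := by positivity
  have dS : 4 * S ^ 2 * d = 1 / 4 := by rw [hd]; field_simp; norm_num
  have d4 : d ≤ 1 / 4 := by nlinarith
  have dS1 : 2 * S * d ≤ 1 := by nlinarith
  have hQ : IsCompact (Set.Icc (-S) S ×ˢ Set.Icc (-S) S) := isCompact_Icc.prod isCompact_Icc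
  obtain ⟨t0, p0, -, hX⟩ := ψ.lemD η hψ sη one_pos
  obtain ⟨t1, p1, h1⟩ := Sk_unif ψ.c11 hQ (half_pos d0)
  obtain ⟨t2, p2, h2⟩ := Sk_unif ψ.c12 hQ (half_pos d0)
  obtain ⟨t3, p3, h3⟩ := Sk_unif ψ.c22 hQ (half_pos d0)
  obtain ⟨t, tp, tt⟩ := exists_between (lt_min (lt_min p0 p1) (lt_min p2 p3))
  have l0 : t < t0 := tt.trans_le ((min_le_left _ _).trans (min_le_left _ _))
  have l1 : t < t1 := tt.trans_le ((min_le_left _ _).trans (min_le_right _ _))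
  have l2 : t < t2 := tt.trans_le ((min_le_right _ _).trans (min_le_left _ _))
  have l3 : t < t3 := tt.trans_le ((min_le_right _ _).trans (min_le_right _ _))
  have X := hX t tp l0
  clear hX
  have tn := tp.ne'
  set n : ℝ × ℝ → ℝ := fun z => nn (Sk ψ.f11 t z) (Sk ψ.f12 t z) (Sk ψ.f22 t z) with hn
  have n0 : ∀ z, 0 ≤ n z := fun z => nn_nonneg _ _ _
  have k11 := Sk_cont ψ.c11 t
  have k12 := Sk_cont ψ.c12 t
  have k22 := Sk_cont ψ.c22 t
  have cn : Continuous n := by simp only [hn]; unfold nn; fun_prop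
  have gn : ∀ x ∈ Set.Icc (-S) S, ∀ y ∈ Set.Icc (-S) S, ψ.g (x, y) ≤ n (x, y) + d := by
    intro x hx y hy
    apply nn_close d0.le
    · rw [abs_sub_comm]; exact h1 t tp l1 _ ⟨hx, hy⟩
    · rw [abs_sub_comm]; exact h2 t tp l2 _ ⟨hx, hy⟩
    · rw [abs_sub_comm]; exact h3 t tp l3 _ ⟨hx, hy⟩
  have ng : ∀ x ∈ Set.Icc (-S) S, ∀ y ∈ Set.Icc (-S) S, n (x, y) ≤ ψ.g (x, y) + d := by
    intro x hx y hy
    apply nn_close d0.le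
    · exact h1 t tp l1 _ ⟨hx, hy⟩
    · exact h2 t tp l2 _ ⟨hx, hy⟩
    · exact h3 t tp l3 _ ⟨hx, hy⟩
  have een : ∀ x ∈ Set.Icc (-S) S, ∀ y ∈ Set.Icc (-S) S, eee (n (x, y)) ≤ ψ.en (x, y) + d := by
    intro x hx y hy
    exact eee_lip (n0 _) (ψ.g_nonneg _) d0.le (ng x hx y hy)
  set k : ℝ × ℝ → ℝ := fun z => kk (n z ^ 2) with hk
  have k0 : ∀ z, 0 ≤ k z := fun z => kk_nonneg (sq_nonneg _)
  have ck : Continuous k := by simp only [hk]; unfold kk; fun_prop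
  have cee : Continuous (fun z => eee (n z)) := by
    unfold eee
    refine Continuous.div (by fun_prop) (by fun_prop) fun z => ?_
    have := n0 z
    positivity
  have kee : ∀ z, k z ≤ eee (n z) := fun z => kk_le (n0 z)
  -- derivatives
  set k1 : ℝ × ℝ → ℝ := fun z => (Sk ψ.f11 t z * Dx ψ.f11 t z + 2 * (Sk ψ.f12 t z * Dx ψ.f12 t z) + Sk ψ.f22 t z * Dx ψ.f22 t z) / √(1 + n z ^ 2) with hk1
  set k2 : ℝ × ℝ → ℝ := fun z => (Sk ψ.f11 t z * Dy ψ.f11 t z + 2 * (Sk ψ.f12 t z * Dy ψ.f12 t z) + Sk ψ.f22 t z * Dy ψ.f22 t z) / √(1 + n z ^ 2) with hk2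
  have sp : ∀ z, 0 < √(1 + n z ^ 2) := fun z => Real.sqrt_pos.2 (by positivity)
  have x11 := Dx_cont ψ.c11 t
  have x12 := Dx_cont ψ.c12 t
  have x22 := Dx_cont ψ.c22 t
  have y11 := Dy_cont ψ.c11 t
  have y12 := Dy_cont ψ.c12 t
  have y22 := Dy_cont ψ.c22 t
  have ck1 : Continuous k1 := Continuous.div (by fun_prop) (by fun_prop) fun z => (sp z).ne'
  have ck2 : Continuous k2 := Continuous.div (by fun_prop) (by fun_prop) fun z => (sp z).ne'
  have hder : ∀ (A B D : ℝ → ℝ) (A' B' D' x : ℝ), HasDerivAt A A' x → HasDerivAt B B' x → HasDerivAt D D' x →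
      HasDerivAt (fun s => kk (nn (A s) (B s) (D s) ^ 2))
        ((A x * A' + 2 * (B x * B') + D x * D') / √(1 + nn (A x) (B x) (D x) ^ 2)) x := by
    intro A B D A' B' D' x hA hB hD
    have e : (fun s => kk (nn (A s) (B s) (D s) ^ 2)) = fun s => √(1 + (A s ^ 2 + 2 * B s ^ 2 + D s ^ 2)) - 1 := by
      ext s; rw [nn_sq]; rfl
    rw [e, nn_sq]
    have h := ((((hA.fun_pow 2).add ((hB.fun_pow 2).const_mul 2)).add (hD.fun_pow 2)).const_add 1)
    have := (h.sqrt (by simp only [Pi.add_apply]; positivity)).sub_const 1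
    refine this.congr_deriv ?_
    simp only [Pi.add_apply]
    rw [div_eq_div_iff (by positivity) (by positivity)]
    push_cast
    ring
  have dk1 : ∀ x y, HasDerivAt (fun s => k (s, y)) (k1 (x, y)) x := fun x y =>
    hder (fun s => Sk ψ.f11 t (s, y)) (fun s => Sk ψ.f12 t (s, y)) (fun s => Sk ψ.f22 t (s, y)) _ _ _ x
      (Sk_dx ψ.c11 tn x y) (Sk_dx ψ.c12 tn x y) (Sk_dx ψ.c22 tn x y)
  have dk2 : ∀ x y, HasDerivAt (fun s => k (x, s)) (k2 (x, y)) y := fun x y =>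
    hder (fun s => Sk ψ.f11 t (x, s)) (fun s => Sk ψ.f12 t (x, s)) (fun s => Sk ψ.f22 t (x, s)) _ _ _ y
      (Sk_dy ψ.c11 tn x y) (Sk_dy ψ.c12 tn x y) (Sk_dy ψ.c22 tn x y)
  -- pointwise gradient bound
  have cα := hα.cα
  have cβ := hβ.cα
  have ca := hα.ca
  have cb := hβ.ca
  have cW := ψ.WW_cont η
  have ct := ψ.tau_cont t
  have grad : ∀ x ∈ Set.Icc (-S) S, ∀ y ∈ Set.Icc (-S) S,
      |k2 (x, y)| * (α x * β y) + |k1 (x, y)| * (α x * β y) ≤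
        ψ.WW η (x, y) * ψ.tau t (x, y) + 16 * eee (n (x, y)) := by
    intro x hx y hy
    set z := (x, y) with hz
    set wx := nn (Dx ψ.f11 t z) (Dx ψ.f12 t z) (Dx ψ.f22 t z) with hwx
    set wy := nn (Dy ψ.f11 t z) (Dy ψ.f12 t z) (Dy ψ.f22 t z) with hwy
    have b1 : |k1 z| ≤ (n z / √(1 + n z ^ 2)) * wx := by
      simp only [hk1]
      rw [abs_div, abs_of_pos (sp z), div_mul_eq_mul_div]
      exact div_le_div_of_nonneg_right (nn_cs _ _ _ _ _ _) (sp z).le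
    have b2 : |k2 z| ≤ (n z / √(1 + n z ^ 2)) * wy := by
      simp only [hk2]
      rw [abs_div, abs_of_pos (sp z), div_mul_eq_mul_div]
      exact div_le_div_of_nonneg_right (nn_cs _ _ _ _ _ _) (sp z).le
    have hw : (wx + wy) ^ 2 ≤ 16 * ψ.tau t z := by
      have e1 := nn_sq (Dx ψ.f11 t z) (Dx ψ.f12 t z) (Dx ψ.f22 t z)
      have e2 := nn_sq (Dy ψ.f11 t z) (Dy ψ.f12 t z) (Dy ψ.f22 t z)
      have e3 := ψ.grad_le tn z
      rw [← hwx] at e1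
      rw [← hwy] at e2
      nlinarith [sq_nonneg (wx - wy)]
    have h0 : 0 ≤ α x * β y := mul_nonneg (hα.p0 _) (hβ.p0 _)
    have := amgm_pt (η := α x * β y) (n0 z) (ψ.r_nonneg z) (ψ.r_le_g z) (gn x hx y hy) d4 hw
    have e : ψ.WW η z = (α x * β y) ^ 2 / (1 + 2 * ψ.r z) := by
      unfold WW; rw [hη]
    rw [e]
    refine le_trans ?_ this
    have := mul_le_mul_of_nonneg_right (add_le_add b2 b1) h0
    nlinarith
  -- integrals
  have Ik : II S (fun z => eee (n z)) ≤ E + 1 := by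
    have : II S (fun z => eee (n z)) ≤ II S (fun z => ψ.en z + d) :=
      II_mono S0 cee (by fun_prop) een
    rw [II_add (by fun_prop) (by fun_prop), II_const] at this
    linarith
  have Ik' : II S k ≤ E + 1 := (II_mono S0 ck cee (fun x _ y _ => kee _)).trans Ik
  have ak : ∀ x ∈ Set.Icc (-S) S, a x * ∫ y in (-S)..S, k (x, y) ≤ 1 := by
    intro x hx
    refine le_trans (mul_le_mul_of_nonneg_left ?_ (hα.a0 x)) (hα.as x hx)
    have : ∫ y in (-S)..S, k (x, y) ≤ ∫ y in (-S)..S, (ψ.en (x, y) + d) := by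
      apply intervalIntegral.integral_mono_on (by linarith)
      · apply Continuous.intervalIntegrable; fun_prop
      · apply Continuous.intervalIntegrable; fun_prop
      · intro y hy; exact (kee _).trans (een x hx y hy)
    rw [intervalIntegral.integral_add] at this
    · simp only [intervalIntegral.integral_const, smul_eq_mul] at this
      linarith
    all_goals
      apply Continuous.intervalIntegrable; fun_prop
  have bk : ∀ y ∈ Set.Icc (-S) S, b y * ∫ x in (-S)..S, k (x, y) ≤ 1 := by
    intro y hy
    refine le_trans (mul_le_mul_of_nonneg_left ?_ (hβ.a0 y)) (hβ.as y hy)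
    have : ∫ x in (-S)..S, k (x, y) ≤ ∫ x in (-S)..S, (ψ.en (x, y) + d) := by
      apply intervalIntegral.integral_mono_on (by linarith)
      · apply Continuous.intervalIntegrable; fun_prop
      · apply Continuous.intervalIntegrable; fun_prop
      · intro x hx; exact (kee _).trans (een x hx y hy)
    rw [intervalIntegral.integral_add] at this
    · simp only [intervalIntegral.integral_const, smul_eq_mul] at this
      linarith
    all_goals
      apply Continuous.intervalIntegrable; fun_prop
  have sl1 := slice2 (c := C) S0 ck ck2 dk2 hβ.d1 hβ.cα' cα ca k0 hβ.p0 (hβ.bC C0 hR)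
    (hβ.zero _ (by rw [abs_neg]; exact le_abs_self S)) hα.p0 hα.p1 hα.a0 hα.a1 ak
  have sl2 := slice2 (c := C) S0 (k := fun z => k (z.2, z.1)) (k2 := fun z => k1 (z.2, z.1))
    (by fun_prop) (by fun_prop) (fun x y => dk1 y x) hα.d1 hα.cα' cβ cb (fun z => k0 _) hα.p0 (hα.bC C0 hR)
    (hα.zero _ (by rw [abs_neg]; exact le_abs_self S)) hβ.p0 hβ.p1 hβ.a0 hβ.a1 bk
  rw [II_swap S0 (F := fun z => k (z.2, z.1) ^ 2 * _) (by fun_prop),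
    II_swap S0 (F := fun z => |k1 (z.2, z.1)| * _) (by fun_prop), II_swap S0 (F := fun z => k (z.2, z.1)) (by fun_prop)] at sl2
  simp only at sl2
  have gI : II S (fun z => |k2 z| * (α z.1 * β z.2)) + II S (fun z => |k1 z| * (β z.2 * α z.1)) ≤
      (16 * (∫ z, ψ.kd η z) + 1) + 16 * (E + 1) := by
    have e : (fun z : ℝ × ℝ => |k1 z| * (β z.2 * α z.1)) = fun z => |k1 z| * (α z.1 * β z.2) := by
      ext z; ring
    rw [e, ← II_add (by fun_prop) (by fun_prop)]
    have := II_mono (S := S) S0 (F := fun z => |k2 z| * (α z.1 * β z.2) + |k1 z| * (α z.1 * β z.2))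
      (G := fun z => ψ.WW η z * ψ.tau t z + 16 * eee (n z)) (by fun_prop) (by fun_prop) grad
    refine this.trans ?_
    rw [II_add (by fun_prop) (by fun_prop), II_cmul, II_eq_integral S0 (by fun_prop)]
    · linarith
    · intro z hz
      have : η.f z = 0 := by
        rw [hη]
        rcases hz with h | h
        · rw [hα.zero _ h, zero_mul]
        · rw [hβ.zero _ h, mul_zero]
      simp [WW, this]
  have main : II S (fun z => ψ.gg z * (α z.1 * β z.2 * (a z.1 ^ 2 + b z.2 ^ 2))) ≤
      II S (fun z => (2 * (k z ^ 2 * (α z.1 * β z.2 * a z.1 ^ 2)) + 2 * (k z ^ 2 * (β z.2 * α z.1 * b z.2 ^ 2)))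
        + (8 * k z + 4 * d ^ 2)) := by
    have cgg : Continuous ψ.gg := by unfold gg; fun_prop
    apply II_mono S0 (by fun_prop) (by fun_prop)
    intro x hx y hy
    have h1 := gn x hx y hy
    have h2 := ψ.g_sq (x, y)
    have h3 := kk_sq (sq_nonneg (n (x, y)))
    have h4 : ψ.gg (x, y) ≤ 2 * k (x, y) ^ 2 + (4 * k (x, y) + 2 * d ^ 2) := by
      rw [← h2]
      have := ψ.g_nonneg (x, y)
      have h5 : ψ.g (x, y) ^ 2 ≤ (n (x, y) + d) ^ 2 := pow_le_pow_left₀ this h1 2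
      have h6 : k (x, y) ^ 2 + 2 * k (x, y) = n (x, y) ^ 2 := h3
      nlinarith [sq_nonneg (n (x, y) - d)]
    set w := α x * β y * (a x ^ 2 + b y ^ 2) with hw
    have ab0 : 0 ≤ α x * β y := mul_nonneg (hα.p0 _) (hβ.p0 _)
    have ab1 : α x * β y ≤ 1 := mul_le_one₀ (hα.p1 _) (hβ.p0 _) (hβ.p1 _)
    have aa : a x ^ 2 ≤ 1 := pow_le_one₀ (hα.a0 x) (hα.a1 x)
    have bb : b y ^ 2 ≤ 1 := pow_le_one₀ (hβ.a0 y) (hβ.a1 y)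
    have w0 : 0 ≤ w := by positivity
    have w2 : w ≤ 2 := by
      have : w ≤ 1 * (a x ^ 2 + b y ^ 2) := mul_le_mul_of_nonneg_right ab1 (by positivity)
      linarith
    have h7 := mul_le_mul_of_nonneg_right h4 w0
    have h8 : (4 * k (x, y) + 2 * d ^ 2) * w ≤ (4 * k (x, y) + 2 * d ^ 2) * 2 :=
      mul_le_mul_of_nonneg_left w2 (by have := k0 (x, y); positivity)
    have h9 : 2 * k (x, y) ^ 2 * w = 2 * (k (x, y) ^ 2 * (α x * β y * a x ^ 2)) + 2 * (k (x, y) ^ 2 * (β y * α x * b y ^ 2)) := by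
      rw [hw]; ring
    rw [add_mul] at h7
    show ψ.gg (x, y) * w ≤ 2 * (k (x, y) ^ 2 * (α x * β y * a x ^ 2)) + 2 * (k (x, y) ^ 2 * (β y * α x * b y ^ 2))
        + (8 * k (x, y) + 4 * d ^ 2)
    rw [← h9]
    have h10 : (4 * k (x, y) + 2 * d ^ 2) * 2 = 8 * k (x, y) + 4 * d ^ 2 := by ring
    rw [h10] at h8
    exact h7.trans (add_le_add_right h8 _)
  refine main.trans ?_
  rw [II_add (by fun_prop) (by fun_prop), II_add (by fun_prop) (by fun_prop), II_cmul, II_cmul,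
    II_add (by fun_prop) (by fun_prop), II_cmul, II_const]
  have hdd : 4 * S ^ 2 * (4 * d ^ 2) ≤ 1 := by
    have : 4 * S ^ 2 * (4 * d ^ 2) = (4 * S ^ 2 * d) * (4 * d) := by ring
    rw [this, dS]; linarith
  have hCk : C * II S k ≤ C * (E + 1) := mul_le_mul_of_nonneg_left Ik' C0.le
  linarith

end J2

namespace J2

lemma kd_pt {g2 U α β α' β' a b q s t V : ℝ} (g0 : 0 ≤ g2) (V0 : 0 ≤ V) (q0 : 0 ≤ q)
    (hα0 : 0 ≤ α) (hα1 : α ≤ 1) (hβ0 : 0 ≤ β) (hβ1 : β ≤ 1) (ha0 : 0 ≤ a) (hb0 : 0 ≤ b)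
    (as : a * (1 + s) ≤ 1) (bt : b * (1 + t) ≤ 1) (U0 : 0 ≤ U)
    (U1 : U ≤ V * (1 + s)) (U2 : U ≤ V * (1 + t))
    (b1 : |α'| ≤ q * a ^ 3) (b2 : α' ^ 2 ≤ q * (α * a ^ 2))
    (d1 : |β'| ≤ q * b ^ 3) (d2 : β' ^ 2 ≤ q * (β * b ^ 2)) :
    g2 * ((α' * β) ^ 2 + (α * β') ^ 2) + U * g2 * |α * β| * (|α' * β| + |α * β'|) ≤
      (q * (1 + V)) * (g2 * (α * β * (a ^ 2 + b ^ 2))) := by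
  have e1 : (α' * β) ^ 2 ≤ q * (α * β * a ^ 2) := by
    rw [mul_pow]
    have h1 : β ^ 2 ≤ β := by nlinarith
    calc α' ^ 2 * β ^ 2 ≤ (q * (α * a ^ 2)) * β := mul_le_mul b2 h1 (by positivity) (by positivity)
      _ = _ := by ring
  have e2 : (α * β') ^ 2 ≤ q * (α * β * b ^ 2) := by
    rw [mul_pow]
    have h1 : α ^ 2 ≤ α := by nlinarith
    calc α ^ 2 * β' ^ 2 ≤ α * (q * (β * b ^ 2)) := mul_le_mul h1 d2 (by positivity) (by positivity)
      _ = _ := by ring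
  have e3 : U * |α' * β| ≤ V * q * a ^ 2 := by
    rw [abs_mul, abs_of_nonneg hβ0]
    have h1 : |α'| * β ≤ q * a ^ 3 := by
      have := mul_le_mul b1 hβ1 hβ0 (by positivity); linarith
    calc U * (|α'| * β) ≤ U * (q * a ^ 3) := mul_le_mul_of_nonneg_left h1 U0
      _ ≤ (V * (1 + s)) * (q * a ^ 3) := mul_le_mul_of_nonneg_right U1 (by positivity)
      _ = (V * q * a ^ 2) * (a * (1 + s)) := by ring
      _ ≤ (V * q * a ^ 2) * 1 := mul_le_mul_of_nonneg_left as (by positivity)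
      _ = _ := by ring
  have e4 : U * |α * β'| ≤ V * q * b ^ 2 := by
    rw [abs_mul, abs_of_nonneg hα0]
    have h1 : α * |β'| ≤ q * b ^ 3 := by
      have := mul_le_mul hα1 d1 (abs_nonneg _) zero_le_one; linarith
    calc U * (α * |β'|) ≤ U * (q * b ^ 3) := mul_le_mul_of_nonneg_left h1 U0
      _ ≤ (V * (1 + t)) * (q * b ^ 3) := mul_le_mul_of_nonneg_right U2 (by positivity)
      _ = (V * q * b ^ 2) * (b * (1 + t)) := by ring
      _ ≤ (V * q * b ^ 2) * 1 := mul_le_mul_of_nonneg_left bt (by positivity)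
      _ = _ := by ring
  rw [abs_of_nonneg (mul_nonneg hα0 hβ0)]
  have f1 := mul_le_mul_of_nonneg_left (add_le_add e1 e2) g0
  have f2 := mul_le_mul_of_nonneg_left (add_le_add e3 e4) (mul_nonneg g0 (mul_nonneg hα0 hβ0))
  calc _ = g2 * ((α' * β) ^ 2 + (α * β') ^ 2) + g2 * (α * β) * (U * |α' * β| + U * |α * β'|) := by ring
    _ ≤ _ := add_le_add f1 f2
    _ = _ := by ring

lemma f1_le_g (a b c : ℝ) : |a| ≤ nn a b c ∧ |b| ≤ nn a b c ∧ |c| ≤ nn a b c := by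
  refine ⟨?_, ?_, ?_⟩ <;>
  · apply Real.abs_le_sqrt
    nlinarith [sq_nonneg a, sq_nonneg b, sq_nonneg c]

lemma sqrt_uu (x y : ℝ) : √(x ^ 2 + y ^ 2) ≤ |x| + |y| := by
  apply Real.sqrt_le_iff.2 ⟨by positivity, ?_⟩
  nlinarith [sq_abs x, sq_abs y, abs_nonneg x, abs_nonneg y, mul_nonneg (abs_nonneg x) (abs_nonneg y)]

lemma good_cut (ψ : J2) (hψ : ψ.Weak) (hi : Integrable ψ.en) (ρ : ℝ) {ε : ℝ} (hε : 0 < ε) :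
    ∃ η : J2, HasCompactSupport η.f ∧ (∀ z, ‖z‖ ≤ ρ → η.f z = 1) ∧ ∫ z, ψ.kd η z ≤ ε := by
  obtain ⟨C, C0, hC⟩ := exists_cutoff
  set E := ∫ z, ψ.en z with hE
  have E0 : 0 ≤ E := integral_nonneg ψ.en_nonneg
  -- bound M
  have hM : ∃ M : ℝ, 0 ≤ M ∧ ∀ b ∈ Set.Icc (0:ℝ) 1, |ψ.f1 (0, b)| ≤ M ∧ |ψ.f1 (b, 0)| ≤ M ∧
      |ψ.f2 (0, b)| ≤ M ∧ |ψ.f2 (b, 0)| ≤ M := by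
    have cc : Continuous (fun b : ℝ => |ψ.f1 (0, b)| + |ψ.f1 (b, 0)| + |ψ.f2 (0, b)| + |ψ.f2 (b, 0)|) := by fun_prop
    obtain ⟨M, hM⟩ := (isCompact_Icc (a := (0:ℝ)) (b := 1)).bddAbove_image cc.continuousOn
    have hM' : ∀ b ∈ Set.Icc (0:ℝ) 1, |ψ.f1 (0, b)| + |ψ.f1 (b, 0)| + |ψ.f2 (0, b)| + |ψ.f2 (b, 0)| ≤ M :=
      fun b hb => hM ⟨b, hb, rfl⟩
    refine ⟨M, ?_, fun b hb => ?_⟩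
    · refine le_trans ?_ (hM' 0 ⟨le_rfl, zero_le_one⟩); positivity
    · have := hM' b hb
      have h1 := abs_nonneg (ψ.f1 (0, b))
      have h2 := abs_nonneg (ψ.f1 (b, 0))
      have h3 := abs_nonneg (ψ.f2 (0, b))
      have h4 := abs_nonneg (ψ.f2 (b, 0))
      refine ⟨?_, ?_, ?_, ?_⟩ <;> linarith
  obtain ⟨M, M0, hM⟩ := hM
  set c0 := M + 6 + 2 * E with hc0
  set D := 3 + (40 + 4 * C) * (E + 1) with hD
  have D0 : 0 < D := by positivity
  -- choice of R
  set δ := min (1 / 64) (ε / (2 * D)) with hδ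
  have δ0 : 0 < δ := by positivity
  set B := C * (1 + 32 * c0) / δ with hB
  have B0 : 0 < B := by positivity
  set R := max (max 1 E) (max ρ (B ^ 2)) with hR
  have R1 : 1 ≤ R := (le_max_left _ _).trans (le_max_left _ _)
  have RE : E ≤ R := (le_max_right _ _).trans (le_max_left _ _)
  have Rρ : ρ ≤ R := (le_max_left _ _).trans (le_max_right _ _)
  have RB : B ^ 2 ≤ R := (le_max_right _ _).trans (le_max_right _ _)
  have R0 : 0 < R := by linarith
  set S := 256 * R with hS
  have S1 : 1 ≤ S := by linarith
  have S0 : 0 ≤ S := by linarith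
  have IE : II S ψ.en ≤ E := II_le_integral S0 ψ.en_cont ψ.en_nonneg hi
  have IE' : II S (fun z => ψ.en (z.2, z.1)) ≤ E := by rw [← II_swap S0 ψ.en_cont]; exact IE
  have cs := slice_cont ψ.en_cont (-S) S
  have ct : Continuous (fun y : ℝ => ∫ x in (-S)..S, ψ.en (x, y)) :=
    slice_cont (F := fun z => ψ.en (z.2, z.1)) (by fun_prop) (-S) S
  have s0 : ∀ x : ℝ, 0 ≤ ∫ y in (-S)..S, ψ.en (x, y) := fun x =>
    intervalIntegral.integral_nonneg (by linarith) fun _ _ => ψ.en_nonneg _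
  have t0 : ∀ y : ℝ, 0 ≤ ∫ x in (-S)..S, ψ.en (x, y) := fun x =>
    intervalIntegral.integral_nonneg (by linarith) fun _ _ => ψ.en_nonneg _
  obtain ⟨α, α', α'', a, hα⟩ := hC R E _ R1 RE cs s0 IE
  obtain ⟨β, β', β'', b, hβ⟩ := hC R E _ R1 RE ct t0 IE'
  set η : J2 := (ofX α α' α'' hα.d1 hα.d2 hα.c2).mul (ofY β β' β'' hβ.d1 hβ.d2 hβ.c2) with hη
  have η0 : ∀ z, η.f z = α z.1 * β z.2 := fun z => rfl
  have η1 : ∀ z, η.f1 z = α' z.1 * β z.2 := fun z => by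
    show α' z.1 * β z.2 + α z.1 * 0 = _; ring
  have η2 : ∀ z, η.f2 z = α z.1 * β' z.2 := fun z => by
    show 0 * β z.2 + α z.1 * β' z.2 = _; ring
  have ηz : ∀ z : ℝ × ℝ, (S ≤ |z.1| ∨ S ≤ |z.2|) → η.f z = 0 := by
    intro z hz
    rw [η0]
    rcases hz with h | h
    · rw [hα.zero _ h, zero_mul]
    · rw [hβ.zero _ h, mul_zero]
  have sη : HasCompactSupport η.f := by
    refine cs_of_far S fun z hz => ηz z ?_
    rw [Prod.norm_def, lt_max_iff] at hz
    exact hz.imp le_of_lt le_of_lt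
  refine ⟨η, sη, fun z hz => ?_, ?_⟩
  · rw [Prod.norm_def, max_le_iff] at hz
    rw [η0, hα.one _ (hz.1.trans Rρ), hβ.one _ (hz.2.trans Rρ), one_mul]
  have KH := ψ.khat η hψ C0 R1 hS E0 hα hβ η0 sη IE
  set KK := ∫ z, ψ.kd η z with hKK
  set H := II S (fun z => ψ.gg z * (α z.1 * β z.2 * (a z.1 ^ 2 + b z.2 ^ 2))) with hH
  have V0 : 0 ≤ √S * c0 := by positivity
  have hg11 : ∀ z, |ψ.f11 z| ≤ ψ.g z := fun z => (f1_le_g _ _ _).1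
  have hg12 : ∀ z, |ψ.f12 z| ≤ ψ.g z := fun z => (f1_le_g _ _ _).2.1
  have hg22 : ∀ z, |ψ.f22 z| ≤ ψ.g z := fun z => (f1_le_g _ _ _).2.2
  have key : KK ≤ (C / R * (1 + 2 * (√S * c0))) * H := by
    rw [hH, ← II_cmul, hKK, ← II_eq_integral S0 (ψ.kd_cont η)]
    · have cα := hα.cα
      have cβ := hβ.cα
      have ca := hα.ca
      have cb := hβ.ca
      have cgg : Continuous ψ.gg := by unfold gg; fun_prop
      apply II_mono S0 (ψ.kd_cont η) (by fun_prop)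
      intro x hx y hy
      have u1 := ubound S1 ψ.d1.dx ψ.d1.dy ψ.c11 ψ.c12 ψ.g_cont ψ.g_nonneg hg11 hg12 IE E0 M0
        (fun b hb => (hM b hb).1) hx hy
      have u2 := ubound S1 ψ.d2.dx ψ.d2.dy ψ.c12 ψ.c22 ψ.g_cont ψ.g_nonneg hg12 hg22 IE E0 M0
        (fun b hb => (hM b hb).2.2.1) hx hy
      have v1 := ubound S1 (f := fun z => ψ.f1 (z.2, z.1)) (f1 := fun z => ψ.f12 (z.2, z.1))
        (f2 := fun z => ψ.f11 (z.2, z.1)) (g := fun z => ψ.g (z.2, z.1))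
        (fun x y => ψ.d1.dy y x) (fun x y => ψ.d1.dx y x) (by fun_prop) (by fun_prop) (by fun_prop)
        (fun z => ψ.g_nonneg _) (fun z => hg12 _) (fun z => hg11 _) IE' E0 M0
        (fun b hb => (hM b hb).2.1) hy hx
      have v2 := ubound S1 (f := fun z => ψ.f2 (z.2, z.1)) (f1 := fun z => ψ.f22 (z.2, z.1))
        (f2 := fun z => ψ.f12 (z.2, z.1)) (g := fun z => ψ.g (z.2, z.1))
        (fun x y => ψ.d2.dy y x) (fun x y => ψ.d2.dx y x) (by fun_prop) (by fun_prop) (by fun_prop)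
        (fun z => ψ.g_nonneg _) (fun z => hg22 _) (fun z => hg12 _) IE' E0 M0
        (fun b hb => (hM b hb).2.2.2) hy hx
      have U := sqrt_uu (ψ.f1 (x, y)) (ψ.f2 (x, y))
      unfold kd
      rw [η0, η1, η2]
      simp only
      refine kd_pt (s := ∫ y in (-S)..S, ψ.en (x, y)) (t := ∫ x in (-S)..S, ψ.en (x, y)) (ψ.gg_nonneg _) (by positivity) (by positivity) (hα.p0 _) (hα.p1 _) (hβ.p0 _) (hβ.p1 _)
        (hα.a0 _) (hβ.a0 _) (hα.as x hx) (hβ.as y hy) (Real.sqrt_nonneg _) ?_ ?_ (hα.b1 _) (hα.b2 _) (hβ.b1 _) (hβ.b2 _)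
      · refine U.trans ((add_le_add u1 u2).trans (le_of_eq ?_))
        unfold en; ring
      · refine U.trans ((add_le_add v1 v2).trans (le_of_eq ?_))
        unfold en; ring
    · intro z hz
      have e0 := ηz z hz
      have e12 : η.f1 z = 0 ∧ η.f2 z = 0 := by
        rw [η1, η2]
        have hsq : ∀ {C R S : ℝ} {s α α' α'' a : ℝ → ℝ}, Cutoff C R S s α α' α'' a → ∀ x, S ≤ |x| → α' x = 0 := by
          intro C R S s α α' α'' a h x hx
          have := h.b2 x
          rw [h.zero x hx, zero_mul, mul_zero] at this
          exact pow_eq_zero_iff two_ne_zero |>.1 (le_antisymm this (sq_nonneg _))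
        rcases hz with h | h
        · rw [hsq hα _ h, hα.zero _ h]; simp
        · rw [hsq hβ _ h, hβ.zero _ h]; simp
      unfold kd
      rw [e0, e12.1, e12.2]
      simp
  -- θ ≤ δ
  have hθ : C / R * (1 + 2 * (√S * c0)) ≤ δ := by
    have hsS : √S = 16 * √R := by
      rw [hS, Real.sqrt_mul (by norm_num), show (256:ℝ) = 16 ^ 2 by norm_num, Real.sqrt_sq (by norm_num)]
    set σ := √R with hσ
    have σ1 : 1 ≤ σ := Real.one_le_sqrt.2 R1
    have σσ : σ ^ 2 = R := Real.sq_sqrt R0.le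
    have σB : B ≤ σ := Real.le_sqrt_of_sq_le RB
    rw [hsS, div_mul_eq_mul_div, div_le_iff₀ R0, ← σσ]
    have hBδ : B * δ = C * (1 + 32 * c0) := by rw [hB]; field_simp
    have c00 : 0 ≤ c0 := by positivity
    calc C * (1 + 2 * (16 * σ * c0)) ≤ C * (σ + 2 * (16 * σ * c0)) := by gcongr
      _ = (C * (1 + 32 * c0)) * σ := by ring
      _ = (B * δ) * σ := by rw [hBδ]
      _ ≤ (σ * δ) * σ := by gcongr
      _ = _ := by ring
  have KK0 : 0 ≤ KK := integral_nonneg fun z => by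
    have := ψ.gg_nonneg z
    unfold kd; positivity
  have hlast : KK ≤ δ * (32 * KK + D) := by
    refine key.trans ?_
    have h1 : (C / R * (1 + 2 * (√S * c0))) * H ≤ (C / R * (1 + 2 * (√S * c0))) * (32 * KK + D) :=
      mul_le_mul_of_nonneg_left KH (by positivity)
    exact h1.trans (mul_le_mul_of_nonneg_right hθ (by positivity))
  have q1 : δ ≤ 1 / 64 := min_le_left _ _
  have q2 : δ ≤ ε / (2 * D) := min_le_right _ _
  rw [le_div_iff₀ (by positivity)] at q2
  have q3 : δ * (32 * KK) ≤ 1 / 64 * (32 * KK) := mul_le_mul_of_nonneg_right q1 (by positivity)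
  nlinarith

end J2

lemma const_of_diff {F : ℝ × ℝ → ℝ} (hF : Continuous F) {v : ℝ × ℝ} (hv : ‖v‖ ≤ 1)
    (H : ∀ ρ ε : ℝ, 0 < ε → ∃ t0 : ℝ, 0 < t0 ∧ ∀ t, 0 < t → t < t0 →
      ∫ z in Metric.closedBall 0 ρ, (F (z + t • v) - F z) ^ 2 ≤ t ^ 2 * ε)
    {L : ℝ} (hL : 0 < L) (z0 : ℝ × ℝ) : F (z0 + L • v) = F z0 := by
  set S := Metric.ball z0 1 with hS
  set D : ℝ × ℝ → ℝ := fun z => (F (z + L • v) - F z) ^ 2 with hD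
  have cD : Continuous D := by fun_prop
  have intOn : ∀ G : ℝ × ℝ → ℝ, Continuous G → IntegrableOn G S := fun G hG =>
    (hG.continuousOn.integrableOn_compact (isCompact_closedBall z0 1)).mono_set
      Metric.ball_subset_closedBall
  have key : ∀ ε : ℝ, 0 < ε → ∫ z in S, D z ≤ L ^ 2 * ε := by
    intro ε hε
    set ρ := ‖z0‖ + 1 + L with hρ
    obtain ⟨t0, ht0, ht⟩ := H ρ ε hε
    obtain ⟨n, hn⟩ := exists_nat_gt (L / t0)
    have hn0 : (0:ℝ) < n := lt_trans (by positivity) hn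
    set t := L / n with htd
    have htp : 0 < t := by positivity
    have htn : n * t = L := by rw [htd]; field_simp
    have htt : t < t0 := by
      rw [htd, div_lt_iff₀ hn0]; rw [div_lt_iff₀ ht0] at hn; linarith
    have hB := ht t htp htt
    set G : ℝ × ℝ → ℝ := fun z => (F (z + t • v) - F z) ^ 2 with hG
    have cG : Continuous G := by fun_prop
    have pt : ∀ z, D z ≤ n * ∑ i ∈ Finset.range n, G (z + (i * t) • v) := by
      intro z
      have e : F (z + L • v) - F z = ∑ i ∈ Finset.range n,
          (F (z + ((i + 1 : ℕ) * t : ℝ) • v) - F (z + ((i : ℕ) * t : ℝ) • v)) := by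
        rw [Finset.sum_range_sub (fun i : ℕ => F (z + (i * t : ℝ) • v))]
        simp [htn]
      have := sq_sum_le_card_mul_sum_sq (s := Finset.range n)
        (f := fun i : ℕ => (F (z + ((i + 1 : ℕ) * t : ℝ) • v) - F (z + ((i : ℕ) * t : ℝ) • v)))
      rw [← e, Finset.card_range] at this
      refine this.trans (le_of_eq ?_)
      congr 1
      refine Finset.sum_congr rfl fun i _ => ?_
      simp only [hG]
      have e3 : z + ((i + 1 : ℕ) * t : ℝ) • v = z + (i * t : ℝ) • v + t • v := by
        push_cast; module
      rw [e3]
    have sh : ∀ i ∈ Finset.range n, ∫ z in S, G (z + (i * t : ℝ) • v) ≤ t ^ 2 * ε := by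
      intro i hi
      have hi' : (i : ℝ) ≤ n := by exact_mod_cast (Finset.mem_range.1 hi).le
      refine le_trans ?_ hB
      rw [← integral_indicator (measurableSet_ball), ← integral_indicator (f := G) (measurableSet_closedBall)]
      rw [← integral_add_right_eq_self (μ := volume) (Set.indicator (Metric.closedBall 0 ρ) G)
        ((i * t : ℝ) • v)]
      apply integral_mono
      · exact (intOn _ (by fun_prop)).integrable_indicator measurableSet_ball
      · exact (((cG.continuousOn).integrableOn_compact
          (isCompact_closedBall 0 ρ)).integrable_indicator measurableSet_closedBall).comp_add_right _
      · intro z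
        by_cases hz : z ∈ S
        · have : z + (i * t : ℝ) • v ∈ Metric.closedBall (0 : ℝ × ℝ) ρ := by
            rw [mem_closedBall_zero_iff]
            have h1 : ‖z‖ ≤ ‖z0‖ + 1 := by
              have : ‖z - z0‖ < 1 := by simpa [hS, dist_eq_norm] using hz
              calc ‖z‖ = ‖z0 + (z - z0)‖ := by congr 1; abel
                _ ≤ _ := (norm_add_le _ _).trans (by linarith)
            have h2 : ‖(i * t : ℝ) • v‖ ≤ L := by
              rw [norm_smul, Real.norm_of_nonneg (by positivity), ← htn]
              calc i * t * ‖v‖ ≤ i * t * 1 := by gcongr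
                _ ≤ n * t := by rw [mul_one]; gcongr
            exact (norm_add_le _ _).trans (by linarith)
          rw [Set.indicator_of_mem hz]
          exact le_of_eq (Set.indicator_of_mem this G).symm
        · rw [Set.indicator_of_notMem hz]
          exact Set.indicator_nonneg (fun _ _ => sq_nonneg _) _
    calc ∫ z in S, D z ≤ ∫ z in S, n * ∑ i ∈ Finset.range n, G (z + (i * t : ℝ) • v) :=
          integral_mono (intOn _ cD) (intOn _ (by fun_prop)) pt
      _ = n * ∑ i ∈ Finset.range n, ∫ z in S, G (z + (i * t : ℝ) • v) := by
          rw [integral_const_mul, integral_finsetSum]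
          intro i _; exact intOn _ (by fun_prop)
      _ ≤ n * ∑ i ∈ Finset.range n, t ^ 2 * ε := by gcongr with i hi; exact sh i hi
      _ = L ^ 2 * ε := by rw [Finset.sum_const, Finset.card_range, ← htn]; simp; ring
  have I0 : ∫ z in S, D z = 0 := by
    refine le_antisymm ?_ (setIntegral_nonneg measurableSet_ball fun z _ => sq_nonneg _)
    refine le_of_forall_pos_le_add fun e he => ?_
    have := key (e / L ^ 2) (by positivity)
    rw [mul_div_cancel₀ _ (by positivity)] at this
    linarith
  have ae : D =ᵐ[volume.restrict S] fun _ => 0 :=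
    (integral_eq_zero_iff_of_nonneg (fun z => sq_nonneg _) (intOn _ cD)).1 I0
  have := Measure.eqOn_open_of_ae_eq ae Metric.isOpen_ball cD.continuousOn continuousOn_const
    (Metric.mem_ball_self one_pos : z0 ∈ S)
  simp only [hD] at this
  have := pow_eq_zero_iff two_ne_zero |>.1 this
  linarith

namespace J2

lemma diff_small (ψ : J2) (hψ : ψ.Weak) (hi : Integrable ψ.en) (ρ ε : ℝ) (hε : 0 < ε) :
    ∃ t0 : ℝ, 0 < t0 ∧ ∀ t, 0 < t → t < t0 → ∀ v : ℝ × ℝ, (v = (1,0) ∨ v = (0,1)) →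
      ∫ z in Metric.closedBall 0 ρ, ((ψ.p (z + t • v) - ψ.p z) ^ 2 + (ψ.q (z + t • v) - ψ.q z) ^ 2)
        ≤ t ^ 2 * ε := by
  obtain ⟨R, hR⟩ := (isCompact_closedBall (0 : ℝ × ℝ) (ρ + 1)).exists_bound_of_continuousOn
    ψ.cr.continuousOn
  set M := 1 + |R| + |R| with hM
  have M0 : 0 < M := by positivity
  obtain ⟨η, sη, h1, hk⟩ := ψ.good_cut hψ hi (ρ + 1) (ε := ε / M / 32) (by positivity)
  obtain ⟨t0, ht0, ht1, ht⟩ := ψ.cacc η hψ sη (e := ε / M / 2) (by positivity)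
  refine ⟨t0, ht0, fun t htp htt v hv => ?_⟩
  have hc := ht t htp htt
  have n1 : 0 ≤ ∫ z, η.f (z + t • (1, 0)) ^ 2 * ψ.mm (t • (1, 0)) z :=
    integral_nonneg fun z => mul_nonneg (sq_nonneg _) (ψ.mm_nonneg _ _)
  have n2 : 0 ≤ ∫ z, η.f (z + t • (0, 1)) ^ 2 * ψ.mm (t • (0, 1)) z :=
    integral_nonneg fun z => mul_nonneg (sq_nonneg _) (ψ.mm_nonneg _ _)
  have hb : ∫ z, η.f (z + t • v) ^ 2 * ψ.mm (t • v) z ≤ t ^ 2 * (ε / M) := by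
    have : t ^ 2 * (16 * (∫ z, ψ.kd η z) + ε / M / 2) ≤ t ^ 2 * (ε / M) := by
      gcongr; linarith
    rcases hv with rfl | rfl <;> linarith
  have nv : ‖v‖ ≤ 1 := by rcases hv with rfl | rfl <;> simp [Prod.norm_def]
  calc _ ≤ ∫ z, M * (η.f (z + t • v) ^ 2 * ψ.mm (t • v) z) := by
        rw [← integral_indicator measurableSet_closedBall]
        apply integral_mono
        · exact ((by fun_prop : Continuous _).continuousOn.integrableOn_compact
            (isCompact_closedBall 0 ρ)).integrable_indicator measurableSet_closedBall
        · exact (ψ.emm_int η sη _).const_mul M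
        · intro z
          by_cases hz : z ∈ Metric.closedBall (0 : ℝ × ℝ) ρ
          · rw [Set.indicator_of_mem hz]
            rw [mem_closedBall_zero_iff] at hz
            have hz2 : ‖z + t • v‖ ≤ ρ + 1 := by
              refine (norm_add_le _ _).trans (add_le_add hz ?_)
              rw [norm_smul, Real.norm_of_nonneg htp.le]
              calc t * ‖v‖ ≤ 1 * 1 := by gcongr; linarith
                _ = 1 := one_mul 1
            have b1 := hR z (mem_closedBall_zero_iff.2 (by linarith))
            have b2 := hR (z + t • v) (mem_closedBall_zero_iff.2 hz2)
            rw [Real.norm_of_nonneg (ψ.r_nonneg _)] at b1 b2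
            have := ψ.mm_lower (t • v) z
            have r1 := ψ.r_nonneg z
            have r2 := ψ.r_nonneg (z + t • v)
            rw [div_le_iff₀ (by linarith)] at this
            simp only [h1 _ hz2, one_pow, one_mul]
            refine this.trans ?_
            rw [mul_comm]
            refine mul_le_mul_of_nonneg_right ?_ (ψ.mm_nonneg _ _)
            have := le_abs_self R
            linarith
          · rw [Set.indicator_of_notMem hz]
            exact mul_nonneg M0.le (mul_nonneg (sq_nonneg _) (ψ.mm_nonneg _ _))
    _ = M * ∫ z, (η.f (z + t • v) ^ 2 * ψ.mm (t • v) z) := integral_const_mul _ _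
    _ ≤ M * (t ^ 2 * (ε / M)) := by gcongr
    _ = _ := by field_simp

lemma const_all {F : ℝ × ℝ → ℝ} (h : ∀ v : ℝ × ℝ, (v = (1,0) ∨ v = (0,1)) → ∀ L : ℝ, 0 < L →
    ∀ z, F (z + L • v) = F z) (z : ℝ × ℝ) : F z = F 0 := by
  have h' : ∀ v : ℝ × ℝ, (v = (1,0) ∨ v = (0,1)) → ∀ L : ℝ, ∀ z, F (z + L • v) = F z := by
    intro v hv L z
    rcases lt_trichotomy L 0 with hL | rfl | hL
    · have := h v hv (-L) (by linarith) (z + L • v)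
      rw [← this]; congr 1; module
    · simp
    · exact h v hv L hL z
  have e1 := h' (1,0) (Or.inl rfl) z.1 0
  have e2 := h' (0,1) (Or.inr rfl) z.2 (0 + z.1 • (1,0))
  rw [← e1, ← e2]; congr 1; ext <;> simp

lemma pq_const (ψ : J2) (hψ : ψ.Weak) (hi : Integrable ψ.en) :
    (∀ z, ψ.p z = ψ.p 0) ∧ ∀ z, ψ.q z = ψ.q 0 := by
  have nv : ∀ v : ℝ × ℝ, (v = (1,0) ∨ v = (0,1)) → ‖v‖ ≤ 1 := by
    intro v hv
    rcases hv with rfl | rfl <;> simp [Prod.norm_def]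
  constructor
  · refine const_all fun v hv L hL z => const_of_diff ψ.cp (nv v hv) ?_ hL z
    intro ρ ε hε
    obtain ⟨t0, ht0, ht⟩ := ψ.diff_small hψ hi ρ ε hε
    refine ⟨t0, ht0, fun t a b => le_trans ?_ (ht t a b v hv)⟩
    apply integral_mono
    · exact (by fun_prop : Continuous _).continuousOn.integrableOn_compact (isCompact_closedBall 0 ρ)
    · exact (by fun_prop : Continuous _).continuousOn.integrableOn_compact (isCompact_closedBall 0 ρ)
    · intro z; simp only; nlinarith [sq_nonneg (ψ.q (z + t • v) - ψ.q z)]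
  · refine const_all fun v hv L hL z => const_of_diff ψ.cq (nv v hv) ?_ hL z
    intro ρ ε hε
    obtain ⟨t0, ht0, ht⟩ := ψ.diff_small hψ hi ρ ε hε
    refine ⟨t0, ht0, fun t a b => le_trans ?_ (ht t a b v hv)⟩
    apply integral_mono
    · exact (by fun_prop : Continuous _).continuousOn.integrableOn_compact (isCompact_closedBall 0 ρ)
    · exact (by fun_prop : Continuous _).continuousOn.integrableOn_compact (isCompact_closedBall 0 ρ)
    · intro z; simp only; nlinarith [sq_nonneg (ψ.p (z + t • v) - ψ.p z)]

lemma const_zero_of_en (ψ : J2) (hi : Integrable ψ.en) {c : ℝ} (hc : 0 ≤ c)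
    (h : ∀ z, c ≤ ψ.g z) : c = 0 := by
  have hle : ∀ z, c ^ 2 / (1 + c) ≤ ψ.en z := by
    intro z
    have := h z
    unfold en
    rw [div_le_div_iff₀ (by linarith) (by linarith)]
    nlinarith [mul_nonneg hc (sub_nonneg.2 this), mul_nonneg (mul_nonneg hc (hc.trans this)) (sub_nonneg.2 this)]
  have hint : Integrable (fun _ : ℝ × ℝ => c ^ 2 / (1 + c)) := by
    refine hi.mono' aestronglyMeasurable_const (Filter.Eventually.of_forall fun z => ?_)
    rw [Real.norm_of_nonneg (by positivity)]; exact hle z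
  rw [integrable_const_iff] at hint
  rcases hint with h0 | h0
  · have h1 : (1 + c) ≠ 0 := by linarith
    have : c ^ 2 = 0 := by
      rcases div_eq_zero_iff.1 h0 with h | h
      · exact h
      · exact absurd h h1
    exact pow_eq_zero_iff two_ne_zero |>.1 this
  · exfalso
    have := h0.measure_univ_lt_top
    rw [show (volume : Measure (ℝ × ℝ)) = (volume : Measure ℝ).prod volume from rfl,
      ← Set.univ_prod_univ, Measure.prod_prod] at this
    simp at this

theorem main2 (ψ : J2) (hψ : ψ.Weak) (hi : Integrable ψ.en) (z : ℝ × ℝ) :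
    ψ.f11 z = 0 ∧ ψ.f12 z = 0 ∧ ψ.f22 z = 0 := by
  obtain ⟨hp, hq⟩ := ψ.pq_const hψ hi
  have hr : ∀ z, ψ.r z = ψ.r 0 := fun z => by unfold r; rw [hp, hq]
  have r0 : ψ.r 0 = 0 := ψ.const_zero_of_en hi (ψ.r_nonneg 0) fun z => by
    rw [← hr z]; exact ψ.r_le_g z
  have rz : ∀ z, 2 * ψ.p z ^ 2 + 2 * ψ.q z ^ 2 = 0 := fun z => by
    rw [← rr_sq]; have := (hr z).trans r0; unfold r at this; rw [this]; simp
  have h12 : ∀ z, ψ.f12 z = 0 := fun z => by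
    have := rz z
    have : ψ.p z ^ 2 = 0 := by nlinarith [sq_nonneg (ψ.p z), sq_nonneg (ψ.q z)]
    have := pow_eq_zero_iff two_ne_zero |>.1 this
    unfold p at this; linarith
  have hq0 : ∀ z, ψ.f11 z = ψ.f22 z := fun z => by
    have := rz z
    have : ψ.q z ^ 2 = 0 := by nlinarith [sq_nonneg (ψ.p z), sq_nonneg (ψ.q z)]
    have := pow_eq_zero_iff two_ne_zero |>.1 this
    unfold q at this; linarith
  -- f1 independent of y
  have e1 : ∀ x y, ψ.f1 (x, y) = ψ.f1 (x, 0) := fun x y => by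
    refine is_const_of_deriv_eq_zero (f := fun s => ψ.f1 (x, s))
      (fun s => (ψ.d1.dy x s).differentiableAt) (fun s => ?_) y 0
    rw [(ψ.d1.dy x s).deriv, h12]
  have e2 : ∀ x y, ψ.f2 (x, y) = ψ.f2 (0, y) := fun x y => by
    refine is_const_of_deriv_eq_zero (f := fun s => ψ.f2 (s, y))
      (fun s => (ψ.d2.dx s y).differentiableAt) (fun s => ?_) x 0
    rw [(ψ.d2.dx s y).deriv, h12]
  have e11 : ∀ x y, ψ.f11 (x, y) = ψ.f11 (x, 0) := fun x y => by
    have h1 := ψ.d1.dx x y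
    have h2 := ψ.d1.dx x 0
    have : (fun s => ψ.f1 (s, y)) = fun s => ψ.f1 (s, 0) := funext fun s => e1 s y
    rw [this] at h1
    exact h1.unique h2
  have e22 : ∀ x y, ψ.f22 (x, y) = ψ.f22 (0, y) := fun x y => by
    have h1 := ψ.d2.dy x y
    have h2 := ψ.d2.dy 0 y
    have : (fun s => ψ.f2 (x, s)) = fun s => ψ.f2 (0, s) := funext fun s => e2 x s
    rw [this] at h1
    exact h1.unique h2
  have e : ∀ z, ψ.f11 z = ψ.f11 0 := by
    rintro ⟨x, y⟩
    rw [e11, hq0, e22, ← hq0]; rfl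
  have g0 : ψ.g 0 = 0 := ψ.const_zero_of_en hi (ψ.g_nonneg 0) fun z => by
    apply le_of_eq
    unfold g; rw [← hq0, ← hq0, h12, h12, e z]
  have := ψ.g_sq 0
  rw [g0] at this; unfold gg at this
  have : ψ.f11 0 ^ 2 = 0 := by
    nlinarith [sq_nonneg (ψ.f11 0), sq_nonneg (ψ.f12 0), sq_nonneg (ψ.f22 0)]
  have := pow_eq_zero_iff two_ne_zero |>.1 this
  refine ⟨by rw [e, this], h12 z, by rw [← hq0, e, this]⟩
end J2

/-- mollification -/
def mo (b : ContDiffBump (0 : ℝ × ℝ)) (g : ℝ × ℝ → ℝ) : ℝ × ℝ → ℝ :=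
  convolution (b.normed volume) g (ContinuousLinearMap.lsmul ℝ ℝ) volume

lemma mo_smooth (b : ContDiffBump (0 : ℝ × ℝ)) {g : ℝ × ℝ → ℝ} (hg : Continuous g) :
    ContDiff ℝ (⊤ : ℕ∞) (mo b g) :=
  b.hasCompactSupport_normed.contDiff_convolution_left _ b.contDiff_normed
    hg.locallyIntegrable

lemma mo_close (b : ContDiffBump (0 : ℝ × ℝ)) {g : ℝ × ℝ → ℝ} (hg : Continuous g) {z : ℝ × ℝ}
    {ε : ℝ} (h : ∀ x, dist x z < b.rOut → |g x - g z| ≤ ε) : |mo b g z - g z| ≤ ε :=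
  b.dist_normed_convolution_le hg.aestronglyMeasurable (fun x hx => h x hx)

lemma mo_far (b : ContDiffBump (0 : ℝ × ℝ)) (hb : b.rOut ≤ 1) {g : ℝ × ℝ → ℝ} (hg : Continuous g)
    {ρ : ℝ} (h : ∀ z, ρ < ‖z‖ → g z = 0) (z : ℝ × ℝ) (hz : ρ + 1 < ‖z‖) : mo b g z = 0 := by
  have h0 := h z (by linarith)
  have : |mo b g z - g z| ≤ 0 := by
    refine mo_close b hg fun x hx => ?_
    have : ρ < ‖x‖ := by
      rw [dist_eq_norm] at hx
      have : ‖z‖ ≤ ‖x‖ + ‖x - z‖ := by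
        calc ‖z‖ = ‖x - (x - z)‖ := by congr 1; abel
          _ ≤ _ := norm_sub_le _ _
      linarith
    rw [h x this, h0]; simp
  rw [h0, sub_zero] at this
  exact abs_nonpos_iff.1 this

lemma mo_PD (b : ContDiffBump (0 : ℝ × ℝ)) {f f1 f2 : ℝ × ℝ → ℝ} (h : PD f f1 f2)
    (s : HasCompactSupport f) (c1 : Continuous f1) (c2 : Continuous f2) :
    PD (mo b f) (mo b f1) (mo b f2) := by
  intro z
  have cb : LocallyIntegrable (b.normed (volume : Measure (ℝ × ℝ))) :=
    b.continuous_normed.locallyIntegrable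
  have hc := h.contDiff_one c1 c2
  have := s.hasFDerivAt_convolution_right (ContinuousLinearMap.lsmul ℝ ℝ) cb hc z
  refine this.congr_fderiv ?_
  have e := fun v => convolution_precompR_apply (ContinuousLinearMap.lsmul ℝ ℝ) cb
    (s.fderiv ℝ) (hc.continuous_fderiv (by norm_num)) z v
  have e1 : (fun a => fderiv ℝ f a (1, 0)) = f1 := funext fun a => by
    rw [(h a).fderiv]; simp
  have e2 : (fun a => fderiv ℝ f a (0, 1)) = f2 := funext fun a => by
    rw [(h a).fderiv]; simp
  ext
  · have := e (1, 0)
    rw [e1] at this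
    simpa [mo] using this
  · have := e (0, 1)
    rw [e2] at this
    simpa [mo] using this

namespace J2
def moll (b : ContDiffBump (0 : ℝ × ℝ)) (F : J2) (s : HasCompactSupport F.f) : J2 where
  f := mo b F.f
  f1 := mo b F.f1
  f2 := mo b F.f2
  f11 := mo b F.f11
  f12 := mo b F.f12
  f22 := mo b F.f22
  d0 := mo_PD b F.d0 s F.c1 F.c2
  d1 := mo_PD b F.d1 (F.cs s).s1 F.c11 F.c12
  d2 := mo_PD b F.d2 (F.cs s).s2 F.c12 F.c22
  c11 := (mo_smooth b F.c11).continuous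
  c12 := (mo_smooth b F.c12).continuous
  c22 := (mo_smooth b F.c22).continuous

lemma weak_of_smooth (ψ : J2) (h : ∀ F : J2, ContDiff ℝ (⊤ : ℕ∞) F.f → HasCompactSupport F.f →
    ∫ z, ψ.wf F z = 0) : ψ.Weak := by
  intro F s
  obtain ⟨ρ, hρ, hf⟩ := F.far s
  have cs := F.cs s
  have u : ∀ g : ℝ × ℝ → ℝ, Continuous g → HasCompactSupport g → UniformContinuous g :=
    fun g hg sg => sg.uniformContinuous_of_continuous hg
  set W : ℝ × ℝ → ℝ := (Metric.closedBall 0 (ρ + 1)).indicator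
    (fun z => 2 * |ψ.Q z| + 2 * |ψ.P z| + |ψ.b1 z| + |ψ.b2 z|) with hW
  have iW : Integrable W := ((by fun_prop : Continuous _).continuousOn.integrableOn_compact
            (isCompact_closedBall 0 (ρ + 1))).integrable_indicator measurableSet_closedBall
  have key : ∀ ε : ℝ, 0 < ε → |∫ z, ψ.wf F z| ≤ ε * ∫ z, W z := by
    intro ε hε
    have uu : ∀ g : ℝ × ℝ → ℝ, Continuous g → HasCompactSupport g → ∃ δ > 0, ∀ x z,
        dist x z < δ → |g x - g z| ≤ ε := by
      intro g hg sg
      obtain ⟨δ, δ0, hδ⟩ := Metric.uniformContinuous_iff.1 (u g hg sg) ε hε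
      exact ⟨δ, δ0, fun x z hx => (hδ hx).le⟩
    obtain ⟨a1, p1, q1⟩ := uu _ F.c1 cs.s1
    obtain ⟨a2, p2, q2⟩ := uu _ F.c2 cs.s2
    obtain ⟨a3, p3, q3⟩ := uu _ F.c11 cs.s11
    obtain ⟨a4, p4, q4⟩ := uu _ F.c12 cs.s12
    obtain ⟨a5, p5, q5⟩ := uu _ F.c22 cs.s22
    obtain ⟨δ, δ0, d1, d2, d3, d4, d5, d6⟩ : ∃ δ > 0, δ ≤ 1 ∧ δ ≤ a1 ∧ δ ≤ a2 ∧ δ ≤ a3 ∧ δ ≤ a4 ∧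
        δ ≤ a5 := by
      refine ⟨min 1 (min a1 (min a2 (min a3 (min a4 a5)))), by positivity, ?_⟩
      simp
    let b : ContDiffBump (0 : ℝ × ℝ) := ⟨δ / 2, δ, by positivity, by linarith⟩
    have hb : b.rOut = δ := rfl
    set G := F.moll b s with hG
    have f0 := mo_far b d1 F.c0 hf.v0
    have f1 := mo_far b d1 F.c1 hf.v1
    have f2 := mo_far b d1 F.c2 hf.v2
    have f3 := mo_far b d1 F.c11 hf.v11
    have f4 := mo_far b d1 F.c12 hf.v12
    have f5 := mo_far b d1 F.c22 hf.v22
    have sG : HasCompactSupport G.f := cs_of_far (ρ + 1) f0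
    have hz := h G (mo_smooth b F.c0) sG
    have cwf : ∀ F : J2, Continuous (ψ.wf F) := fun F => by unfold wf; fun_prop
    have iF : Integrable (ψ.wf F) := by
      refine (cwf F).integrable_of_hasCompactSupport (cs_of_far ρ fun z hz => ?_)
      simp [wf, hf.v1 z hz, hf.v2 z hz, hf.v11 z hz, hf.v12 z hz, hf.v22 z hz]
    have iG : Integrable (ψ.wf G) := by
      refine (cwf G).integrable_of_hasCompactSupport (cs_of_far (ρ + 1) fun z hz => ?_)
      simp [wf, hG, moll, f1 z hz, f2 z hz, f3 z hz, f4 z hz, f5 z hz]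
    have e : ∫ z, ψ.wf F z = ∫ z, (ψ.wf F z - ψ.wf G z) := by
      rw [integral_sub iF iG, hz, sub_zero]
    rw [e, ← integral_const_mul, ← Real.norm_eq_abs]
    refine norm_integral_le_of_norm_le (iW.const_mul ε) (Filter.Eventually.of_forall fun z => ?_)
    rw [Real.norm_eq_abs]
    by_cases hz : z ∈ Metric.closedBall (0 : ℝ × ℝ) (ρ + 1)
    · rw [hW, Set.indicator_of_mem hz]
      have m1 : |G.f1 z - F.f1 z| ≤ ε := mo_close b F.c1 fun x hx => q1 x z (by linarith)
      have m2 : |G.f2 z - F.f2 z| ≤ ε := mo_close b F.c2 fun x hx => q2 x z (by linarith)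
      have m3 : |G.f11 z - F.f11 z| ≤ ε := mo_close b F.c11 fun x hx => q3 x z (by linarith)
      have m4 : |G.f12 z - F.f12 z| ≤ ε := mo_close b F.c12 fun x hx => q4 x z (by linarith)
      have m5 : |G.f22 z - F.f22 z| ≤ ε := mo_close b F.c22 fun x hx => q5 x z (by linarith)
      have ee : ψ.wf F z - ψ.wf G z = -(ψ.Q z * (G.f11 z - F.f11 z)) + (ψ.Q z * (G.f22 z - F.f22 z))
        + 2 * (ψ.P z * (G.f12 z - F.f12 z)) - (ψ.b1 z * (G.f1 z - F.f1 z))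
        - (ψ.b2 z * (G.f2 z - F.f2 z)) := by unfold wf; ring
      have t : ∀ a b : ℝ, |b| ≤ ε → |a * b| ≤ ε * |a| := fun a b h => by
        rw [abs_mul, mul_comm]; gcongr
      have t1 := abs_le.1 (t (ψ.b1 z) _ m1)
      have t2 := abs_le.1 (t (ψ.b2 z) _ m2)
      have t3 := abs_le.1 (t (ψ.Q z) _ m3)
      have t4 := abs_le.1 (t (ψ.P z) _ m4)
      have t5 := abs_le.1 (t (ψ.Q z) _ m5)
      rw [ee, abs_le]
      constructor <;> linarith
    · rw [hW, Set.indicator_of_notMem hz]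
      rw [mem_closedBall_zero_iff, not_le] at hz
      have hz' : ρ < ‖z‖ := by linarith
      simp [wf, hG, moll, f1 z hz, f2 z hz, f3 z hz, f4 z hz, f5 z hz,
        hf.v1 z hz', hf.v2 z hz', hf.v11 z hz', hf.v12 z hz', hf.v22 z hz']
  have W0 : 0 ≤ ∫ z, W z := integral_nonneg fun z => Set.indicator_nonneg (fun _ _ => by positivity) _
  have : |∫ z, ψ.wf F z| ≤ 0 := by
    refine le_of_forall_pos_le_add fun e he => ?_
    refine (key (e / (1 + ∫ z, W z)) (by positivity)).trans ?_
    rw [zero_add, div_mul_eq_mul_div, div_le_iff₀ (by positivity)]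
    nlinarith
  exact abs_nonpos_iff.1 this
end J2

/-- the identification of ℝ×ℝ with the Euclidean plane -/
def TT : (ℝ × ℝ) ≃L[ℝ] EuclideanSpace ℝ (Fin 2) :=
  (ContinuousLinearEquiv.finTwoArrow ℝ ℝ).symm.trans (EuclideanSpace.equiv (Fin 2) ℝ).symm

lemma TT_0 (z : ℝ × ℝ) : TT z 0 = z.1 := by simp [TT]
lemma TT_1 (z : ℝ × ℝ) : TT z 1 = z.2 := by simp [TT]
lemma TT_e0 : TT (1, 0) = EuclideanSpace.single 0 1 := by
  ext i; fin_cases i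
  · exact (TT_0 _).trans (by simp)
  · exact (TT_1 _).trans (by simp)
lemma TT_e1 : TT (0, 1) = EuclideanSpace.single 1 1 := by
  ext i; fin_cases i
  · exact (TT_0 _).trans (by simp)
  · exact (TT_1 _).trans (by simp)

lemma TT_mp : MeasurePreserving TT volume volume := by
  have h1 := (volume_preserving_finTwoArrow ℝ).symm
  have h2 := PiLp.volume_preserving_toLp (Fin 2)
  have := h2.comp h1
  exact this

lemma TT_emb : MeasurableEmbedding TT := TT.toHomeomorph.measurableEmbedding

lemma TT_int (f : EuclideanSpace ℝ (Fin 2) → ℝ) : ∫ z, f (TT z) = ∫ x, f x :=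
  TT_mp.integral_comp TT_emb f

/-- PD of components -/
lemma comp_PD {u : EuclideanSpace ℝ (Fin 2) → EuclideanSpace ℝ (Fin 2)}
    (hu : Differentiable ℝ u) (i : Fin 2) :
    PD (fun z => u (TT z) i) (fun z => pd u 0 (TT z) i) (fun z => pd u 1 (TT z) i) := by
  intro z
  have h1 := (hu (TT z)).hasFDerivAt.comp z (TT.hasFDerivAt)
  have h2 := ((EuclideanSpace.proj i : EuclideanSpace ℝ (Fin 2) →L[ℝ] ℝ).hasFDerivAt
    (x := u (TT z))).comp z h1
  refine HasFDerivAt.congr_fderiv (f' := _) h2 ?_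
  ext
  · simp [pd, TT_e0]
  · simp [pd, TT_e1]

lemma pd_cont {u : EuclideanSpace ℝ (Fin 2) → EuclideanSpace ℝ (Fin 2)}
    (hu : ContDiff ℝ 1 u) (k i : Fin 2) : Continuous (fun z => pd u k (TT z) i) := by
  have := hu.continuous_fderiv (by norm_num)
  unfold pd
  have h2 : Continuous (fun z => fderiv ℝ u (TT z) (EuclideanSpace.single k 1)) :=
    (this.comp TT.continuous).clm_apply continuous_const
  exact (EuclideanSpace.proj i : EuclideanSpace ℝ (Fin 2) →L[ℝ] ℝ).continuous.comp h2

/-- the stream function -/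
lemma exists_stream {u : EuclideanSpace ℝ (Fin 2) → EuclideanSpace ℝ (Fin 2)}
    (hu : ContDiff ℝ 1 u) (hdiv : ∀ x, divg u x = 0) :
    ∃ ψ : J2, (∀ z, ψ.f1 z = u (TT z) 1) ∧ (∀ z, ψ.f2 z = - u (TT z) 0) ∧
      (∀ z, ψ.f11 z = pd u 0 (TT z) 1) ∧ (∀ z, ψ.f12 z = pd u 1 (TT z) 1) ∧
      (∀ z, ψ.f12 z = - pd u 0 (TT z) 0) ∧ (∀ z, ψ.f22 z = - pd u 1 (TT z) 0) := by
  have hd : Differentiable ℝ u := hu.differentiable (by norm_num)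
  have hdv : ∀ z, pd u 1 (TT z) 1 = - pd u 0 (TT z) 0 := fun z => by
    have := hdiv (TT z)
    simp only [divg, Fin.sum_univ_two] at this
    linarith
  have d1 := comp_PD hd 1
  have d2 : PD (fun z => - u (TT z) 0) (fun z => pd u 1 (TT z) 1) (fun z => - pd u 1 (TT z) 0) :=
    ((comp_PD hd 0).cmul (-1)).congr (fun z => by ring) (fun z => by rw [hdv]; ring)
      (fun z => by ring)
  set ω : ℝ × ℝ → (ℝ × ℝ) →L[ℝ] ℝ := fun z => u (TT z) 1 • ContinuousLinearMap.fst ℝ ℝ ℝ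
    + (- u (TT z) 0) • ContinuousLinearMap.snd ℝ ℝ ℝ with hω
  have hωd : ∀ z, HasFDerivAt ω _ z := fun z =>
    ((d1 z).smul_const (ContinuousLinearMap.fst ℝ ℝ ℝ)).add
      ((d2 z).smul_const (ContinuousLinearMap.snd ℝ ℝ ℝ))
  obtain ⟨f, hf⟩ := convex_univ.exists_forall_hasFDerivAt_of_fderiv_symmetric (ω := ω)
    isOpen_univ (fun z _ => (hωd z).differentiableAt.differentiableWithinAt) (by
      intro z _ x y
      rw [(hωd z).fderiv]
      simp; ring)
  exact ⟨⟨f, _, _, _, _, _, fun z => hf z trivial, d1, d2, pd_cont hu 0 1, pd_cont hu 1 1,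
    (pd_cont hu 1 0).neg⟩, fun z => rfl, fun z => rfl, fun z => rfl, fun z => rfl,
    fun z => hdv z, fun z => rfl⟩

lemma deriv_h {r : ℝ} (hr : 0 ≤ r) : deriv (fun t : ℝ => t * Real.log (1 + t)) r = hp r := by
  have h1 : HasDerivAt (fun t : ℝ => Real.log (1 + t)) (1 / (1 + r)) r :=
    ((hasDerivAt_id r).const_add 1).log (by simp; linarith)
  have := (hasDerivAt_id r).mul h1
  have e := HasDerivAt.deriv (f := fun t : ℝ => t * Real.log (1 + t)) this
  rw [e]; simp [hp]; ring

lemma DH_eq (A : Matrix (Fin 2) (Fin 2) ℝ) :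
    DH (fun t : ℝ => t * Real.log (1 + t)) A = kap (fnorm A) • A := by
  have h0 : 0 ≤ fnorm A := Real.sqrt_nonneg _
  unfold DH kap
  split_ifs with h
  · have h1 : frob A A = 0 := by
      unfold fnorm at h
      refine (Real.sqrt_eq_zero ?_).1 h
      exact Finset.sum_nonneg fun i _ => Finset.sum_nonneg fun j _ => mul_self_nonneg _
    simp only [frob, Fin.sum_univ_two] at h1
    have a := mul_self_nonneg (A 0 0)
    have b := mul_self_nonneg (A 0 1)
    have c := mul_self_nonneg (A 1 0)
    have d := mul_self_nonneg (A 1 1)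
    have : A = 0 := by
      ext i j
      fin_cases i <;> fin_cases j <;> simp <;> apply mul_self_eq_zero.1 <;> linarith
    rw [this]; simp
  · rw [deriv_h h0]

lemma stream_weak {u : EuclideanSpace ℝ (Fin 2) → EuclideanSpace ℝ (Fin 2)}
    (hweak : IsWeakSolution (fun t : ℝ => t * Real.log (1 + t)) u) (ψ : J2)
    (h1 : ∀ z, ψ.f1 z = u (TT z) 1) (h2 : ∀ z, ψ.f2 z = - u (TT z) 0)
    (h11 : ∀ z, ψ.f11 z = pd u 0 (TT z) 1) (h12 : ∀ z, ψ.f12 z = pd u 1 (TT z) 1)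
    (h12' : ∀ z, ψ.f12 z = - pd u 0 (TT z) 0) (h22 : ∀ z, ψ.f22 z = - pd u 1 (TT z) 0) :
    ψ.Weak := by
  refine ψ.weak_of_smooth fun F sF cF => ?_
  have cs := F.cs cF
  have e1 : F.f1 = fun z => fderiv ℝ F.f z (1, 0) := funext fun z => by rw [(F.d0 z).fderiv]; simp
  have e2 : F.f2 = fun z => fderiv ℝ F.f z (0, 1) := funext fun z => by rw [(F.d0 z).fderiv]; simp
  have sd : ContDiff ℝ (⊤ : ℕ∞) (fderiv ℝ F.f) := sF.fderiv_right (by simp)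
  have s1 : ContDiff ℝ (⊤ : ℕ∞) F.f1 := by rw [e1]; exact sd.clm_apply contDiff_const
  have s2 : ContDiff ℝ (⊤ : ℕ∞) F.f2 := by rw [e2]; exact sd.clm_apply contDiff_const
  set φ : EuclideanSpace ℝ (Fin 2) → EuclideanSpace ℝ (Fin 2) :=
    fun x => TT (- F.f2 (TT.symm x), F.f1 (TT.symm x)) with hφ
  have φ0 : ∀ z, φ (TT z) 0 = - F.f2 z := fun z => by simp [hφ, TT_0]
  have φ1 : ∀ z, φ (TT z) 1 = F.f1 z := fun z => by simp [hφ, TT_1]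
  have sφ : ContDiff ℝ (⊤ : ℕ∞) φ :=
    TT.contDiff.comp (((s2.comp TT.symm.contDiff).neg).prodMk (s1.comp TT.symm.contDiff))
  have cφ : HasCompactSupport φ := by
    obtain ⟨ρ, hρ, hf⟩ := F.far cF
    refine HasCompactSupport.intro ((isCompact_closedBall (0 : ℝ × ℝ) ρ).image TT.continuous)
      fun x hx => ?_
    have : ρ < ‖TT.symm x‖ := by
      by_contra hn
      exact hx ⟨TT.symm x, mem_closedBall_zero_iff.2 (not_lt.1 hn), by simp⟩
    simp only [hφ]
    rw [hf.v1 _ this, hf.v2 _ this, neg_zero]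
    exact map_zero TT
  have dφ : Differentiable ℝ φ := sφ.differentiable (by simp)
  have p1 := comp_PD dφ 1
  have p0 := comp_PD dφ 0
  simp only [φ0, φ1] at p0 p1
  have q0 : PD (fun z => - F.f2 z) (fun z => - F.f12 z) (fun z => - F.f22 z) :=
    (F.d2.cmul (-1)).congr (fun z => by ring) (fun z => by ring) (fun z => by ring)
  have uq : ∀ {f f1 f2 g1 g2 : ℝ × ℝ → ℝ}, PD f f1 f2 → PD f g1 g2 →
      ∀ z, f1 z = g1 z ∧ f2 z = g2 z := by
    intro f f1 f2 g1 g2 a b z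
    have := (a z).unique (b z)
    have t1 := congrArg (fun L => L ((1:ℝ), (0:ℝ))) this
    have t2 := congrArg (fun L => L ((0:ℝ), (1:ℝ))) this
    exact ⟨by simpa using t1, by simpa using t2⟩
  have r0 := uq p0 q0
  have r1 := uq p1 F.d1
  have hw := hweak φ sφ cφ (by
    intro x
    obtain ⟨z, rfl⟩ := TT.surjective x
    simp only [divg, Fin.sum_univ_two]
    rw [(r0 z).1, (r1 z).2]; ring)
  rw [← TT_int, ← TT_int] at hw
  have hr : ∀ z, fnorm (symGrad u (TT z)) = ψ.r z := by
    intro z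
    have h3 := h12 z
    have h4 := h12' z
    unfold fnorm J2.r rr
    congr 1
    simp only [frob, Fin.sum_univ_two, symGrad, J2.p, J2.q, h11 z, h22 z]
    rw [← h3, show pd u 0 (TT z) 0 = - ψ.f12 z by linarith]
    ring
  have w1 : ∀ z, frob (DH (fun t : ℝ => t * Real.log (1 + t)) (symGrad u (TT z)))
      (symGrad φ (TT z)) = ψ.Q z * (F.f11 z - F.f22 z) - 2 * ψ.P z * F.f12 z := by
    intro z
    rw [DH_eq, hr]
    have h3 := h12 z
    have h4 := h12' z
    simp only [frob, Fin.sum_univ_two, symGrad, J2.P, J2.Q, J2.p, J2.q, h11 z, h22 z,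
      Matrix.smul_apply, smul_eq_mul, (r0 z).1, (r0 z).2, (r1 z).1, (r1 z).2]
    rw [← h3, show pd u 0 (TT z) 0 = - ψ.f12 z by linarith]
    ring
  have w2 : ∀ z, ∑ k, ∑ i, u (TT z) k * pd u k (TT z) i * φ (TT z) i
      = ψ.b1 z * F.f1 z + ψ.b2 z * F.f2 z := by
    intro z
    have h3 := h12 z
    have h4 := h12' z
    simp only [Fin.sum_univ_two, J2.b1, J2.b2, h1 z, h2 z, h11 z, h22 z, φ0, φ1]
    rw [← h3, show pd u 0 (TT z) 0 = - ψ.f12 z by linarith]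
    ring
  simp only [w1, w2] at hw
  rw [← integral_add] at hw
  · rw [← hw]
    refine integral_congr_ae (Filter.Eventually.of_forall fun z => ?_)
    simp only [J2.wf]; ring
  · obtain ⟨ρ, hρ, hf⟩ := F.far cF
    refine Continuous.integrable_of_hasCompactSupport (by fun_prop) (J2.cs_of_far ρ fun z hz => ?_)
    simp [hf.v11 z hz, hf.v12 z hz, hf.v22 z hz]
  · obtain ⟨ρ, hρ, hf⟩ := F.far cF
    refine Continuous.integrable_of_hasCompactSupport (by fun_prop) (J2.cs_of_far ρ fun z hz => ?_)
    simp [hf.v1 z hz, hf.v2 z hz]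

lemma log_lower {r : ℝ} (hr : 0 ≤ r) : r / (1 + r) ≤ Real.log (1 + r) := by
  have h1 : 0 < 1 + r := by linarith
  have := Real.log_le_sub_one_of_pos (inv_pos.2 h1)
  rw [Real.log_inv] at this
  have e : r / (1 + r) = 1 - (1 + r)⁻¹ := by field_simp; ring
  rw [e]; linarith

theorem liouville_prandtl_eyring_finite_energy
    (u : EuclideanSpace ℝ (Fin 2) → EuclideanSpace ℝ (Fin 2))
    (hu : ContDiff ℝ 1 u)
    (hdiv : ∀ x, divg u x = 0)
    (hweak : IsWeakSolution (fun t : ℝ => t * Real.log (1 + t)) u)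
    (henergy : Integrable (fun x => fnorm (gradM u x) * Real.log (1 + fnorm (gradM u x)))) :
    ∃ c, ∀ x, u x = c := by
  obtain ⟨ψ, h1, h2, h11, h12, h12', h22⟩ := exists_stream hu hdiv
  have hW := stream_weak hweak ψ h1 h2 h11 h12 h12' h22
  have hg : ∀ z, fnorm (gradM u (TT z)) = ψ.g z := by
    intro z
    have e1 : fnorm (gradM u (TT z)) ^ 2 = ψ.g z ^ 2 := by
      rw [ψ.g_sq]
      have fn : 0 ≤ frob (gradM u (TT z)) (gradM u (TT z)) :=
        Finset.sum_nonneg fun i _ => Finset.sum_nonneg fun j _ => mul_self_nonneg _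
      unfold fnorm
      rw [Real.sq_sqrt fn]
      have h3 := h12 z
      have h4 := h12' z
      simp only [frob, Fin.sum_univ_two, gradM, J2.gg, h11 z, h22 z]
      rw [← h3, show pd u 0 (TT z) 0 = - ψ.f12 z by linarith]
      ring
    exact (pow_left_inj₀ (Real.sqrt_nonneg _) (ψ.g_nonneg z) two_ne_zero).1 e1
  have hi : Integrable ψ.en := by
    have := TT_mp.integrable_comp_of_integrable henergy
    refine this.mono' ψ.en_cont.aestronglyMeasurable (Filter.Eventually.of_forall fun z => ?_)
    rw [Real.norm_of_nonneg (ψ.en_nonneg z)]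
    simp only [Function.comp, hg]
    have := mul_le_mul_of_nonneg_left (log_lower (ψ.g_nonneg z)) (ψ.g_nonneg z)
    refine le_trans (le_of_eq ?_) this
    unfold J2.en; ring
  have hz := ψ.main2 hW hi
  have hd : Differentiable ℝ u := hu.differentiable (by norm_num)
  have f0 : ∀ x, fderiv ℝ u x = 0 := by
    intro x
    obtain ⟨z, rfl⟩ := TT.surjective x
    obtain ⟨a, b, c⟩ := hz z
    have g11 := h11 z
    have g12 := h12 z
    have g12' := h12' z
    have g22 := h22 z
    rw [a] at g11; rw [b] at g12 g12'; rw [c] at g22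
    have k0 : pd u 0 (TT z) = 0 := by
      ext i; fin_cases i
      · simp; linarith
      · simp; linarith
    have k1 : pd u 1 (TT z) = 0 := by
      ext i; fin_cases i
      · simp; linarith
      · simp; linarith
    ext1 v
    obtain ⟨w, rfl⟩ := TT.surjective v
    have : TT w = w.1 • EuclideanSpace.single 0 1 + w.2 • EuclideanSpace.single 1 1 := by
      rw [← TT_e0, ← TT_e1, ← map_smul, ← map_smul, ← map_add]
      congr 1
      ext <;> simp
    rw [this, map_add, map_smul, map_smul]
    change w.1 • pd u 0 (TT z) + w.2 • pd u 1 (TT z) = 0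
    rw [k0, k1]; simp
  exact ⟨u 0, fun x => is_const_of_fderiv_eq_zero hd f0 x 0⟩
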